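/- Let p ∈ (1,∞) and let T be a Calderón–Zygmund operator with normalised standard kernel of Hölder exponent γ. For s ∈ ℕ and m ∈ ℤⁿ∖{0}, let Λ_{s,m} be the linear operator acting on the Haar basis by Λ_{s,m} h^η_I := ⟨h⁰_{I^{(s)}∔m}, T h^η_I⟩ h^η_{I^{(s)}} (I ∈ 𝒟, η ∈ {0,1}ⁿ∖{0}), extended linearly to functions with finite Haar expansion. Then ‖Λ_{s,m} f‖_{L^p} ≤ C (1+s) 2^{−s·min(γ,1/2,1/p′)} (1+|m|)^{−n−γ} ‖f‖_{L^p} for all such f, with C depending only on n, p, γ. -/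

import Mathlib

open MeasureTheory

noncomputable section

open Classical in
/-- Classical indicator of a proposition. -/
def indR (P : Prop) : ℝ := if P then 1 else 0

/-- The real sign associated to a boolean. -/
def sgnB (b : Bool) : ℝ := if b then 1 else -1

/-- The `ℓ∞` norm of an integer vector, as a real number. -/
def inorm {n : ℕ} (m : Fin n → ℤ) : ℝ := ‖(fun i => (m i : ℝ) : Fin n → ℝ)‖

/-- The dyadic cube `2^{-k}([0,1)^n + m)` of generation `k` in `ℝ^n` (with the `ℓ∞` metric). -/
def dyadicCube (n : ℕ) (k : ℤ) (m : Fin n → ℤ) : Set (Fin n → ℝ) :=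
  {x | ∀ i, (2:ℝ) ^ (-k) * m i ≤ x i ∧ x i < (2:ℝ) ^ (-k) * (m i + 1)}

/-- The side length `2^{-k}` of a dyadic cube of generation `k`. -/
def sideLen (k : ℤ) : ℝ := (2:ℝ) ^ (-k)

/-- One-dimensional Haar function on the dyadic interval `2^{-k}[m, m+1)`:
the non-cancellative `h⁰` for `η = false`, the cancellative `h¹` for `η = true`. -/
def haar1D (k : ℤ) (m : ℤ) (η : Bool) (t : ℝ) : ℝ :=
  (Real.sqrt ((2:ℝ) ^ (-k)))⁻¹ *
    (if η then
        (Set.Ico ((2:ℝ) ^ (-k) * m) ((2:ℝ) ^ (-k) * (m + 1/2))).indicator 1 t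
          - (Set.Ico ((2:ℝ) ^ (-k) * (m + 1/2)) ((2:ℝ) ^ (-k) * (m + 1))).indicator 1 t
      else (Set.Ico ((2:ℝ) ^ (-k) * m) ((2:ℝ) ^ (-k) * (m + 1))).indicator 1 t)

/-- The Haar function `h^η_I` for the dyadic cube `I` indexed by `(k, m)`. -/
def haarFn (n : ℕ) (k : ℤ) (m : Fin n → ℤ) (η : Fin n → Bool) (x : Fin n → ℝ) : ℝ :=
  ∏ i, haar1D k (m i) (η i) (x i)

/-- The non-cancellative Haar function `h⁰_I = |I|^{-1/2} 1_I`. -/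
def haarZero (n : ℕ) (k : ℤ) (m : Fin n → ℤ) : (Fin n → ℝ) → ℝ :=
  haarFn n k m (fun _ => false)

/-- The pairing `⟨g, f⟩ = ∫ g f dx`. -/
def pairing {n : ℕ} (g f : (Fin n → ℝ) → ℝ) : ℝ := ∫ x, g x * f x

/-- A normalised standard kernel with Hölder exponent `γ` (with respect to the `ℓ∞` metric). -/
structure IsNormalisedKernel (n : ℕ) (γ : ℝ) (K : (Fin n → ℝ) → (Fin n → ℝ) → ℝ) : Prop where
  size : ∀ x y, x ≠ y → |K x y| ≤ dist x y ^ (-(n:ℝ))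
  smooth : ∀ x y h, 2 * ‖h‖ < dist x y →
    |K (x + h) y - K x y| + |K x (y + h) - K x y| ≤ ‖h‖ ^ γ * dist x y ^ (-(n:ℝ) - γ)

/-- The singular integral `Tf(x) = ∫ K(x,y) f(y) dy`. -/
def czIntegral {n : ℕ} (K : (Fin n → ℝ) → (Fin n → ℝ) → ℝ) (f : (Fin n → ℝ) → ℝ)
    (x : Fin n → ℝ) : ℝ := ∫ y, K x y * f y

/-- The truncated singular integral `T_ε f(x) = ∫_{|y-x|>ε} K(x,y) f(y) dy`. -/
def czTrunc {n : ℕ} (K : (Fin n → ℝ) → (Fin n → ℝ) → ℝ) (ε : ℝ) (f : (Fin n → ℝ) → ℝ)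
    (x : Fin n → ℝ) : ℝ := ∫ y in {y | ε < dist x y}, K x y * f y

/-- The dyadic conditional expectation `E_k f`. -/
def dyadicE (n : ℕ) (k : ℤ) (f : (Fin n → ℝ) → ℝ) (x : Fin n → ℝ) : ℝ :=
  (2:ℝ) ^ (k * (n:ℤ)) * ∫ y in dyadicCube n k (fun i => ⌊(2:ℝ) ^ k * x i⌋), f y

/-- The dyadic martingale difference `D_k f = E_{k+1} f - E_k f`. -/
def dyadicD (n : ℕ) (k : ℤ) (f : (Fin n → ℝ) → ℝ) (x : Fin n → ℝ) : ℝ :=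
  dyadicE n (k+1) f x - dyadicE n k f x

/-- The centre of the dyadic cube indexed by `(k, m)`. -/
def cubeCenter (n : ℕ) (k : ℤ) (m : Fin n → ℤ) : Fin n → ℝ :=
  fun i => (2:ℝ) ^ (-k) * (m i + 1/2)

/-- The concentric `c`-fold expansion of the dyadic cube indexed by `(k, m)`. -/
def expandCube (n : ℕ) (k : ℤ) (m : Fin n → ℤ) (c : ℝ) : Set (Fin n → ℝ) :=
  {x | ∀ i, |x i - cubeCenter n k m i| ≤ c * (2:ℝ) ^ (-k) / 2}

/-- The set `Σ_{f,s} = ⋃_k 9Ω_k`, where `Ω_k` is the union of the cubes `I ∈ 𝒟_k` on which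
`D_{k+s} f` is not a.e. zero. -/
def SigmaSet (n : ℕ) (f : (Fin n → ℝ) → ℝ) (s : ℕ) : Set (Fin n → ℝ) :=
  ⋃ (k : ℤ) (m : Fin n → ℤ)
    (_ : ¬ (∀ᵐ x ∂(volume.restrict (dyadicCube n k m)), dyadicD n (k + (s:ℤ)) f x = 0)),
      expandCube n k m 9

/-- The (measure-theoretic) support of a measurable function: the complement of the union of
all balls on which the function vanishes a.e. -/
def suppAE {n : ℕ} (f : (Fin n → ℝ) → ℝ) : Set (Fin n → ℝ) :=
  {x | ∀ r > 0, ¬ (∀ᵐ y ∂(volume.restrict (Metric.ball x r)), f y = 0)}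

/-- The axis-parallel closed cube with centre `c` and side length `ρ`. -/
def cube (n : ℕ) (c : Fin n → ℝ) (ρ : ℝ) : Set (Fin n → ℝ) :=
  {x | ∀ i, |x i - c i| ≤ ρ / 2}

/-- The index of the `s`-th dyadic ancestor `I^{(s)}` of the cube indexed by `(k, m)`
(the ancestor is the cube indexed by `(k - s, ancestorIdx s m)`). -/
def ancestorIdx {n : ℕ} (s : ℕ) (m : Fin n → ℤ) : Fin n → ℤ :=
  fun i => Int.fdiv (m i) (2 ^ s)

/-- The distance between two sets (in the ambient metric). -/
def setDist {α : Type*} [PseudoMetricSpace α] (A B : Set α) : ℝ :=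
  sInf (Set.image2 dist A B)

/-! ### Elementary inequalities for real powers -/

/-- The tangent line inequality for the convex function `t ↦ t ^ r` on `[0, ∞)`. -/
lemma rpow_tangent_le {r a b : ℝ} (hr : 1 ≤ r) (ha : 0 ≤ a) (hb : 0 ≤ b) :
    a ^ r + r * a ^ (r - 1) * (b - a) ≤ b ^ r := by
  rcases ha.eq_or_lt with rfl | ha
  · rcases hr.eq_or_lt with rfl | hr
    · simp
    · rw [Real.zero_rpow (by linarith), Real.zero_rpow (by linarith)]
      simpa using Real.rpow_nonneg hb r
  · have h := one_add_mul_self_le_rpow_one_add (s := b / a - 1)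
      (by have := div_nonneg hb ha.le; linarith) hr
    have h2 : (1 + (b / a - 1)) ^ r = b ^ r / a ^ r := by
      rw [add_sub_cancel, Real.div_rpow hb ha.le]
    rw [h2, le_div_iff₀ (Real.rpow_pos_of_pos ha r)] at h
    have h3 : a ^ r = a ^ (r - 1) * a := by
      rw [← Real.rpow_add_one ha.ne', sub_add_cancel]
    calc _ = (1 + r * (b / a - 1)) * a ^ r := by rw [h3]; field_simp
      _ ≤ _ := h

lemma rpow_add_le {r S z : ℝ} (hr : 1 ≤ r) (hS : 0 ≤ S) (hz : 0 ≤ z) :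
    (S + z) ^ r ≤ S ^ r + r * (z * (S + z) ^ (r - 1)) := by
  have := rpow_tangent_le hr (add_nonneg hS hz) hS
  linarith

/-- Summation by parts: a power of a sum is controlled by the partial sums. -/
lemma rpow_sum_le_partial {ι : Type*} (F : Finset ι) (κ : ι → ℤ) (z : ι → ℝ)
    (hz : ∀ i, 0 ≤ z i) {r : ℝ} (hr : 1 ≤ r) :
    (∑ i ∈ F, z i) ^ r ≤ r * ∑ i ∈ F, z i * (∑ j ∈ F with κ j ≤ κ i, z j) ^ (r - 1) := by
  classical
  induction F using Finset.induction_on_max_value κ with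
  | empty => simp [Real.zero_rpow (by linarith : r ≠ 0)]
  | insert a s has hmax ih =>
    rw [Finset.sum_insert has, Finset.sum_insert has, add_comm (z a)]
    have hS : 0 ≤ ∑ i ∈ s, z i := Finset.sum_nonneg fun i _ => hz i
    have h1 := rpow_add_le hr hS (hz a)
    have hf : (insert a s).filter (fun j => κ j ≤ κ a) = insert a s := by
      apply Finset.filter_true_of_mem
      intro j hj
      rcases Finset.mem_insert.1 hj with rfl | hj
      · exact le_rfl
      · exact hmax j hj
    have h2 : ∑ i ∈ s, z i * (∑ j ∈ s with κ j ≤ κ i, z j) ^ (r - 1) ≤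
        ∑ i ∈ s, z i * (∑ j ∈ insert a s with κ j ≤ κ i, z j) ^ (r - 1) := by
      refine Finset.sum_le_sum fun i _ => ?_
      refine mul_le_mul_of_nonneg_left ?_ (hz i)
      refine Real.rpow_le_rpow (Finset.sum_nonneg fun i _ => hz i) ?_ (by linarith)
      refine Finset.sum_le_sum_of_subset_of_nonneg ?_ fun i _ _ => hz i
      exact Finset.filter_subset_filter _ (Finset.subset_insert _ _)
    rw [hf, Finset.sum_insert has, add_comm (z a)]
    have h3 := mul_le_mul_of_nonneg_left h2 (by linarith : (0:ℝ) ≤ r)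
    linarith

lemma mul_rpow_neg_le {S z b : ℝ} (hb0 : 0 ≤ b) (hb1 : b < 1) (hS : 0 ≤ S) (hz : 0 ≤ z) :
    z * (S + z) ^ (-b) ≤ (1 - b)⁻¹ * ((S + z) ^ (1 - b) - S ^ (1 - b)) := by
  rcases (add_nonneg hS hz).eq_or_lt with h | h
  · have h1 : S = 0 := by linarith
    have h2 : z = 0 := by linarith
    simp [h1, h2]
  · have hpos : 0 < 1 - b := by linarith
    have hx : -1 ≤ S / (S + z) - 1 := by
      have := div_nonneg hS h.le; linarith
    have h1 := rpow_one_add_le_one_add_mul_self hx hpos.le (by linarith)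
    rw [add_sub_cancel, Real.div_rpow hS h.le,
      div_le_iff₀ (Real.rpow_pos_of_pos h _)] at h1
    have h3 : (S + z) ^ (1 - b) = (S + z) ^ (-b) * (S + z) := by
      rw [← Real.rpow_add_one h.ne']; congr 1; ring
    rw [inv_mul_eq_div, le_div_iff₀ hpos]
    have h4 : (1 + (1 - b) * (S / (S + z) - 1)) * (S + z) ^ (1 - b)
        = (S + z) ^ (1 - b) - z * (S + z) ^ (-b) * (1 - b) := by
      rw [h3]; field_simp; ring
    linarith

/-- Summation by parts with a decreasing weight. -/
lemma sum_mul_partial_rpow_neg_le {ι : Type*} (F : Finset ι) (κ : ι → ℤ) (z : ι → ℝ)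
    (hz : ∀ i, 0 ≤ z i) {b : ℝ} (hb0 : 0 ≤ b) (hb1 : b < 1) :
    ∑ i ∈ F, z i * (∑ j ∈ F with κ j ≤ κ i, z j) ^ (-b) ≤
      (1 - b)⁻¹ * (∑ i ∈ F, z i) ^ (1 - b) := by
  classical
  induction F using Finset.induction_on_max_value κ with
  | empty => simp [Real.zero_rpow (by linarith : 1 - b ≠ 0)]
  | insert a s has hmax ih =>
    rw [Finset.sum_insert has, Finset.sum_insert has, add_comm (z a)]
    have hS : 0 ≤ ∑ i ∈ s, z i := Finset.sum_nonneg fun i _ => hz i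
    have h1 := mul_rpow_neg_le hb0 hb1 hS (hz a)
    have hf : (insert a s).filter (fun j => κ j ≤ κ a) = insert a s := by
      apply Finset.filter_true_of_mem
      intro j hj
      rcases Finset.mem_insert.1 hj with rfl | hj
      · exact le_rfl
      · exact hmax j hj
    have h2 : ∑ i ∈ s, z i * (∑ j ∈ insert a s with κ j ≤ κ i, z j) ^ (-b) ≤
        ∑ i ∈ s, z i * (∑ j ∈ s with κ j ≤ κ i, z j) ^ (-b) := by
      refine Finset.sum_le_sum fun i hi => ?_
      rcases (hz i).eq_or_lt with h | h
      · simp [← h]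
      refine mul_le_mul_of_nonneg_left ?_ (hz i)
      have hpos : 0 < ∑ j ∈ s with κ j ≤ κ i, z j := by
        refine lt_of_lt_of_le h (Finset.single_le_sum (f := z) (fun j _ => hz j) ?_)
        simp [hi]
      refine Real.rpow_le_rpow_of_nonpos hpos ?_ (by linarith)
      refine Finset.sum_le_sum_of_subset_of_nonneg ?_ fun i _ _ => hz i
      exact Finset.filter_subset_filter _ (Finset.subset_insert _ _)
    rw [hf, Finset.sum_insert has, add_comm (z a)]
    linarith

/-- The derivative `a * sign x * |x| ^ (a - 1)` of `|x| ^ a`. -/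
def absRpowDeriv (a x : ℝ) : ℝ := a * (SignType.sign x * |x| ^ (a - 1))

lemma absRpowDeriv_neg (a x : ℝ) : absRpowDeriv a (-x) = -absRpowDeriv a x := by
  simp [absRpowDeriv, Left.sign_neg]

lemma absRpowDeriv_of_nonneg {a x : ℝ} (hx : 0 ≤ x) (ha : 1 < a) :
    absRpowDeriv a x = a * x ^ (a - 1) := by
  rcases hx.eq_or_lt with rfl | hx
  · simp [absRpowDeriv, Real.zero_rpow (by linarith : a - 1 ≠ 0)]
  · simp [absRpowDeriv, sign_pos hx, abs_of_pos hx]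

/-- The subgradient inequality for `|x| ^ a`. -/
lemma abs_rpow_tangent_le {a : ℝ} (ha : 1 ≤ a) (x y : ℝ) :
    |x| ^ a + absRpowDeriv a x * (y - x) ≤ |y| ^ a := by
  wlog hx : 0 ≤ x generalizing x y
  · have := this (-x) (-y) (by linarith)
    rw [absRpowDeriv_neg, abs_neg, abs_neg] at this
    linarith
  rcases hx.eq_or_lt with rfl | hx
  · simp only [absRpowDeriv, sign_zero, SignType.coe_zero, abs_zero]
    rw [Real.zero_rpow (by linarith)]
    simpa using Real.rpow_nonneg (abs_nonneg y) a
  · have hd : absRpowDeriv a x = a * x ^ (a - 1) := by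
      simp [absRpowDeriv, sign_pos hx, abs_of_pos hx]
    have h := rpow_tangent_le ha hx.le (abs_nonneg y)
    have h0 : 0 ≤ a * x ^ (a - 1) := mul_nonneg (by linarith) (Real.rpow_nonneg hx.le _)
    have h1 := mul_le_mul_of_nonneg_left (sub_le_sub_right (le_abs_self y) x) h0
    rw [hd, abs_of_pos hx]
    linarith

lemma mul_sub_rpow_le {a x d : ℝ} (ha : 1 ≤ a) (hx : 0 ≤ x) (hy : 0 ≤ x + d) :
    d * ((x + d) ^ a - x ^ a) ≤ a * d ^ 2 * (x + |d|) ^ (a - 1) := by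
  rcases le_total 0 d with hd | hd
  · have h := rpow_tangent_le ha hy hx
    have h2 : (x + d) ^ a - x ^ a ≤ a * (x + d) ^ (a - 1) * d := by linarith
    rw [abs_of_nonneg hd]
    nlinarith [mul_le_mul_of_nonneg_left h2 hd]
  · have h := rpow_tangent_le ha hx hy
    have h2 : x ^ a - (x + d) ^ a ≤ a * x ^ (a - 1) * (-d) := by linarith
    have h3 : x ^ (a - 1) ≤ (x + |d|) ^ (a - 1) :=
      Real.rpow_le_rpow hx (by linarith [abs_nonneg d]) (by linarith)
    have h4 : a * d ^ 2 * x ^ (a - 1) ≤ a * d ^ 2 * (x + |d|) ^ (a - 1) :=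
      mul_le_mul_of_nonneg_left h3 (by positivity)
    nlinarith [mul_le_mul_of_nonneg_left h2 (neg_nonneg.2 hd)]

lemma add_rpow_le_two_rpow {a x y : ℝ} (ha : 0 ≤ a) (hx : 0 ≤ x) (hy : 0 ≤ y) :
    (x + y) ^ a ≤ 2 ^ a * (x ^ a + y ^ a) := by
  have h : x + y ≤ 2 * max x y := by linarith [le_max_left x y, le_max_right x y]
  calc (x + y) ^ a ≤ (2 * max x y) ^ a := Real.rpow_le_rpow (by positivity) h ha
    _ = 2 ^ a * (max x y) ^ a := Real.mul_rpow (by norm_num) (le_max_of_le_left hx)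
    _ ≤ _ := by
      refine mul_le_mul_of_nonneg_left ?_ (by positivity)
      rcases max_cases x y with h | h <;> rw [h.1]
      · linarith [Real.rpow_nonneg hy a]
      · linarith [Real.rpow_nonneg hx a]

/-- A second order Taylor estimate for `|x| ^ q`. -/
lemma abs_add_rpow_le_taylor {q : ℝ} (hq : 2 ≤ q) (x d : ℝ) :
    |x + d| ^ q ≤ |x| ^ q + absRpowDeriv q x * d +
      (q * (q - 1) * 2 ^ (q - 2) + 1 + q) * (d ^ 2 * (|x| ^ (q - 2) + |d| ^ (q - 2))) := by
  wlog hx : 0 ≤ x generalizing x d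
  · have := this (-x) (-d) (by linarith)
    rw [absRpowDeriv_neg, ← neg_add, abs_neg, abs_neg, abs_neg] at this
    simpa using this
  rw [absRpowDeriv_of_nonneg hx (by linarith), abs_of_nonneg hx]
  have hxq : 0 ≤ x ^ (q - 2) := Real.rpow_nonneg hx _
  have hdq : 0 ≤ |d| ^ (q - 2) := Real.rpow_nonneg (abs_nonneg d) _
  have h2q : (0:ℝ) ≤ 2 ^ (q - 2) := by positivity
  have hqq : 0 ≤ q * (q - 1) := mul_nonneg (by linarith) (by linarith)
  rcases le_or_gt 0 (x + d) with hy | hy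
  · rw [abs_of_nonneg hy]
    have h1 := rpow_tangent_le (by linarith : 1 ≤ q) hy hx
    have h2 := mul_sub_rpow_le (a := q - 1) (by linarith) hx hy
    have h3 := add_rpow_le_two_rpow (a := q - 2) (by linarith) hx (abs_nonneg d)
    have e : q - 1 - 1 = q - 2 := by ring
    rw [e] at h2
    have h4 : (q - 1) * d ^ 2 * (x + |d|) ^ (q - 2) ≤
        (q - 1) * d ^ 2 * (2 ^ (q - 2) * (x ^ (q - 2) + |d| ^ (q - 2))) :=
      mul_le_mul_of_nonneg_left h3 (mul_nonneg (by linarith) (sq_nonneg d))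
    have h5 := mul_le_mul_of_nonneg_left (h2.trans h4) (by linarith : 0 ≤ q)
    have h6 : 0 ≤ (1 + q) * (d ^ 2 * (x ^ (q - 2) + |d| ^ (q - 2))) := by positivity
    nlinarith
  · have hd : |d| = -d := abs_of_neg (by linarith)
    have h1 : |x + d| ≤ |d| := by rw [abs_of_neg hy, hd]; linarith
    have h2 : |x + d| ^ q ≤ |d| ^ q := Real.rpow_le_rpow (abs_nonneg _) h1 (by linarith)
    have hxd : x ≤ |d| := by rw [hd]; linarith
    have hdpos : 0 < |d| := by rw [hd]; linarith
    have h3 : x ^ (q - 1) ≤ |d| ^ (q - 1) := Real.rpow_le_rpow hx hxd (by linarith)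
    have e1 : |d| ^ q = |d| ^ (q - 1) * |d| := by
      rw [← Real.rpow_add_one hdpos.ne', sub_add_cancel]
    have e2 : |d| ^ q = |d| ^ (q - 2) * d ^ 2 := by
      rw [← sq_abs, ← Real.rpow_natCast, ← Real.rpow_add hdpos]; congr 1; push_cast; ring
    have h4 : -(q * |d| ^ q) ≤ q * x ^ (q - 1) * d := by
      have := mul_le_mul_of_nonneg_right h3 hdpos.le
      rw [← e1] at this
      have h5 := mul_le_mul_of_nonneg_left this (by linarith : 0 ≤ q)
      have h6 : d = -|d| := by rw [hd]; ring
      rw [h6]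
      simp only [abs_neg, abs_abs]
      linarith
    have hX : 0 ≤ x ^ q := Real.rpow_nonneg hx _
    have h7 : (1 + q) * |d| ^ q ≤ (q * (q - 1) * 2 ^ (q - 2) + 1 + q) *
        (d ^ 2 * (x ^ (q - 2) + |d| ^ (q - 2))) := by
      rw [e2]
      have h8 : |d| ^ (q - 2) * d ^ 2 ≤ d ^ 2 * (x ^ (q - 2) + |d| ^ (q - 2)) := by
        nlinarith [mul_nonneg (sq_nonneg d) hxq]
      have h9 : 0 ≤ d ^ 2 * (x ^ (q - 2) + |d| ^ (q - 2)) := by positivity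
      have h10 : 0 ≤ q * (q - 1) * 2 ^ (q - 2) := by positivity
      nlinarith [mul_nonneg h10 h9]
    nlinarith

/-- Absorption of a product of powers. -/
lemma mul_rpow_sub_one_le_absorb {r U V : ℝ} (hr : 1 ≤ r) (hU : 0 ≤ U) (hV : 0 ≤ V) :
    r * (U * V ^ (r - 1)) ≤ 1 / 2 * V ^ r + (2 * r) ^ r * U ^ r := by
  rcases hV.eq_or_lt with rfl | hV'
  · rcases hr.eq_or_lt with rfl | hr'
    · simp only [sub_self, Real.rpow_zero, Real.rpow_one]; linarith
    · rw [Real.zero_rpow (by linarith), Real.zero_rpow (by linarith)]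
      simp only [mul_zero, zero_add]; positivity
  have e : V ^ r = V ^ (r - 1) * V := by
    rw [← Real.rpow_add_one hV'.ne', sub_add_cancel]
  have hp : 0 ≤ V ^ (r - 1) := Real.rpow_nonneg hV _
  rcases le_total V (2 * r * U) with h | h
  · have h1 : V ^ (r - 1) ≤ (2 * r * U) ^ (r - 1) := Real.rpow_le_rpow hV h (by linarith)
    have hpos : 0 < 2 * r * U := lt_of_lt_of_le hV' h
    have e2 : (2 * r) ^ r * U ^ r = (2 * r * U) ^ (r - 1) * (2 * r * U) := by
      rw [← Real.mul_rpow (by linarith) hU, ← Real.rpow_add_one hpos.ne', sub_add_cancel]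
    rw [e2]
    have h2 := mul_le_mul_of_nonneg_right h1 (by nlinarith : 0 ≤ r * U)
    have h3 : 0 ≤ (2 * r * U) ^ (r - 1) * (r * U) :=
      mul_nonneg (Real.rpow_nonneg hpos.le _) (by nlinarith)
    have h4 : 0 ≤ V ^ r := Real.rpow_nonneg hV _
    nlinarith
  · have h2 := mul_le_mul_of_nonneg_right h hp
    have h3 : 0 ≤ (2 * r) ^ r * U ^ r := by positivity
    nlinarith

lemma mul_rpow_le_absorb {M q a b f A : ℝ} (hM : 0 ≤ M) (hb : b < 1) (ha : 0 ≤ a)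
    (hq : q = a + 2 * (1 - b)) (hf : 0 ≤ f) (hA : 0 ≤ A) :
    M * (f ^ a * A ^ (1 - b)) ≤
      1 / 2 * f ^ q + M * ((2 * M + 1) ^ (1 - b)⁻¹) ^ (a / 2) * A ^ (q / 2) := by
  have hb' : 0 < 1 - b := by linarith
  set t : ℝ := (2 * M + 1) ^ (1 - b)⁻¹ with ht
  have htpos : 0 < t := Real.rpow_pos_of_pos (by linarith) _
  have htp : t ^ (1 - b) = 2 * M + 1 := by
    rw [ht, ← Real.rpow_mul (by linarith), inv_mul_cancel₀ hb'.ne', Real.rpow_one]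
  have hq0 : q ≠ 0 := by rw [hq]; positivity
  rcases hf.eq_or_lt with rfl | hf'
  · rw [Real.zero_rpow hq0, mul_zero, zero_add]
    rcases ha.eq_or_lt with rfl | ha
    · have : q / 2 = 1 - b := by rw [hq]; ring
      rw [this]; simp
    · rw [Real.zero_rpow ha.ne']; simp only [zero_mul, mul_zero]; positivity
  rcases le_total (t * A) (f ^ 2) with h | h
  · have h1 : (t * A) ^ (1 - b) ≤ (f ^ 2) ^ (1 - b) := Real.rpow_le_rpow (by positivity) h hb'.le
    rw [Real.mul_rpow htpos.le hA, htp, ← Real.rpow_natCast, ← Real.rpow_mul hf] at h1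
    have e : f ^ q = f ^ a * f ^ (((2:ℕ):ℝ) * (1 - b)) := by
      rw [← Real.rpow_add hf', hq]; norm_num
    have hfa : 0 ≤ f ^ a := by positivity
    have h2 := (mul_le_mul_of_nonneg_left h1 hfa).trans_eq e.symm
    have h3 : 0 ≤ M * t ^ (a / 2) * A ^ (q / 2) := by positivity
    have h4 : 0 ≤ f ^ a * A ^ (1 - b) := by positivity
    have h5 : f ^ a * ((2 * M + 1) * A ^ (1 - b)) =
        2 * (M * (f ^ a * A ^ (1 - b))) + f ^ a * A ^ (1 - b) := by ring
    linarith
  · have h1 : f ^ a ≤ (t * A) ^ (a / 2) := by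
      calc f ^ a = (f ^ 2) ^ (a / 2) := by
            rw [← Real.rpow_natCast, ← Real.rpow_mul hf]; congr 1; push_cast; ring
        _ ≤ _ := Real.rpow_le_rpow (by positivity) h (by positivity)
    have hApos : 0 < A := by
      by_contra hc
      have : A = 0 := le_antisymm (not_lt.1 hc) hA
      rw [this, mul_zero] at h
      have : 0 < f ^ 2 := by positivity
      linarith
    have e : A ^ (q / 2) = A ^ (a / 2) * A ^ (1 - b) := by
      rw [← Real.rpow_add hApos, hq]; congr 1; ring
    rw [Real.mul_rpow htpos.le hA] at h1
    have h2 := mul_le_mul_of_nonneg_right h1 (by positivity : 0 ≤ A ^ (1 - b))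
    have h3 := mul_le_mul_of_nonneg_left h2 hM
    have h4 : 0 ≤ f ^ q := by positivity
    rw [e]
    nlinarith

/-- Splitting a power according to the size of `f` relative to `A ^ (1/2)`. -/
lemma rpow_sub_two_le {q a b f A : ℝ} (hq2 : 2 ≤ q) (haq : q - 2 ≤ a)
    (hq : q = a + 2 * (1 - b)) (hf : 0 ≤ f) (hA : 0 < A) :
    f ^ (q - 2) ≤ A ^ (q / 2 - 1) + A ^ (-b) * f ^ a := by
  rcases le_total (f ^ 2) A with h | h
  · have h1 : f ^ (q - 2) ≤ A ^ (q / 2 - 1) := by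
      calc f ^ (q - 2) = (f ^ 2) ^ (q / 2 - 1) := by
            rw [← Real.rpow_natCast, ← Real.rpow_mul hf]; congr 1; push_cast; ring
        _ ≤ _ := Real.rpow_le_rpow (by positivity) h (by linarith)
    have : 0 ≤ A ^ (-b) * f ^ a := by positivity
    linarith
  · have hf' : 0 < f := by
      rcases hf.eq_or_lt with rfl | h'
      · simp at h; linarith
      · exact h'
    have h1 : (f ^ 2) ^ (-b) ≤ A ^ (-b) :=
      Real.rpow_le_rpow_of_nonpos hA h (by linarith)
    have e : f ^ (q - 2) = (f ^ 2) ^ (-b) * f ^ a := by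
      rw [← Real.rpow_natCast, ← Real.rpow_mul hf, ← Real.rpow_add hf']
      congr 1; push_cast; linarith
    rw [e]
    have h2 := mul_le_mul_of_nonneg_right h1 (by positivity : 0 ≤ f ^ a)
    have : 0 ≤ A ^ (q / 2 - 1) := by positivity
    linarith

section

variable {n : ℕ}

/-! ### Dyadic cubes and step functions -/

variable {n : ℕ}

/-- The index of the dyadic cube of generation `k` containing `x`. -/
def dyadicIdx (k : ℤ) (x : Fin n → ℝ) : Fin n → ℤ := fun i => ⌊(2:ℝ) ^ k * x i⌋

/-- The lower corner of a dyadic cube. -/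
def dyadicCorner (k : ℤ) (μ : Fin n → ℤ) : Fin n → ℝ := fun i => (2:ℝ) ^ (-k) * μ i

lemma dyadicIdx_corner (k : ℤ) (μ : Fin n → ℤ) : dyadicIdx k (dyadicCorner k μ) = μ := by
  funext i
  simp only [dyadicIdx, dyadicCorner]
  rw [← mul_assoc, ← zpow_add₀ (by norm_num : (2:ℝ) ≠ 0)]
  simp

lemma ancestorIdx_dyadicIdx (s : ℕ) (k : ℤ) (x : Fin n → ℝ) :
    ancestorIdx s (dyadicIdx k x) = dyadicIdx (k - s) x := by
  funext i
  simp only [ancestorIdx, dyadicIdx]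
  rw [Int.fdiv_eq_ediv_of_nonneg _ (by positivity)]
  have h := Int.floor_div_natCast ((2:ℝ) ^ k * x i) (2 ^ s)
  push_cast at h
  rw [← h, zpow_sub₀ (by norm_num), zpow_natCast]
  congr 1; ring

/-- `v` is constant on dyadic cubes of generation `k`. -/
def IsStep (k : ℤ) (v : (Fin n → ℝ) → ℝ) : Prop :=
  ∀ x y, dyadicIdx k x = dyadicIdx k y → v x = v y

lemma IsStep.mono {k l : ℤ} (hkl : k ≤ l) {v : (Fin n → ℝ) → ℝ} (hv : IsStep k v) :
    IsStep l v := by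
  intro x y h
  apply hv
  obtain ⟨s, hs⟩ := Int.eq_ofNat_of_zero_le (sub_nonneg.2 hkl)
  have e : k = l - s := by linarith
  rw [e, ← ancestorIdx_dyadicIdx, ← ancestorIdx_dyadicIdx, h]

lemma IsStep.eq_corner {k : ℤ} {v : (Fin n → ℝ) → ℝ} (hv : IsStep k v) (x : Fin n → ℝ) :
    v x = v (dyadicCorner k (dyadicIdx k x)) := by
  apply hv
  rw [dyadicIdx_corner]

lemma IsStep.comp {k : ℤ} {v : (Fin n → ℝ) → ℝ} (hv : IsStep k v) (φ : ℝ → ℝ) :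
    IsStep k (fun x => φ (v x)) := fun x y h => by simp only [hv x y h]

lemma IsStep.comp₂ {k : ℤ} {v w : (Fin n → ℝ) → ℝ} (hv : IsStep k v) (hw : IsStep k w)
    (φ : ℝ → ℝ → ℝ) : IsStep k (fun x => φ (v x) (w x)) := fun x y h => by
  simp only [hv x y h, hw x y h]

lemma IsStep.sum {ι : Type*} {k : ℤ} (F : Finset ι) {v : ι → (Fin n → ℝ) → ℝ}
    (hv : ∀ i ∈ F, IsStep k (v i)) : IsStep k (fun x => ∑ i ∈ F, v i x) := fun x y h =>
  Finset.sum_congr rfl fun i hi => hv i hi x y h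

lemma measurable_dyadicIdx (k : ℤ) : Measurable (dyadicIdx k : (Fin n → ℝ) → Fin n → ℤ) := by
  refine measurable_pi_lambda _ fun i => ?_
  exact Int.measurable_floor.comp ((measurable_pi_apply i).const_mul _)

lemma IsStep.measurable {k : ℤ} {v : (Fin n → ℝ) → ℝ} (hv : IsStep k v) : Measurable v := by
  have : v = (fun μ => v (dyadicCorner k μ)) ∘ dyadicIdx k := by
    funext x; exact hv.eq_corner x
  rw [this]
  exact (measurable_of_countable _).comp (measurable_dyadicIdx k)

/-- A dyadic step function with bounded support. -/
def IsNice (v : (Fin n → ℝ) → ℝ) : Prop :=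
  ∃ (N : ℤ) (R : ℝ), IsStep N v ∧ ∀ x, R < ‖x‖ → v x = 0

lemma IsNice.comp₂ {u v : (Fin n → ℝ) → ℝ} (hu : IsNice u) (hv : IsNice v) (φ : ℝ → ℝ → ℝ)
    (hφ : φ 0 0 = 0) : IsNice (fun x => φ (u x) (v x)) := by
  obtain ⟨N, R, h1, h2⟩ := hu
  obtain ⟨N', R', h1', h2'⟩ := hv
  refine ⟨max N N', max R R', ?_, ?_⟩
  · exact (h1.mono (le_max_left _ _)).comp₂ (h1'.mono (le_max_right _ _)) φ
  · intro x hx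
    beta_reduce
    rw [h2 x (lt_of_le_of_lt (le_max_left _ _) hx), h2' x (lt_of_le_of_lt (le_max_right _ _) hx),
      hφ]

lemma IsNice.comp {u : (Fin n → ℝ) → ℝ} (hu : IsNice u) (φ : ℝ → ℝ) (hφ : φ 0 = 0) :
    IsNice (fun x => φ (u x)) := hu.comp₂ hu (fun a _ => φ a) hφ

lemma IsNice.mul {u v : (Fin n → ℝ) → ℝ} (hu : IsNice u) (hv : IsNice v) :
    IsNice (fun x => u x * v x) := hu.comp₂ hv (fun a b => a * b) (by simp)

lemma IsNice.add {u v : (Fin n → ℝ) → ℝ} (hu : IsNice u) (hv : IsNice v) :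
    IsNice (fun x => u x + v x) := hu.comp₂ hv (fun a b => a + b) (by simp)

lemma IsNice.const_mul {u : (Fin n → ℝ) → ℝ} (hu : IsNice u) (c : ℝ) :
    IsNice (fun x => c * u x) := hu.comp (fun a => c * a) (by simp)

lemma IsNice.mul_step {u v : (Fin n → ℝ) → ℝ} (hu : IsNice u) {k : ℤ} (hv : IsStep k v) :
    IsNice (fun x => u x * v x) := by
  obtain ⟨N, R, h1, h2⟩ := hu
  refine ⟨max N k, R, ?_, ?_⟩
  · exact (h1.mono (le_max_left _ _)).comp₂ (hv.mono (le_max_right _ _)) (· * ·)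
  · intro x hx
    beta_reduce
    rw [h2 x hx, zero_mul]

lemma isNice_zero : IsNice (fun _ : Fin n → ℝ => (0:ℝ)) := ⟨0, 0, fun _ _ _ => rfl, fun _ _ => rfl⟩

lemma IsNice.sum {ι : Type*} (F : Finset ι) {v : ι → (Fin n → ℝ) → ℝ}
    (hv : ∀ i ∈ F, IsNice (v i)) : IsNice (fun x => ∑ i ∈ F, v i x) := by
  classical
  induction F using Finset.induction_on with
  | empty => simpa using isNice_zero
  | insert a s ha ih =>
    simp only [Finset.sum_insert ha]
    exact (hv a (Finset.mem_insert_self _ _)).add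
      (ih fun i hi => hv i (Finset.mem_insert_of_mem hi))

lemma IsNice.exists_bound {u : (Fin n → ℝ) → ℝ} (hu : IsNice u) : ∃ C, ∀ x, ‖u x‖ ≤ C := by
  obtain ⟨N, R, h1, h2⟩ := hu
  have hfin : (Set.range u).Finite := by
    have hs : Set.range u ⊆ insert 0 ((fun μ => u (dyadicCorner N μ)) ''
        (Set.pi Set.univ fun _ : Fin n => Set.Icc ⌊-((2:ℝ) ^ N * R)⌋ ⌊(2:ℝ) ^ N * R⌋)) := by
      rintro _ ⟨x, rfl⟩
      by_cases hx : R < ‖x‖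
      · rw [h2 x hx]; exact Set.mem_insert _ _
      · refine Set.mem_insert_of_mem _ ⟨dyadicIdx N x, ?_, (h1.eq_corner x).symm⟩
        intro i _
        have hxi : |x i| ≤ R := (norm_le_pi_norm x i).trans (not_lt.1 hx)
        have hp : (0:ℝ) < (2:ℝ) ^ N := by positivity
        obtain ⟨ha, hb⟩ := abs_le.1 hxi
        constructor
        · apply Int.floor_le_floor; nlinarith
        · apply Int.floor_le_floor; nlinarith
    refine Set.Finite.subset ?_ hs
    refine Set.Finite.insert _ (Set.Finite.image _ ?_)
    exact Set.Finite.pi fun _ => Set.finite_Icc _ _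
  obtain ⟨C, hC⟩ := hfin.isBounded.exists_norm_le
  exact ⟨C, fun x => hC _ ⟨x, rfl⟩⟩

lemma IsNice.measurable {u : (Fin n → ℝ) → ℝ} (hu : IsNice u) : Measurable u := by
  obtain ⟨N, R, h1, h2⟩ := hu
  exact h1.measurable

lemma IsNice.integrable {u : (Fin n → ℝ) → ℝ} (hu : IsNice u) : Integrable u := by
  obtain ⟨C, hC⟩ := hu.exists_bound
  have hm := hu.measurable
  obtain ⟨N, R, h1, h2⟩ := hu
  have hs : Function.support u ⊆ Metric.closedBall 0 R := by
    intro x hx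
    by_contra hc
    apply hx
    apply h2
    simpa using hc
  rw [← integrableOn_iff_integrable_of_support_subset hs]
  exact Measure.integrableOn_of_bounded
    (isCompact_closedBall (0 : Fin n → ℝ) R).measure_lt_top.ne hm.aestronglyMeasurable
    (Filter.Eventually.of_forall hC)

/-! ### Haar functions -/

/-- Indices of Haar functions: generation, position and type. -/
abbrev HaarIndex (n : ℕ) := ℤ × (Fin n → ℤ) × (Fin n → Bool)

/-- The Haar function with a given index. -/
def haar (q : HaarIndex n) : (Fin n → ℝ) → ℝ := haarFn n q.1 q.2.1 q.2.2

open Classical in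
/-- The normalised indicator of the cube of a Haar index. -/
def density (q : HaarIndex n) (x : Fin n → ℝ) : ℝ :=
  if dyadicIdx q.1 x = q.2.1 then ((2:ℝ) ^ q.1) ^ n else 0

lemma density_nonneg (q : HaarIndex n) (x : Fin n → ℝ) : 0 ≤ density q x := by
  unfold density; split_ifs <;> positivity

lemma mem_dyadic_Ico_iff (k a : ℤ) (t : ℝ) :
    t ∈ Set.Ico ((2:ℝ) ^ (-k) * a) ((2:ℝ) ^ (-k) * (a + 1)) ↔ ⌊(2:ℝ) ^ k * t⌋ = a := by
  have hp : (0:ℝ) < (2:ℝ) ^ k := by positivity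
  rw [Int.floor_eq_iff, zpow_neg, Set.mem_Ico, inv_mul_le_iff₀ hp, lt_inv_mul_iff₀ hp]

lemma haar1D_eq (k a : ℤ) (η : Bool) (t : ℝ) :
    haar1D k a η t = if ⌊(2:ℝ) ^ k * t⌋ = a then
      (Real.sqrt ((2:ℝ) ^ (-k)))⁻¹ * (if η ∧ ⌊(2:ℝ) ^ (k + 1) * t⌋ = 2 * a + 1 then -1 else 1)
      else 0 := by
  have h0 := mem_dyadic_Ico_iff k a t
  have h1 := mem_dyadic_Ico_iff (k + 1) (2 * a) t
  have h2 := mem_dyadic_Ico_iff (k + 1) (2 * a + 1) t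
  have e : (2:ℝ) ^ (-k) = 2 * (2:ℝ) ^ (-(k + 1)) := by
    rw [← zpow_one_add₀ (by norm_num)]; congr 1; ring
  have hp : (0:ℝ) < (2:ℝ) ^ (-(k + 1)) := by positivity
  have e1 : (2:ℝ) ^ (-(k + 1)) * ((2 * a : ℤ) : ℝ) = (2:ℝ) ^ (-k) * a := by
    rw [e]; push_cast; ring
  have e2 : (2:ℝ) ^ (-(k + 1)) * (((2 * a : ℤ) : ℝ) + 1) = (2:ℝ) ^ (-k) * (a + 1 / 2) := by
    rw [e]; push_cast; ring
  have e3 : (2:ℝ) ^ (-(k + 1)) * ((2 * a + 1 : ℤ) : ℝ) = (2:ℝ) ^ (-k) * (a + 1 / 2) := by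
    rw [e]; push_cast; ring
  have e4 : (2:ℝ) ^ (-(k + 1)) * (((2 * a + 1 : ℤ) : ℝ) + 1) = (2:ℝ) ^ (-k) * (a + 1) := by
    rw [e]; push_cast; ring
  rw [e1, e2] at h1
  rw [e3, e4] at h2
  have hk : (0:ℝ) < (2:ℝ) ^ (-k) := by positivity
  unfold haar1D
  simp only [Set.indicator_apply, Pi.one_apply]
  cases η with
  | false =>
    simp only [h0, Bool.false_eq_true, false_and, if_false]
    by_cases h : ⌊(2:ℝ) ^ k * t⌋ = a
    · rw [if_pos h, if_pos h]
    · rw [if_neg h, if_neg h, mul_zero]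
  | true =>
    simp only [if_true]
    by_cases ht : t < (2:ℝ) ^ (-k) * (a + 1 / 2)
    · have n2 : ⌊(2:ℝ) ^ (k + 1) * t⌋ ≠ 2 * a + 1 := fun h => by
        have := (h2.2 h).1; linarith
      have n3 : t ∉ Set.Ico ((2:ℝ) ^ (-k) * (a + 1 / 2)) ((2:ℝ) ^ (-k) * (a + 1)) :=
        fun h => n2 (h2.1 h)
      have n4 : t ∈ Set.Ico ((2:ℝ) ^ (-k) * a) ((2:ℝ) ^ (-k) * (a + 1 / 2)) ↔
          ⌊(2:ℝ) ^ k * t⌋ = a := by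
        rw [← h0]
        refine ⟨fun h => ⟨h.1, h.2.trans (by nlinarith)⟩, fun h => ⟨h.1, ht⟩⟩
      simp only [if_neg n3, n4, n2, and_false, if_false, sub_zero]
      by_cases h : ⌊(2:ℝ) ^ k * t⌋ = a
      · rw [if_pos h, if_pos h]
      · rw [if_neg h, if_neg h, mul_zero]
    · have n3 : t ∉ Set.Ico ((2:ℝ) ^ (-k) * a) ((2:ℝ) ^ (-k) * (a + 1 / 2)) := fun h => ht h.2
      have n4 : t ∈ Set.Ico ((2:ℝ) ^ (-k) * (a + 1 / 2)) ((2:ℝ) ^ (-k) * (a + 1)) ↔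
          ⌊(2:ℝ) ^ k * t⌋ = a := by
        rw [← h0]
        refine ⟨fun h => ⟨le_trans (by nlinarith) h.1, h.2⟩, fun h => ⟨not_lt.1 ht, h.2⟩⟩
      simp only [if_neg n3, n4]
      by_cases hf : ⌊(2:ℝ) ^ k * t⌋ = a
      · have := h2.1 (n4.2 hf)
        rw [if_pos hf, if_pos hf, if_pos ⟨trivial, this⟩, zero_sub]
      · rw [if_neg hf, if_neg hf, sub_zero, mul_zero]

lemma haar1D_sq (k a : ℤ) (η : Bool) (t : ℝ) :
    haar1D k a η t ^ 2 = if ⌊(2:ℝ) ^ k * t⌋ = a then (2:ℝ) ^ k else 0 := by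
  rw [haar1D_eq]
  split_ifs
  · rw [mul_pow, inv_pow, Real.sq_sqrt (by positivity), zpow_neg, inv_inv]; norm_num
  · rw [mul_pow, inv_pow, Real.sq_sqrt (by positivity), zpow_neg, inv_inv]; norm_num
  · norm_num

lemma haar_sq (q : HaarIndex n) (x : Fin n → ℝ) : haar q x ^ 2 = density q x := by
  unfold haar haarFn density
  rw [← Finset.prod_pow]
  simp only [haar1D_sq]
  split_ifs with h
  · have : ∀ i, ⌊(2:ℝ) ^ q.1 * x i⌋ = q.2.1 i := fun i => congrFun h i
    simp [this]
  · have : ∃ i, ⌊(2:ℝ) ^ q.1 * x i⌋ ≠ q.2.1 i := by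
      by_contra hc; push Not at hc; exact h (funext hc)
    obtain ⟨i, hi⟩ := this
    exact Finset.prod_eq_zero (Finset.mem_univ i) (if_neg hi)

lemma haar_eq_zero {q : HaarIndex n} {x : Fin n → ℝ} (h : dyadicIdx q.1 x ≠ q.2.1) :
    haar q x = 0 := by
  have := haar_sq q x
  rw [density, if_neg h] at this
  exact pow_eq_zero_iff (two_ne_zero) |>.1 this

lemma isStep_haar (q : HaarIndex n) : IsStep (q.1 + 1) (haar q) := by
  intro x y h
  have h' : dyadicIdx q.1 x = dyadicIdx q.1 y := by
    have e : q.1 = q.1 + 1 - (1:ℕ) := by push_cast; ring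
    rw [e, ← ancestorIdx_dyadicIdx, ← ancestorIdx_dyadicIdx, h]
  unfold haar haarFn
  refine Finset.prod_congr rfl fun i _ => ?_
  have h1 : ⌊(2:ℝ) ^ q.1 * x i⌋ = ⌊(2:ℝ) ^ q.1 * y i⌋ := congrFun h' i
  have h2 : ⌊(2:ℝ) ^ (q.1 + 1) * x i⌋ = ⌊(2:ℝ) ^ (q.1 + 1) * y i⌋ := congrFun h i
  rw [haar1D_eq, haar1D_eq, h1, h2]

lemma isStep_density (q : HaarIndex n) : IsStep q.1 (density q) := by
  intro x y h
  simp only [density, h]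

lemma norm_le_of_dyadicIdx_eq {k : ℤ} {μ : Fin n → ℤ} {x : Fin n → ℝ} (h : dyadicIdx k x = μ) :
    ‖x‖ ≤ (2:ℝ) ^ (-k) * (‖μ‖ + 1) := by
  refine (pi_norm_le_iff_of_nonneg (by positivity)).2 fun i => ?_
  have hi : ⌊(2:ℝ) ^ k * x i⌋ = μ i := congrFun h i
  have h1 := (mem_dyadic_Ico_iff k (μ i) (x i)).2 hi
  have hp : (0:ℝ) < (2:ℝ) ^ (-k) := by positivity
  have h2 : |(μ i : ℝ)| ≤ ‖μ‖ := by
    have := norm_le_pi_norm μ i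
    rwa [Int.norm_eq_abs] at this
  obtain ⟨ha, hb⟩ := abs_le.1 h2
  rw [Real.norm_eq_abs, abs_le]
  constructor
  · nlinarith [h1.1]
  · nlinarith [h1.2]

lemma isNice_haar (q : HaarIndex n) : IsNice (haar q) := by
  refine ⟨q.1 + 1, (2:ℝ) ^ (-q.1) * (‖q.2.1‖ + 1), isStep_haar q, fun x hx => ?_⟩
  exact haar_eq_zero fun h => absurd (norm_le_of_dyadicIdx_eq h) (not_le.2 hx)

lemma isNice_density (q : HaarIndex n) : IsNice (density q) := by
  have := (isNice_haar q).mul (isNice_haar q)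
  simpa only [← sq, haar_sq] using this

lemma integral_indicator_dyadic (k a : ℤ) (c : ℝ) :
    ∫ t : ℝ, (if ⌊(2:ℝ) ^ k * t⌋ = a then c else 0) = (2:ℝ) ^ (-k) * c := by
  have : (fun t : ℝ => if ⌊(2:ℝ) ^ k * t⌋ = a then c else 0) =
      (Set.Ico ((2:ℝ) ^ (-k) * a) ((2:ℝ) ^ (-k) * (a + 1))).indicator (fun _ => c) := by
    funext t
    rw [Set.indicator_apply]
    simp only [mem_dyadic_Ico_iff]
  have hp : (0:ℝ) < (2:ℝ) ^ (-k) := by positivity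
  rw [this, integral_indicator measurableSet_Ico, setIntegral_const, Measure.real,
    Real.volume_Ico, ENNReal.toReal_ofReal (by nlinarith), smul_eq_mul]
  ring

lemma integral_density (q : HaarIndex n) : ∫ x, density q x = 1 := by
  have : density q = fun x : Fin n → ℝ => ∏ i, (fun i t =>
      if ⌊(2:ℝ) ^ q.1 * t⌋ = q.2.1 i then (2:ℝ) ^ q.1 else 0) i (x i) := by
    funext x
    rw [← haar_sq, haar, haarFn, ← Finset.prod_pow]
    simp only [haar1D_sq]
  rw [this, integral_fintype_prod_volume_eq_prod (fun i t =>
      if ⌊(2:ℝ) ^ q.1 * t⌋ = q.2.1 i then (2:ℝ) ^ q.1 else 0)]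
  simp only [integral_indicator_dyadic]
  rw [← zpow_add₀ (by norm_num)]
  simp

lemma integral_density_mul {q : HaarIndex n} {k : ℤ} (hk : k ≤ q.1) {v : (Fin n → ℝ) → ℝ}
    (hv : IsStep k v) : ∫ x, density q x * v x = v (dyadicCorner q.1 q.2.1) := by
  have : (fun x => density q x * v x) =
      fun x => density q x * v (dyadicCorner q.1 q.2.1) := by
    funext x
    by_cases h : dyadicIdx q.1 x = q.2.1
    · rw [(hv.mono hk).eq_corner x, h]
    · simp [density, h]
  rw [this, integral_mul_const, integral_density, one_mul]

lemma integral_haar1D_true (k a : ℤ) : ∫ t, haar1D k a true t = 0 := by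
  unfold haar1D
  simp only [if_true]
  rw [integral_const_mul, integral_sub]
  · have e : (1 : ℝ → ℝ) = fun _ => 1 := rfl
    have hp : (0:ℝ) < (2:ℝ) ^ (-k) := by positivity
    rw [e, integral_indicator measurableSet_Ico, integral_indicator measurableSet_Ico,
      setIntegral_const, setIntegral_const, Measure.real, Measure.real, Real.volume_Ico,
      Real.volume_Ico, ENNReal.toReal_ofReal (by nlinarith),
      ENNReal.toReal_ofReal (by nlinarith)]
    simp only [smul_eq_mul]
    ring
  · exact (integrable_indicator_iff measurableSet_Ico).2
      (integrableOn_const (by simp) (by simp))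
  · exact (integrable_indicator_iff measurableSet_Ico).2
      (integrableOn_const (by simp) (by simp))

lemma integral_haar {q : HaarIndex n} (hq : q.2.2 ≠ fun _ => false) : ∫ x, haar q x = 0 := by
  unfold haar haarFn
  rw [integral_fintype_prod_volume_eq_prod]
  obtain ⟨i, hi⟩ := Function.ne_iff.1 hq
  refine Finset.prod_eq_zero (Finset.mem_univ i) ?_
  rw [Bool.eq_true_of_not_eq_false hi, integral_haar1D_true]

lemma haar_mul_step {q : HaarIndex n} {k : ℤ} (hk : k ≤ q.1) {v : (Fin n → ℝ) → ℝ}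
    (hv : IsStep k v) (x : Fin n → ℝ) :
    haar q x * v x = haar q x * v (dyadicCorner q.1 q.2.1) := by
  by_cases h : dyadicIdx q.1 x = q.2.1
  · rw [(hv.mono hk).eq_corner x, h]
  · simp [haar_eq_zero h]

lemma integral_haar_mul_step {q : HaarIndex n} (hq : q.2.2 ≠ fun _ => false) {k : ℤ}
    (hk : k ≤ q.1) {v : (Fin n → ℝ) → ℝ} (hv : IsStep k v) : ∫ x, haar q x * v x = 0 := by
  simp only [haar_mul_step hk hv]
  rw [integral_mul_const, integral_haar hq, zero_mul]

lemma integral_haar1D_mul {k a : ℤ} {η η' : Bool} (h : η ≠ η') :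
    ∫ t, haar1D k a η t * haar1D k a η' t = 0 := by
  wlog hη : η = true generalizing η η'
  · have := this h.symm (by cases η <;> cases η' <;> simp_all)
    simpa only [mul_comm] using this
  have hη' : η' = false := by cases η' <;> simp_all
  subst hη hη'
  have : ∀ t, haar1D k a true t * haar1D k a false t =
      haar1D k a true t * (Real.sqrt ((2:ℝ) ^ (-k)))⁻¹ := by
    intro t
    rw [haar1D_eq, haar1D_eq]
    split_ifs <;> simp_all
  simp only [this]
  rw [integral_mul_const, integral_haar1D_true, zero_mul]

/-- The cancellative Haar functions are orthonormal. -/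
lemma integral_haar_mul_haar {p q : HaarIndex n} (hp : p.2.2 ≠ fun _ => false)
    (hq : q.2.2 ≠ fun _ => false) : ∫ x, haar p x * haar q x = if p = q then 1 else 0 := by
  split_ifs with h
  · subst h
    simp only [← sq, haar_sq, integral_density]
  · rcases lt_trichotomy p.1 q.1 with h1 | h1 | h1
    · simp only [mul_comm (haar p _)]
      exact integral_haar_mul_step hq (by omega) (isStep_haar p)
    · by_cases h2 : p.2.1 = q.2.1
      · obtain ⟨k, μ, η⟩ := p
        obtain ⟨k', μ', η'⟩ := q
        simp only at h1 h2
        subst h1 h2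
        have h3 : η ≠ η' := fun h3 => h (by rw [h3])
        obtain ⟨i, hi⟩ := Function.ne_iff.1 h3
        simp only [haar, haarFn, ← Finset.prod_mul_distrib]
        rw [integral_fintype_prod_volume_eq_prod
          (fun i t => haar1D k (μ i) (η i) t * haar1D k (μ i) (η' i) t)]
        exact Finset.prod_eq_zero (Finset.mem_univ i) (integral_haar1D_mul hi)
      · have : ∀ x, haar p x * haar q x = 0 := by
          intro x
          by_cases h3 : dyadicIdx p.1 x = p.2.1
          · have h4 : dyadicIdx q.1 x ≠ q.2.1 := by
              rw [← h1, h3]; exact h2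
            simp [haar_eq_zero h4]
          · simp [haar_eq_zero h3]
        simp [this]
    · exact integral_haar_mul_step hp (by omega) (isStep_haar q)

/-! ### Square functions -/

variable {n : ℕ}

/-- The lower corner of the cube of a Haar index. -/
def HaarIndex.corner (q : HaarIndex n) : Fin n → ℝ := dyadicCorner q.1 q.2.1

/-- The squared square function with coefficients `z`. -/
def sqFn (F : Finset (HaarIndex n)) (z : HaarIndex n → ℝ) (x : Fin n → ℝ) : ℝ :=
  ∑ q ∈ F, z q * density q x

/-- The part of the squared square function from generations at most `k`. -/
def sqFnLe (F : Finset (HaarIndex n)) (z : HaarIndex n → ℝ) (k : ℤ) (x : Fin n → ℝ) : ℝ :=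
  ∑ q ∈ F with q.1 ≤ k, z q * density q x

section

variable {F : Finset (HaarIndex n)} {z : HaarIndex n → ℝ}

lemma sqFn_nonneg (hz : ∀ q, 0 ≤ z q) (x : Fin n → ℝ) : 0 ≤ sqFn F z x :=
  Finset.sum_nonneg fun q _ => mul_nonneg (hz q) (density_nonneg q x)

lemma sqFnLe_nonneg (hz : ∀ q, 0 ≤ z q) (k : ℤ) (x : Fin n → ℝ) : 0 ≤ sqFnLe F z k x :=
  Finset.sum_nonneg fun q _ => mul_nonneg (hz q) (density_nonneg q x)

lemma sqFnLe_mono (hz : ∀ q, 0 ≤ z q) {k l : ℤ} (hkl : k ≤ l) (x : Fin n → ℝ) :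
    sqFnLe F z k x ≤ sqFnLe F z l x := by
  refine Finset.sum_le_sum_of_subset_of_nonneg ?_ fun q _ _ =>
    mul_nonneg (hz q) (density_nonneg q x)
  intro q hq
  rw [Finset.mem_filter] at hq ⊢
  exact ⟨hq.1, hq.2.trans hkl⟩

lemma sqFnLe_le (hz : ∀ q, 0 ≤ z q) (k : ℤ) (x : Fin n → ℝ) : sqFnLe F z k x ≤ sqFn F z x :=
  Finset.sum_le_sum_of_subset_of_nonneg (Finset.filter_subset _ _) fun q _ _ =>
    mul_nonneg (hz q) (density_nonneg q x)

lemma isNice_sqFn : IsNice (sqFn F z) :=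
  IsNice.sum F fun q _ => (isNice_density q).const_mul (z q)

lemma isStep_sqFnLe (k : ℤ) : IsStep k (sqFnLe F z k) := by
  refine IsStep.sum _ fun q hq => ?_
  exact ((isStep_density q).mono (Finset.mem_filter.1 hq).2).comp (fun t => z q * t)

lemma IsNice.rpow {u : (Fin n → ℝ) → ℝ} (hu : IsNice u) {r : ℝ} (hr : r ≠ 0) :
    IsNice (fun x => u x ^ r) := hu.comp (fun t => t ^ r) (Real.zero_rpow hr)

lemma integral_sqFn_mul (v : (Fin n → ℝ) → ℝ) {k : ℤ} (hv : IsStep k v) :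
    ∫ x, sqFn F z x * v x = ∑ q ∈ F, z q * ∫ x, density q x * v x := by
  simp only [sqFn, Finset.sum_mul, mul_assoc]
  rw [integral_finsetSum _ fun q _ =>
    (((isNice_density q).mul_step hv).const_mul (z q)).integrable]
  simp only [integral_const_mul]

lemma integral_sqFn_rpow_le (hz : ∀ q, 0 ≤ z q) {r : ℝ} (hr : 1 ≤ r) :
    ∫ x, sqFn F z x ^ r ≤ r * ∑ q ∈ F, z q * sqFnLe F z q.1 q.corner ^ (r - 1) := by
  have h1 : ∀ x, sqFn F z x ^ r ≤
      r * ∑ q ∈ F, z q * (density q x * sqFnLe F z q.1 x ^ (r - 1)) := by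
    intro x
    refine (rpow_sum_le_partial F (fun q => q.1) (fun q => z q * density q x)
      (fun q => mul_nonneg (hz q) (density_nonneg q x)) hr).trans (le_of_eq ?_)
    simp only [sqFnLe, mul_assoc]
  have hst : ∀ q : HaarIndex n, IsStep q.1 (fun x => sqFnLe F z q.1 x ^ (r - 1)) :=
    fun q => (isStep_sqFnLe q.1).comp (fun t => t ^ (r - 1))
  have hn : ∀ q : HaarIndex n,
      IsNice (fun x => z q * (density q x * sqFnLe F z q.1 x ^ (r - 1))) :=
    fun q => ((isNice_density q).mul_step (hst q)).const_mul _
  refine (integral_mono (isNice_sqFn.rpow (by linarith)).integrable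
    ((IsNice.sum F fun q _ => hn q).const_mul r).integrable h1).trans (le_of_eq ?_)
  rw [integral_const_mul, integral_finsetSum _ fun q _ => (hn q).integrable]
  simp only [integral_const_mul]
  congr 1
  refine Finset.sum_congr rfl fun q _ => ?_
  rw [integral_density_mul le_rfl (hst q)]
  rfl

end

/-! ### Bessel inequalities -/

/-- The Haar coefficients of a function. -/
def haarCoeff (g : (Fin n → ℝ) → ℝ) (q : HaarIndex n) : ℝ := ∫ x, g x * haar q x

/-- The square of a finite Haar sum has integral equal to the sum of the squares. -/
lemma integral_sum_haar_sq {F : Finset (HaarIndex n)} (hF : ∀ q ∈ F, q.2.2 ≠ fun _ => false)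
    (c : HaarIndex n → ℝ) : ∫ x, (∑ q ∈ F, c q * haar q x) ^ 2 = ∑ q ∈ F, c q ^ 2 := by
  have h : ∀ x, (∑ q ∈ F, c q * haar q x) ^ 2 =
      ∑ p ∈ F, ∑ q ∈ F, c p * c q * (haar p x * haar q x) := by
    intro x
    rw [sq, Finset.sum_mul_sum]
    exact Finset.sum_congr rfl fun p _ => Finset.sum_congr rfl fun q _ => by ring
  simp only [h]
  have hn : ∀ p q : HaarIndex n, IsNice (fun x => c p * c q * (haar p x * haar q x)) :=
    fun p q => ((isNice_haar p).mul (isNice_haar q)).const_mul _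
  rw [integral_finsetSum _ fun p _ => (IsNice.sum F fun q _ => hn p q).integrable]
  refine Finset.sum_congr rfl fun p hp => ?_
  rw [integral_finsetSum _ fun q _ => (hn p q).integrable]
  simp only [integral_const_mul]
  rw [Finset.sum_eq_single p]
  · rw [integral_haar_mul_haar (hF p hp) (hF p hp), if_pos rfl]; ring
  · intro q hq hqp
    rw [integral_haar_mul_haar (hF p hp) (hF q hq), if_neg hqp.symm, mul_zero]
  · exact fun h => absurd hp h

lemma integral_mul_sum_haar {g : (Fin n → ℝ) → ℝ} (hg : IsNice g) (F : Finset (HaarIndex n))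
    (c : HaarIndex n → ℝ) :
    ∫ x, g x * ∑ q ∈ F, c q * haar q x = ∑ q ∈ F, c q * haarCoeff g q := by
  simp only [Finset.mul_sum, mul_left_comm (g _)]
  rw [integral_finsetSum _ fun q _ => ((hg.mul (isNice_haar q)).const_mul (c q)).integrable]
  simp only [integral_const_mul, haarCoeff]

lemma isNice_sum_haar (F : Finset (HaarIndex n)) (c : HaarIndex n → ℝ) :
    IsNice (fun x => ∑ q ∈ F, c q * haar q x) :=
  IsNice.sum F fun q _ => (isNice_haar q).const_mul (c q)

/-- The Haar coefficients of a finite Haar sum. -/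
lemma haarCoeff_sum_haar {F : Finset (HaarIndex n)} (hF : ∀ q ∈ F, q.2.2 ≠ fun _ => false)
    (c : HaarIndex n → ℝ) {q : HaarIndex n} (hq : q ∈ F) :
    haarCoeff (fun x => ∑ p ∈ F, c p * haar p x) q = c q := by
  have h := integral_mul_sum_haar (isNice_haar q) F c
  unfold haarCoeff at *
  simp only [mul_comm (haar q _)] at h
  rw [h, Finset.sum_eq_single q]
  · rw [integral_haar_mul_haar (hF q hq) (hF q hq), if_pos rfl, mul_one]
  · intro p hp hpq
    rw [integral_haar_mul_haar (hF p hp) (hF q hq), if_neg hpq, mul_zero]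
  · exact fun h => absurd hq h

lemma sum_haarCoeff_sq_le {g : (Fin n → ℝ) → ℝ} (hg : IsNice g) {F : Finset (HaarIndex n)}
    (hF : ∀ q ∈ F, q.2.2 ≠ fun _ => false) :
    ∑ q ∈ F, haarCoeff g q ^ 2 ≤ ∫ x, g x ^ 2 := by
  set P : (Fin n → ℝ) → ℝ := fun x => ∑ q ∈ F, haarCoeff g q * haar q x with hP
  have hPn : IsNice P := isNice_sum_haar F _
  have h0 : 0 ≤ ∫ x, (g x - P x) ^ 2 := integral_nonneg fun x => sq_nonneg _
  have h1 : ∫ x, (g x - P x) ^ 2 = (∫ x, g x ^ 2) - 2 * (∫ x, g x * P x) + ∫ x, P x ^ 2 := by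
    have e : ∀ x, (g x - P x) ^ 2 = (g x ^ 2 - 2 * (g x * P x)) + P x ^ 2 := fun x => by ring
    have n1 : IsNice (fun x => g x ^ 2) := hg.comp (fun t => t ^ 2) (by norm_num)
    have n2 : IsNice (fun x => 2 * (g x * P x)) := (hg.mul hPn).const_mul 2
    have n3 : IsNice (fun x => P x ^ 2) := hPn.comp (fun t => t ^ 2) (by norm_num)
    simp only [e]
    rw [integral_add (f := fun x => g x ^ 2 - 2 * (g x * P x))
      (n1.integrable.sub n2.integrable) n3.integrable, integral_sub n1.integrable n2.integrable, integral_const_mul]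
  have h2 : ∫ x, g x * P x = ∑ q ∈ F, haarCoeff g q ^ 2 := by
    rw [hP, integral_mul_sum_haar hg]
    exact Finset.sum_congr rfl fun q _ => by ring
  have h3 : ∫ x, P x ^ 2 = ∑ q ∈ F, haarCoeff g q ^ 2 := integral_sum_haar_sq hF _
  linarith

lemma sum_haarCoeff_sq_mul_le {g : (Fin n → ℝ) → ℝ} (hg : IsNice g) {F : Finset (HaarIndex n)}
    (hF : ∀ q ∈ F, q.2.2 ≠ fun _ => false) {k : ℤ} (hk : ∀ q ∈ F, k ≤ q.1)
    {w : (Fin n → ℝ) → ℝ} (hw : IsStep k w) (hw0 : ∀ x, 0 ≤ w x) :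
    ∑ q ∈ F, haarCoeff g q ^ 2 * w q.corner ≤ ∫ x, g x ^ 2 * w x := by
  have hs : IsStep k (fun x => Real.sqrt (w x)) := hw.comp Real.sqrt
  have h := sum_haarCoeff_sq_le (hg.mul_step hs) hF
  have e : ∀ q ∈ F, haarCoeff (fun x => g x * Real.sqrt (w x)) q ^ 2 =
      haarCoeff g q ^ 2 * w q.corner := by
    intro q hq
    have : haarCoeff (fun x => g x * Real.sqrt (w x)) q =
        haarCoeff g q * Real.sqrt (w q.corner) := by
      unfold haarCoeff
      rw [← integral_mul_const]
      congr 1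
      funext x
      have := haar_mul_step (hk q hq) hs x
      calc g x * Real.sqrt (w x) * haar q x = g x * (haar q x * Real.sqrt (w x)) := by ring
        _ = g x * (haar q x * Real.sqrt (w q.corner)) := by rw [this]; rfl
        _ = _ := by ring
    rw [this, mul_pow, Real.sq_sqrt (hw0 _)]
  rw [Finset.sum_congr rfl e] at h
  simpa only [mul_pow, Real.sq_sqrt (hw0 _)] using h

/-- Bessel's inequality with weights increasing in the generation. -/
lemma sum_haarCoeff_sq_mul_mono_le {g : (Fin n → ℝ) → ℝ} (hg : IsNice g)
    {F : Finset (HaarIndex n)} (hF : ∀ q ∈ F, q.2.2 ≠ fun _ => false)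
    {v : ℤ → (Fin n → ℝ) → ℝ} (hv : ∀ k, IsStep k (v k)) (hv0 : ∀ k x, 0 ≤ v k x)
    (hmono : ∀ k l, k ≤ l → ∀ x, v k x ≤ v l x) {w : (Fin n → ℝ) → ℝ} {l : ℤ}
    (hw : IsStep l w) (hvw : ∀ k x, v k x ≤ w x) :
    ∑ q ∈ F, haarCoeff g q ^ 2 * v q.1 q.corner ≤ ∫ x, g x ^ 2 * w x := by
  obtain ⟨a, ha⟩ : ∃ a : ℤ, ∀ q ∈ F, a ≤ q.1 := by
    obtain ⟨a, ha⟩ := (F.image fun q => q.1).bddBelow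
    exact ⟨a, fun q hq => ha (Finset.mem_coe.2 (Finset.mem_image_of_mem _ hq))⟩
  obtain ⟨b, hb⟩ : ∃ b : ℤ, ∀ q ∈ F, q.1 ≤ b := by
    obtain ⟨b, hb⟩ := (F.image fun q => q.1).bddAbove
    exact ⟨b, fun q hq => hb (Finset.mem_coe.2 (Finset.mem_image_of_mem _ hq))⟩
  have hg2 : IsNice (fun x => g x ^ 2) := hg.comp (fun t => t ^ 2) (by norm_num)
  have key : ∀ N : ℤ, a ≤ N →
      ∑ q ∈ F, haarCoeff g q ^ 2 * v (min q.1 N) q.corner ≤ ∫ x, g x ^ 2 * v N x := by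
    intro N hN
    induction N, hN using Int.leInduction with
    | base =>
      refine le_trans (le_of_eq ?_) (sum_haarCoeff_sq_mul_le hg hF ha (hv a) (hv0 a))
      exact Finset.sum_congr rfl fun q hq => by rw [min_eq_right (ha q hq)]
    | succ N hN ih =>
      have hst : IsStep (N + 1) (fun x => v (N + 1) x - v N x) :=
        (hv (N + 1)).comp₂ ((hv N).mono (by omega)) (fun s t => s - t)
      have h1 := sum_haarCoeff_sq_mul_le hg (F := F.filter fun q => N + 1 ≤ q.1)
        (fun q hq => hF q (Finset.mem_filter.1 hq).1) (fun q hq => (Finset.mem_filter.1 hq).2)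
        hst (fun x => sub_nonneg.2 (hmono _ _ (by omega) x))
      have h2 : ∫ x, g x ^ 2 * (v (N + 1) x - v N x) =
          (∫ x, g x ^ 2 * v (N + 1) x) - ∫ x, g x ^ 2 * v N x := by
        simp only [mul_sub]
        exact integral_sub (hg2.mul_step (hv _)).integrable (hg2.mul_step (hv _)).integrable
      have h3 : ∑ q ∈ F, haarCoeff g q ^ 2 * v (min q.1 (N + 1)) q.corner =
          ∑ q ∈ F, haarCoeff g q ^ 2 * v (min q.1 N) q.corner +
          ∑ q ∈ F with N + 1 ≤ q.1,
            haarCoeff g q ^ 2 * (v (N + 1) q.corner - v N q.corner) := by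
        rw [Finset.sum_filter, ← Finset.sum_add_distrib]
        refine Finset.sum_congr rfl fun q _ => ?_
        split_ifs with h
        · rw [min_eq_right h, min_eq_right (by omega)]; ring
        · rw [min_eq_left (by omega), min_eq_left (by omega), add_zero]
      rw [h3]
      linarith
  have h1 := key (max a b) (le_max_left _ _)
  have h2 : ∫ x, g x ^ 2 * v (max a b) x ≤ ∫ x, g x ^ 2 * w x :=
    integral_mono (hg2.mul_step (hv _)).integrable (hg2.mul_step hw).integrable
      fun x => mul_le_mul_of_nonneg_left (hvw _ x) (sq_nonneg _)
  refine le_trans (le_of_eq ?_) (h1.trans h2)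
  refine Finset.sum_congr rfl fun q hq => ?_
  rw [min_eq_left ((hb q hq).trans (le_max_right _ _))]

/-- Absorption of the `r`-th moment of `V`. -/
lemma integral_rpow_le_of_le_mul {U V : (Fin n → ℝ) → ℝ} (hU : IsNice U) (hV : IsNice V)
    (hU0 : ∀ x, 0 ≤ U x) (hV0 : ∀ x, 0 ≤ V x) {r : ℝ} (hr : 1 ≤ r)
    (h : ∫ x, V x ^ r ≤ r * ∫ x, U x * V x ^ (r - 1)) :
    ∫ x, V x ^ r ≤ 2 * (2 * r) ^ r * ∫ x, U x ^ r := by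
  have n1 := hV.rpow (r := r) (by linarith)
  have n2 := hU.rpow (r := r) (by linarith)
  have n3 : IsNice (fun x => U x * V x ^ (r - 1)) := by
    obtain ⟨N, R, h1, h2⟩ := hV
    exact hU.mul_step (h1.comp (fun t => t ^ (r - 1)))
  have h1 : ∫ x, r * (U x * V x ^ (r - 1)) ≤ ∫ x, (1 / 2 * V x ^ r + (2 * r) ^ r * U x ^ r) :=
    integral_mono (n3.const_mul r).integrable
      ((n1.const_mul _).add (n2.const_mul _)).integrable
      fun x => mul_rpow_sub_one_le_absorb hr (hU0 x) (hV0 x)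
  rw [integral_const_mul, integral_add (n1.const_mul _).integrable (n2.const_mul _).integrable,
    integral_const_mul, integral_const_mul] at h1
  linarith

/-- Upper square function estimate for exponents at least two. -/
lemma integral_sqFn_haarCoeff_le {g : (Fin n → ℝ) → ℝ} (hg : IsNice g)
    {F : Finset (HaarIndex n)} (hF : ∀ q ∈ F, q.2.2 ≠ fun _ => false) {r : ℝ} (hr : 1 ≤ r) :
    ∫ x, sqFn F (fun q => haarCoeff g q ^ 2) x ^ r ≤
      2 * (2 * r) ^ r * ∫ x, (g x ^ 2) ^ r := by
  set z : HaarIndex n → ℝ := fun q => haarCoeff g q ^ 2 with hz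
  have hz0 : ∀ q, 0 ≤ z q := fun q => sq_nonneg _
  refine integral_rpow_le_of_le_mul (hg.comp (fun t => t ^ 2) (by norm_num)) isNice_sqFn
    (fun x => sq_nonneg _) (sqFn_nonneg hz0) hr ?_
  refine (integral_sqFn_rpow_le hz0 hr).trans ?_
  refine mul_le_mul_of_nonneg_left ?_ (by linarith)
  obtain ⟨N, R, h1, h2⟩ : IsNice (sqFn F z) := isNice_sqFn
  exact sum_haarCoeff_sq_mul_mono_le hg hF
    (v := fun k x => sqFnLe F z k x ^ (r - 1))
    (fun k => (isStep_sqFnLe k).comp (fun t => t ^ (r - 1)))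
    (fun k x => Real.rpow_nonneg (sqFnLe_nonneg hz0 k x) _)
    (fun k l hkl x => Real.rpow_le_rpow (sqFnLe_nonneg hz0 k x) (sqFnLe_mono hz0 hkl x)
      (by linarith))
    (h1.comp (fun t => t ^ (r - 1)))
    (fun k x => Real.rpow_le_rpow (sqFnLe_nonneg hz0 k x) (sqFnLe_le hz0 k x) (by linarith))

/-! ### Lower square function estimate -/

variable {n : ℕ}

section

variable (F : Finset (HaarIndex n)) (c : HaarIndex n → ℝ)

/-- A finite Haar sum. -/
def haarSum (x : Fin n → ℝ) : ℝ := ∑ q ∈ F, c q * haar q x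

/-- The part of a finite Haar sum from generations below `k`. -/
def haarSumLt (k : ℤ) (x : Fin n → ℝ) : ℝ := ∑ q ∈ F with q.1 < k, c q * haar q x

/-- The part of a finite Haar sum of generation `k`. -/
def haarSumEq (k : ℤ) (x : Fin n → ℝ) : ℝ := ∑ q ∈ F with q.1 = k, c q * haar q x

variable {F c}

lemma isStep_haarSumLt (k : ℤ) : IsStep k (haarSumLt F c k) := by
  refine IsStep.sum _ fun q hq => ?_
  exact ((isStep_haar q).mono (by have := (Finset.mem_filter.1 hq).2; omega)).comp
    (fun t => c q * t)

lemma isNice_haarSum : IsNice (haarSum F c) := isNice_sum_haar F c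

lemma isNice_haarSumLt (k : ℤ) : IsNice (haarSumLt F c k) := isNice_sum_haar _ c

lemma isNice_haarSumEq (k : ℤ) : IsNice (haarSumEq F c k) := isNice_sum_haar _ c

lemma haarSumLt_succ (k : ℤ) (x : Fin n → ℝ) :
    haarSumLt F c (k + 1) x = haarSumLt F c k x + haarSumEq F c k x := by
  simp only [haarSumLt, haarSumEq, Finset.sum_filter]
  rw [← Finset.sum_add_distrib]
  refine Finset.sum_congr rfl fun q _ => ?_
  rcases lt_trichotomy q.1 k with h | h | h
  · rw [if_pos (by omega), if_pos h, if_neg (by omega), add_zero]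
  · rw [if_pos (by omega), if_neg (by omega), if_pos h, zero_add]
  · rw [if_neg (by omega), if_neg (by omega), if_neg (by omega), add_zero]

lemma integral_sum_haar_mul_step {G : Finset (HaarIndex n)}
    (hG : ∀ q ∈ G, q.2.2 ≠ fun _ => false) {k : ℤ} (hk : ∀ q ∈ G, k ≤ q.1)
    {v : (Fin n → ℝ) → ℝ} (hv : IsStep k v) :
    ∫ x, v x * ∑ q ∈ G, c q * haar q x = 0 := by
  simp only [mul_comm (v _), Finset.sum_mul, mul_assoc]
  rw [integral_finsetSum _ fun q _ =>
    (((isNice_haar q).mul_step hv).const_mul (c q)).integrable]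
  refine Finset.sum_eq_zero fun q hq => ?_
  rw [integral_const_mul, integral_haar_mul_step (hG q hq) (hk q hq) hv, mul_zero]

lemma haarSumEq_sq_le (k : ℤ) (x : Fin n → ℝ) :
    haarSumEq F c k x ^ 2 ≤ 2 ^ n * ∑ q ∈ F with q.1 = k, c q ^ 2 * density q x := by
  classical
  set S := (F.filter fun q => q.1 = k).filter fun q => dyadicIdx q.1 x = q.2.1 with hS
  have h1 : haarSumEq F c k x = ∑ q ∈ S, c q * haar q x := by
    rw [haarSumEq, hS, Finset.sum_filter (fun q : HaarIndex n => dyadicIdx q.1 x = q.2.1)]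
    refine Finset.sum_congr rfl fun q _ => ?_
    split_ifs with h
    · rfl
    · rw [haar_eq_zero h, mul_zero]
  have h2 : S.card ≤ 2 ^ n := by
    have : S.card ≤ (Finset.univ : Finset (Fin n → Bool)).card := by
      refine Finset.card_le_card_of_injOn (fun q => q.2.2) (fun _ _ => Finset.mem_univ _) ?_
      intro p hp q hq hpq
      simp only [hS, Finset.coe_filter, Finset.mem_filter, Set.mem_ofPred_eq] at hp hq
      obtain ⟨⟨_, hp1⟩, hp2⟩ := hp
      obtain ⟨⟨_, hq1⟩, hq2⟩ := hq
      refine Prod.ext (hp1.trans hq1.symm) (Prod.ext ?_ hpq)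
      rw [← hp2, ← hq2, hp1, hq1]
    simpa using this
  have h3 : ∑ q ∈ S, c q ^ 2 * density q x ≤ ∑ q ∈ F with q.1 = k, c q ^ 2 * density q x :=
    Finset.sum_le_sum_of_subset_of_nonneg (Finset.filter_subset _ _) fun q _ _ =>
      mul_nonneg (sq_nonneg _) (density_nonneg q x)
  rw [h1]
  refine (sq_sum_le_card_mul_sum_sq).trans ?_
  simp only [mul_pow, haar_sq]
  have h4 : 0 ≤ ∑ q ∈ S, c q ^ 2 * density q x :=
    Finset.sum_nonneg fun q _ => mul_nonneg (sq_nonneg _) (density_nonneg q x)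
  have h5 : (S.card : ℝ) ≤ 2 ^ n := by exact_mod_cast h2
  calc (S.card : ℝ) * ∑ q ∈ S, c q ^ 2 * density q x ≤ 2 ^ n * ∑ q ∈ S, c q ^ 2 * density q x :=
        mul_le_mul_of_nonneg_right h5 h4
    _ ≤ _ := mul_le_mul_of_nonneg_left h3 (by positivity)

lemma IsNice.abs_rpow {u : (Fin n → ℝ) → ℝ} (hu : IsNice u) {r : ℝ} (hr : r ≠ 0) :
    IsNice (fun x => |u x| ^ r) :=
  hu.comp (fun t => |t| ^ r) (by simp only [abs_zero]; exact Real.zero_rpow hr)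

/-- One step of the telescoping argument. -/
lemma integral_haarSumLt_succ_le (hF : ∀ q ∈ F, q.2.2 ≠ fun _ => false) {e : ℝ} (he : 2 ≤ e)
    (k : ℤ) :
    ∫ x, |haarSumLt F c (k + 1) x| ^ e ≤ (∫ x, |haarSumLt F c k x| ^ e) +
      (e * (e - 1) * 2 ^ (e - 2) + 1 + e) * 2 ^ n * ∑ q ∈ F with q.1 = k, c q ^ 2 *
        ∫ x, density q x * (|haarSumLt F c q.1 x| ^ (e - 2) +
          ((2:ℝ) ^ n) ^ (e / 2 - 1) * sqFn F (fun q => c q ^ 2) x ^ (e / 2 - 1)) := by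
  set M : ℝ := e * (e - 1) * 2 ^ (e - 2) + 1 + e with hM
  have hM0 : 0 ≤ M := by
    have : 0 ≤ e * (e - 1) * (2:ℝ) ^ (e - 2) :=
      mul_nonneg (mul_nonneg (by linarith) (by linarith)) (by positivity)
    linarith
  set A := sqFn F (fun q => c q ^ 2) with hA
  have hz0 : ∀ q : HaarIndex n, 0 ≤ c q ^ 2 := fun q => sq_nonneg _
  obtain ⟨NA, _, hAs, _⟩ : IsNice A := isNice_sqFn
  set W : ℤ → (Fin n → ℝ) → ℝ := fun k x => |haarSumLt F c k x| ^ (e - 2) +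
      ((2:ℝ) ^ n) ^ (e / 2 - 1) * A x ^ (e / 2 - 1) with hW
  have hWs : ∀ k, IsStep (max k NA) (W k) := fun k =>
    ((isStep_haarSumLt k).mono (le_max_left _ _)).comp₂ (hAs.mono (le_max_right _ _))
      (fun s t => |s| ^ (e - 2) + ((2:ℝ) ^ n) ^ (e / 2 - 1) * t ^ (e / 2 - 1))
  have hpt : ∀ x, |haarSumLt F c (k + 1) x| ^ e ≤
      |haarSumLt F c k x| ^ e + absRpowDeriv e (haarSumLt F c k x) * haarSumEq F c k x +
        ∑ q ∈ F with q.1 = k, M * 2 ^ n * c q ^ 2 * (density q x * W k x) := by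
    intro x
    rw [haarSumLt_succ]
    refine (abs_add_rpow_le_taylor he _ _).trans ?_
    rw [← hM]
    have h1 := haarSumEq_sq_le (F := F) (c := c) k x
    set D := haarSumEq F c k x
    set a := ∑ q ∈ F with q.1 = k, c q ^ 2 * density q x with ha
    have haA : a ≤ A x := Finset.sum_le_sum_of_subset_of_nonneg (Finset.filter_subset _ _)
      fun q _ _ => mul_nonneg (hz0 q) (density_nonneg q x)
    have ha0 : 0 ≤ a := Finset.sum_nonneg fun q _ => mul_nonneg (hz0 q) (density_nonneg q x)
    have h2 : |D| ^ (e - 2) ≤ ((2:ℝ) ^ n) ^ (e / 2 - 1) * A x ^ (e / 2 - 1) := by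
      have : |D| ^ (e - 2) = (D ^ 2) ^ (e / 2 - 1) := by
        rw [← sq_abs, ← Real.rpow_natCast, ← Real.rpow_mul (abs_nonneg _)]
        congr 1; push_cast; ring
      rw [this, ← Real.mul_rpow (by positivity) (ha0.trans haA)]
      refine Real.rpow_le_rpow (sq_nonneg _) (h1.trans ?_) (by linarith)
      exact mul_le_mul_of_nonneg_left haA (by positivity)
    have h3 : ∑ q ∈ F with q.1 = k, M * 2 ^ n * c q ^ 2 * (density q x * W k x) =
        M * ((2 ^ n * a) * W k x) := by
      rw [ha, Finset.mul_sum, Finset.sum_mul, Finset.mul_sum]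
      exact Finset.sum_congr rfl fun q _ => by ring
    rw [h3]
    have h4 : 0 ≤ |D| ^ (e - 2) := by positivity
    have h5 : 0 ≤ |haarSumLt F c k x| ^ (e - 2) := by positivity
    have h6 : D ^ 2 * (|haarSumLt F c k x| ^ (e - 2) + |D| ^ (e - 2)) ≤ (2 ^ n * a) * W k x :=
      mul_le_mul h1 (by simp only [hW]; linarith) (by linarith) (by positivity)
    have := mul_le_mul_of_nonneg_left h6 hM0
    linarith
  have n1 : IsNice (fun x => |haarSumLt F c k x| ^ e) :=
    (isNice_haarSumLt k).abs_rpow (by linarith)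
  have hds : IsStep k (fun x => absRpowDeriv e (haarSumLt F c k x)) :=
    (isStep_haarSumLt k).comp (absRpowDeriv e)
  have n2 : IsNice (fun x => absRpowDeriv e (haarSumLt F c k x) * haarSumEq F c k x) := by
    have := (isNice_haarSumEq (F := F) (c := c) k).mul_step hds
    simpa only [mul_comm] using this
  have n3 : ∀ q : HaarIndex n, IsNice (fun x => M * 2 ^ n * c q ^ 2 * (density q x * W k x)) :=
    fun q => ((isNice_density q).mul_step (hWs k)).const_mul _
  have n4 := IsNice.sum (F.filter fun q => q.1 = k) fun q _ => n3 q
  refine (integral_mono ((isNice_haarSumLt (k + 1)).abs_rpow (by linarith)).integrable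
    ((n1.add n2).add n4).integrable hpt).trans (le_of_eq ?_)
  rw [integral_add (n1.add n2).integrable n4.integrable,
    integral_add n1.integrable n2.integrable, integral_finsetSum _ fun q _ => (n3 q).integrable]
  have h0 : ∫ x, absRpowDeriv e (haarSumLt F c k x) * haarSumEq F c k x = 0 :=
    integral_sum_haar_mul_step (fun q hq => hF q (Finset.mem_filter.1 hq).1)
      (fun q hq => (Finset.mem_filter.1 hq).2.ge) hds
  rw [h0, add_zero, Finset.mul_sum]
  congr 1
  refine Finset.sum_congr rfl fun q hq => ?_
  rw [integral_const_mul, (Finset.mem_filter.1 hq).2]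
  ring

lemma integral_haarSum_rpow_le_sum (hF : ∀ q ∈ F, q.2.2 ≠ fun _ => false) {e : ℝ}
    (he : 2 ≤ e) :
    ∫ x, |haarSum F c x| ^ e ≤
      (e * (e - 1) * 2 ^ (e - 2) + 1 + e) * 2 ^ n * ∑ q ∈ F, c q ^ 2 *
        ∫ x, density q x * (|haarSumLt F c q.1 x| ^ (e - 2) +
          ((2:ℝ) ^ n) ^ (e / 2 - 1) * sqFn F (fun q => c q ^ 2) x ^ (e / 2 - 1)) := by
  obtain ⟨a, ha⟩ : ∃ a : ℤ, ∀ q ∈ F, a ≤ q.1 := by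
    obtain ⟨a, ha⟩ := (F.image fun q => q.1).bddBelow
    exact ⟨a, fun q hq => ha (Finset.mem_coe.2 (Finset.mem_image_of_mem _ hq))⟩
  obtain ⟨b, hb⟩ : ∃ b : ℤ, ∀ q ∈ F, q.1 ≤ b := by
    obtain ⟨b, hb⟩ := (F.image fun q => q.1).bddAbove
    exact ⟨b, fun q hq => hb (Finset.mem_coe.2 (Finset.mem_image_of_mem _ hq))⟩
  set M : ℝ := (e * (e - 1) * 2 ^ (e - 2) + 1 + e) * 2 ^ n with hM
  set I : HaarIndex n → ℝ := fun q => ∫ x, density q x * (|haarSumLt F c q.1 x| ^ (e - 2) +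
          ((2:ℝ) ^ n) ^ (e / 2 - 1) * sqFn F (fun q => c q ^ 2) x ^ (e / 2 - 1)) with hI
  have key : ∀ N : ℤ, a ≤ N →
      ∫ x, |haarSumLt F c N x| ^ e ≤ M * ∑ q ∈ F with q.1 < N, c q ^ 2 * I q := by
    intro N hN
    induction N, hN using Int.leInduction with
    | base =>
      have : F.filter (fun q => q.1 < a) = ∅ :=
        Finset.filter_eq_empty_iff.2 fun q hq => not_lt.2 (ha q hq)
      simp only [haarSumLt, this, Finset.sum_empty, abs_zero, mul_zero]
      rw [Real.zero_rpow (by linarith)]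
      simp
    | succ N hN ih =>
      refine (integral_haarSumLt_succ_le hF he N).trans ?_
      have : ∑ q ∈ F with q.1 < N + 1, c q ^ 2 * I q =
          ∑ q ∈ F with q.1 < N, c q ^ 2 * I q + ∑ q ∈ F with q.1 = N, c q ^ 2 * I q := by
        simp only [Finset.sum_filter]
        rw [← Finset.sum_add_distrib]
        refine Finset.sum_congr rfl fun q _ => ?_
        rcases lt_trichotomy q.1 N with h | h | h
        · rw [if_pos (by omega), if_pos h, if_neg (by omega), add_zero]
        · rw [if_pos (by omega), if_neg (by omega), if_pos h, zero_add]
        · rw [if_neg (by omega), if_neg (by omega), if_neg (by omega), add_zero]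
      rw [this, mul_add]
      exact add_le_add ih le_rfl
  have hfil : F.filter (fun q => q.1 < max a (b + 1)) = F :=
    Finset.filter_true_of_mem fun q hq =>
      lt_of_lt_of_le (Int.lt_add_one_of_le (hb q hq)) (le_max_right _ _)
  have h := key (max a (b + 1)) (le_max_left _ _)
  simp only [haarSumLt, hfil] at h
  exact h

/-- Conditional Jensen inequality for partial Haar sums. -/
lemma integral_mul_haarSumLt_rpow_le (hF : ∀ q ∈ F, q.2.2 ≠ fun _ => false) {a : ℝ}
    (ha : 1 ≤ a) {k : ℤ} {w : (Fin n → ℝ) → ℝ} (hw : IsNice w) (hwk : IsStep k w)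
    (hw0 : ∀ x, 0 ≤ w x) :
    ∫ x, w x * |haarSumLt F c k x| ^ a ≤ ∫ x, w x * |haarSum F c x| ^ a := by
  set R : (Fin n → ℝ) → ℝ := fun x => ∑ q ∈ F with ¬ q.1 < k, c q * haar q x with hR
  have hsplit : ∀ x, haarSum F c x = haarSumLt F c k x + R x := fun x =>
    (Finset.sum_filter_add_sum_filter_not F (fun q => q.1 < k) _).symm
  have hv : IsStep k (fun x => w x * absRpowDeriv a (haarSumLt F c k x)) :=
    hwk.comp₂ (isStep_haarSumLt k) (fun s t => s * absRpowDeriv a t)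
  have h0 : ∫ x, w x * absRpowDeriv a (haarSumLt F c k x) * R x = 0 :=
    integral_sum_haar_mul_step (fun q hq => hF q (Finset.mem_filter.1 hq).1)
      (fun q hq => not_lt.1 (Finset.mem_filter.1 hq).2) hv
  have n1 : IsNice (fun x => w x * |haarSumLt F c k x| ^ a) :=
    hw.mul ((isNice_haarSumLt k).abs_rpow (by linarith))
  have n2 : IsNice (fun x => w x * absRpowDeriv a (haarSumLt F c k x) * R x) := by
    have := (isNice_sum_haar (F.filter fun q => ¬ q.1 < k) c).mul_step hv
    simpa only [mul_comm] using this
  have n3 : IsNice (fun x => w x * |haarSum F c x| ^ a) :=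
    hw.mul (isNice_haarSum.abs_rpow (by linarith))
  have h1 := integral_mono (n1.add n2).integrable n3.integrable fun x => by
    have h := mul_le_mul_of_nonneg_left
      (abs_rpow_tangent_le ha (haarSumLt F c k x) (haarSum F c x)) (hw0 x)
    have e : haarSum F c x - haarSumLt F c k x = R x := by rw [hsplit]; ring
    rw [e] at h
    show w x * |haarSumLt F c k x| ^ a + w x * absRpowDeriv a (haarSumLt F c k x) * R x ≤ _
    linarith
  rw [integral_add n1.integrable n2.integrable, h0, add_zero] at h1
  exact h1

end

/-- Lower square function estimate for exponents at least two. -/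
lemma exists_integral_haarSum_rpow_le (n : ℕ) {e : ℝ} (he : 2 ≤ e) :
    ∃ C : ℝ, 0 ≤ C ∧ ∀ (F : Finset (HaarIndex n)) (c : HaarIndex n → ℝ),
      (∀ q ∈ F, q.2.2 ≠ fun _ => false) →
      ∫ x, |haarSum F c x| ^ e ≤ C * ∫ x, sqFn F (fun q => c q ^ 2) x ^ (e / 2) := by
  obtain ⟨a, b, ha1, haq, hb0, hb1, hqab⟩ : ∃ a b : ℝ, 1 ≤ a ∧ e - 2 ≤ a ∧ 0 ≤ b ∧ b < 1 ∧
      e = a + 2 * (1 - b) := by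
    rcases le_total e 3 with h | h
    · exact ⟨1, (3 - e) / 2, le_rfl, by linarith, by linarith, by linarith, by ring⟩
    · exact ⟨e - 2, 0, by linarith, le_rfl, le_rfl, by norm_num, by ring⟩
  set M : ℝ := (e * (e - 1) * 2 ^ (e - 2) + 1 + e) * 2 ^ n with hM
  have hM0 : 0 ≤ M := by
    have : 0 ≤ e * (e - 1) * (2:ℝ) ^ (e - 2) :=
      mul_nonneg (mul_nonneg (by linarith) (by linarith)) (by positivity)
    exact mul_nonneg (by linarith) (by positivity)
  set M' : ℝ := M * (1 - b)⁻¹ with hM'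
  have hM'0 : 0 ≤ M' := mul_nonneg hM0 (inv_nonneg.2 (by linarith))
  set B : ℝ := ((2:ℝ) ^ n) ^ (e / 2 - 1) with hB
  have hB0 : 0 ≤ B := by positivity
  set C' : ℝ := M' * ((2 * M' + 1) ^ (1 - b)⁻¹) ^ (a / 2) with hC'
  have hC'0 : 0 ≤ C' := by positivity
  refine ⟨2 * (M * (1 + B) + C'), by positivity, fun F c hF => ?_⟩
  set f := haarSum F c with hf
  set A := sqFn F (fun q => c q ^ 2) with hA
  have hz0 : ∀ q : HaarIndex n, 0 ≤ c q ^ 2 := fun q => sq_nonneg _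
  have hA0 : ∀ x, 0 ≤ A x := sqFn_nonneg hz0
  have hAn : IsNice A := isNice_sqFn
  obtain ⟨NA, _, hAs, _⟩ := id hAn
  have hfn : IsNice f := isNice_haarSum
  set L : ℤ → (Fin n → ℝ) → ℝ := fun k x => sqFnLe F (fun q => c q ^ 2) k x with hL
  have hL0 : ∀ k x, 0 ≤ L k x := fun k x => sqFnLe_nonneg hz0 k x
  have hLs : ∀ k, IsStep k (L k) := isStep_sqFnLe
  have hwn : ∀ q : HaarIndex n, IsNice (fun x => density q x * L q.1 x ^ (-b)) := fun q =>
    (isNice_density q).mul_step ((hLs q.1).comp (fun t => t ^ (-b)))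
  have hws : ∀ q : HaarIndex n, IsStep q.1 (fun x => density q x * L q.1 x ^ (-b)) := fun q =>
    (isStep_density q).comp₂ (hLs q.1) (fun s t => s * t ^ (-b))
  have nA : ∀ q : HaarIndex n, IsNice (fun x => density q x * A x ^ (e / 2 - 1)) := fun q =>
    (isNice_density q).mul_step (hAs.comp (fun t => t ^ (e / 2 - 1)))
  have nf : ∀ q : HaarIndex n,
      IsNice (fun x => density q x * L q.1 x ^ (-b) * |f x| ^ a) := fun q =>
    (hwn q).mul (hfn.abs_rpow (by linarith))
  have nfk : ∀ q : HaarIndex n,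
      IsNice (fun x => density q x * L q.1 x ^ (-b) * |haarSumLt F c q.1 x| ^ a) := fun q =>
    (hwn q).mul ((isNice_haarSumLt q.1).abs_rpow (by linarith))
  -- estimate of each term
  have hterm : ∀ q ∈ F, c q ^ 2 * ∫ x, density q x * (|haarSumLt F c q.1 x| ^ (e - 2) +
      B * A x ^ (e / 2 - 1)) ≤ (1 + B) * (c q ^ 2 * ∫ x, density q x * A x ^ (e / 2 - 1)) +
        c q ^ 2 * ∫ x, density q x * L q.1 x ^ (-b) * |f x| ^ a := by
    intro q hq
    by_cases hc : c q = 0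
    · simp [hc]
    have hcp : 0 < c q ^ 2 := by positivity
    have hpt : ∀ x, density q x * (|haarSumLt F c q.1 x| ^ (e - 2) + B * A x ^ (e / 2 - 1)) ≤
        (1 + B) * (density q x * A x ^ (e / 2 - 1)) +
          density q x * L q.1 x ^ (-b) * |haarSumLt F c q.1 x| ^ a := by
      intro x
      rcases (density_nonneg q x).eq_or_lt with h | h
      · simp [← h]
      · have hLpos : 0 < L q.1 x := by
          refine lt_of_lt_of_le (mul_pos hcp h) ?_
          exact Finset.single_le_sum (f := fun q => c q ^ 2 * density q x)
            (fun p _ => mul_nonneg (hz0 p) (density_nonneg p x))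
            (Finset.mem_filter.2 ⟨hq, le_rfl⟩)
        have h1 := rpow_sub_two_le he haq hqab (abs_nonneg (haarSumLt F c q.1 x)) hLpos
        have h2 : L q.1 x ^ (e / 2 - 1) ≤ A x ^ (e / 2 - 1) :=
          Real.rpow_le_rpow (hL0 _ _) (sqFnLe_le hz0 _ _) (by linarith)
        have h3 := mul_le_mul_of_nonneg_left (h1.trans (add_le_add_left h2 _)) h.le
        linarith
    have hst : IsStep (max q.1 NA) (fun x => |haarSumLt F c q.1 x| ^ (e - 2) +
        B * A x ^ (e / 2 - 1)) :=
      ((isStep_haarSumLt q.1).mono (le_max_left _ _)).comp₂ (hAs.mono (le_max_right _ _))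
        (fun s t => |s| ^ (e - 2) + B * t ^ (e / 2 - 1))
    have h1 := integral_mono ((isNice_density q).mul_step hst).integrable
      (((nA q).const_mul (1 + B)).add (nfk q)).integrable hpt
    rw [integral_add ((nA q).const_mul (1 + B)).integrable (nfk q).integrable,
      integral_const_mul] at h1
    have h2 := integral_mul_haarSumLt_rpow_le (c := c) hF ha1 (hwn q) (hws q)
      (fun x => mul_nonneg (density_nonneg q x) (Real.rpow_nonneg (hL0 _ _) _))
    have h3 := mul_le_mul_of_nonneg_left (h1.trans (add_le_add_right h2 _)) hcp.le
    linarith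
  -- summation
  have hsum1 : ∑ q ∈ F, c q ^ 2 * ∫ x, density q x * A x ^ (e / 2 - 1) =
      ∫ x, A x ^ (e / 2) := by
    rw [← integral_sqFn_mul _ (hAs.comp (fun t => t ^ (e / 2 - 1)))]
    congr 1
    funext x
    rcases (hA0 x).eq_or_lt with h | h
    · have h' : sqFn F (fun q => c q ^ 2) x = 0 := h.symm
      rw [h', ← h, zero_mul, Real.zero_rpow (by linarith)]
    · have := Real.rpow_add h 1 (e / 2 - 1)
      rw [Real.rpow_one] at this
      rw [← hA, ← this]; congr 1; ring
  have nAf : IsNice (fun x => |f x| ^ a * A x ^ (1 - b)) :=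
    (hfn.abs_rpow (by linarith)).mul (hAn.rpow (by linarith))
  have hsum2 : ∑ q ∈ F, c q ^ 2 * ∫ x, density q x * L q.1 x ^ (-b) * |f x| ^ a ≤
      (1 - b)⁻¹ * ∫ x, |f x| ^ a * A x ^ (1 - b) := by
    have h1 : ∑ q ∈ F, c q ^ 2 * ∫ x, density q x * L q.1 x ^ (-b) * |f x| ^ a =
        ∫ x, ∑ q ∈ F, c q ^ 2 * (density q x * L q.1 x ^ (-b) * |f x| ^ a) := by
      rw [integral_finsetSum _ fun q _ => ((nf q).const_mul (c q ^ 2)).integrable]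
      simp only [integral_const_mul]
    rw [h1, ← integral_const_mul]
    refine integral_mono (IsNice.sum F fun q _ => (nf q).const_mul _).integrable
      (nAf.const_mul _).integrable fun x => ?_
    have h2 := mul_le_mul_of_nonneg_right (sum_mul_partial_rpow_neg_le F (fun q => q.1)
      (fun q => c q ^ 2 * density q x) (fun q => mul_nonneg (hz0 q) (density_nonneg q x)) hb0 hb1)
      (show 0 ≤ |f x| ^ a by positivity)
    rw [Finset.sum_mul] at h2
    refine le_trans (le_of_eq ?_) (h2.trans (le_of_eq ?_))
    · refine Finset.sum_congr rfl fun q _ => ?_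
      simp only [hL, sqFnLe]; ring
    · simp only [hA, sqFn]; ring
  have hmain := integral_haarSum_rpow_le_sum (c := c) hF he
  rw [← hM, ← hB, ← hf, ← hA] at hmain
  have h1 := Finset.sum_le_sum hterm
  rw [Finset.sum_add_distrib, ← Finset.mul_sum, hsum1] at h1
  have h2 := hmain.trans (mul_le_mul_of_nonneg_left (h1.trans (add_le_add_right hsum2 _)) hM0)
  have h3 : ∫ x, M' * (|f x| ^ a * A x ^ (1 - b)) ≤
      ∫ x, (1 / 2 * |f x| ^ e + C' * A x ^ (e / 2)) :=
    integral_mono (nAf.const_mul _).integrable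
      (((hfn.abs_rpow (by linarith)).const_mul _).add
        ((hAn.rpow (by linarith)).const_mul _)).integrable
      fun x => mul_rpow_le_absorb hM'0 hb1 (by linarith) hqab (abs_nonneg _) (hA0 x)
  rw [integral_const_mul, integral_add
    ((hfn.abs_rpow (by linarith)).const_mul _).integrable
    ((hAn.rpow (by linarith)).const_mul _).integrable, integral_const_mul,
    integral_const_mul] at h3
  have h4 : M * ((1 + B) * (∫ x, A x ^ (e / 2)) +
      (1 - b)⁻¹ * ∫ x, |f x| ^ a * A x ^ (1 - b)) =
      M * (1 + B) * (∫ x, A x ^ (e / 2)) + M' * ∫ x, |f x| ^ a * A x ^ (1 - b) := by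
    rw [hM']; ring
  rw [h4] at h2
  linarith

/-! ### Square functions and dyadic ancestors -/

variable {n : ℕ}

/-- The index of the Haar function of the same type on the `s`-th ancestor. -/
def HaarIndex.anc (s : ℕ) (q : HaarIndex n) : HaarIndex n :=
  (q.1 - s, ancestorIdx s q.2.1, q.2.2)

lemma IsStep.corner_anc {s : ℕ} {q : HaarIndex n} {v : (Fin n → ℝ) → ℝ}
    (hv : IsStep (q.1 - s) v) : v (q.anc s).corner = v q.corner := by
  apply hv
  have h : dyadicIdx (q.1 - s) (q.anc s).corner = ancestorIdx s q.2.1 :=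
    dyadicIdx_corner (q.1 - s) (ancestorIdx s q.2.1)
  rw [h, ← ancestorIdx_dyadicIdx, HaarIndex.corner, dyadicIdx_corner]

/-- Passing to ancestors does not increase moments of square functions. -/
lemma integral_sqFn_anc_rpow_le (F : Finset (HaarIndex n)) {z : HaarIndex n → ℝ}
    (hz : ∀ q, 0 ≤ z q) (s : ℕ) {r : ℝ} (hr : 1 ≤ r) :
    ∫ x, sqFn (F.image (HaarIndex.anc s)) (fun Q => ∑ q ∈ F with q.anc s = Q, z q) x ^ r ≤
      2 * (2 * r) ^ r * ∫ x, sqFn F z x ^ r := by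
  set F' := F.image (HaarIndex.anc s) with hF'
  set zV : HaarIndex n → ℝ := fun Q => ∑ q ∈ F with q.anc s = Q, z q with hzV
  have hzV0 : ∀ Q, 0 ≤ zV Q := fun Q => Finset.sum_nonneg fun q _ => hz q
  refine integral_rpow_le_of_le_mul isNice_sqFn isNice_sqFn (sqFn_nonneg hz) (sqFn_nonneg hzV0)
    hr ((integral_sqFn_rpow_le hzV0 hr).trans ?_)
  refine mul_le_mul_of_nonneg_left ?_ (by linarith)
  obtain ⟨N, _, hVs, _⟩ : IsNice (sqFn F' zV) := isNice_sqFn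
  have hVs' := hVs.comp (fun t => t ^ (r - 1))
  rw [integral_sqFn_mul _ hVs']
  have h1 : ∑ Q ∈ F', zV Q * sqFnLe F' zV Q.1 Q.corner ^ (r - 1) =
      ∑ q ∈ F, z q * sqFnLe F' zV (q.anc s).1 (q.anc s).corner ^ (r - 1) := by
    rw [← Finset.sum_fiberwise_of_maps_to (s := F) (t := F') (g := HaarIndex.anc s)
      fun q hq => Finset.mem_image_of_mem _ hq]
    refine Finset.sum_congr rfl fun Q _ => ?_
    rw [hzV, Finset.sum_mul]
    refine Finset.sum_congr rfl fun q hq => ?_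
    rw [(Finset.mem_filter.1 hq).2]
  rw [h1]
  refine Finset.sum_le_sum fun q _ => mul_le_mul_of_nonneg_left ?_ (hz q)
  have hst : IsStep (q.1 - s) (fun x => sqFnLe F' zV (q.1 - s) x ^ (r - 1)) :=
    (isStep_sqFnLe _).comp (fun t => t ^ (r - 1))
  have h2 := hst.corner_anc
  have h3 := integral_density_mul (q := q) (by omega : q.1 - s ≤ q.1) hst
  refine le_trans (le_of_eq (h2.trans h3.symm)) ?_
  refine integral_mono ((isNice_density q).mul_step hst).integrable
    ((isNice_density q).mul_step hVs').integrable fun x => ?_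
  exact mul_le_mul_of_nonneg_left (Real.rpow_le_rpow (sqFnLe_nonneg hzV0 _ _)
    (sqFnLe_le hzV0 _ _) (by linarith)) (density_nonneg q x)

lemma sum_density_anc_le (G : Finset (HaarIndex n)) (s : ℕ) (Q : HaarIndex n)
    (x : Fin n → ℝ) :
    ∑ q ∈ G with q.anc s = Q, (((2:ℝ) ^ s) ^ n)⁻¹ * density q x ≤ density Q x := by
  set q₀ : HaarIndex n := (Q.1 + s, dyadicIdx (Q.1 + s) x, Q.2.2) with hq₀
  have h0 : ∀ q ∈ G.filter (fun q => q.anc s = Q), q ≠ q₀ →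
      (((2:ℝ) ^ s) ^ n)⁻¹ * density q x = 0 := by
    intro q hq hne
    have hQ := (Finset.mem_filter.1 hq).2
    rw [density, if_neg, mul_zero]
    intro hx
    apply hne
    have e1 : q.1 = Q.1 + s := by
      rw [← hQ]; simp [HaarIndex.anc]
    refine Prod.ext e1 (Prod.ext ?_ ?_)
    · rw [← hx, e1]
    · have e2 : (q.anc s).2.2 = Q.2.2 := by rw [hQ]
      exact e2
  by_cases hmem : q₀ ∈ G.filter fun q => q.anc s = Q
  · rw [Finset.sum_eq_single_of_mem q₀ hmem h0]
    have hQ := (Finset.mem_filter.1 hmem).2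
    have e1 : dyadicIdx Q.1 x = Q.2.1 := by
      have h1 : ancestorIdx s q₀.2.1 = Q.2.1 := by rw [← hQ]; rfl
      rw [← h1]
      simp only [hq₀]
      rw [ancestorIdx_dyadicIdx, add_sub_cancel_right]
    rw [density, if_pos (by simp only [hq₀]), density, if_pos e1]
    simp only [hq₀]
    rw [zpow_add₀ (by norm_num), mul_pow, zpow_natCast]
    apply le_of_eq
    field_simp
  · rw [Finset.sum_eq_zero fun q hq => h0 q hq fun h => hmem (h ▸ hq)]
    exact density_nonneg Q x

/-- Moments of square functions supported on sparse families of descendants. -/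
lemma integral_sqFn_desc_rpow_le {G F' : Finset (HaarIndex n)} {s : ℕ}
    (hG : ∀ q ∈ G, q.anc s ∈ F') (d : HaarIndex n → ℝ) {θ : ℝ}
    (hθ : ∀ Q, ((G.filter fun q => q.anc s = Q).card : ℝ) * (((2:ℝ) ^ s) ^ n)⁻¹ ≤ θ)
    {r : ℝ} (hr : 1 ≤ r) :
    ∫ x, sqFn G (fun q => (((2:ℝ) ^ s) ^ n)⁻¹ * d (q.anc s) ^ 2) x ^ r ≤
      r * (θ * ∫ x, sqFn F' (fun Q => d Q ^ 2) x ^ r) := by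
  set ν : ℝ := (((2:ℝ) ^ s) ^ n)⁻¹ with hν
  have hν0 : 0 ≤ ν := by positivity
  set z : HaarIndex n → ℝ := fun q => ν * d (q.anc s) ^ 2 with hz
  have hz0 : ∀ q, 0 ≤ z q := fun q => mul_nonneg hν0 (sq_nonneg _)
  set y : HaarIndex n → ℝ := fun Q => d Q ^ 2 with hy
  have hy0 : ∀ q, 0 ≤ y q := fun q => sq_nonneg _
  have hle : ∀ k x, sqFnLe G z k x ≤ sqFnLe F' y (k - s) x := by
    intro k x
    unfold sqFnLe
    rw [← Finset.sum_fiberwise_of_maps_to (s := G.filter fun q => q.1 ≤ k)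
      (t := F'.filter fun Q => Q.1 ≤ k - s) (g := HaarIndex.anc s)]
    · refine Finset.sum_le_sum fun Q _ => ?_
      refine le_trans (le_of_eq ?_) (mul_le_mul_of_nonneg_left
        (sum_density_anc_le (G.filter fun q => q.1 ≤ k) s Q x) (hy0 Q))
      rw [Finset.mul_sum]
      refine Finset.sum_congr rfl fun q hq => ?_
      simp only [hz, hy, (Finset.mem_filter.1 hq).2]
      ring
    · intro q hq
      have h := Finset.mem_filter.1 hq
      refine Finset.mem_filter.2 ⟨hG q h.1, ?_⟩
      have := h.2
      simp only [HaarIndex.anc]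
      omega
  refine (integral_sqFn_rpow_le hz0 hr).trans (mul_le_mul_of_nonneg_left ?_ (by linarith))
  have hst : ∀ k : ℤ, IsStep k (fun x => sqFnLe F' y k x ^ (r - 1)) := fun k =>
    (isStep_sqFnLe _).comp (fun t => t ^ (r - 1))
  set Y : HaarIndex n → ℝ := fun Q => sqFnLe F' y Q.1 Q.corner ^ (r - 1) with hY
  have hY0 : ∀ Q, 0 ≤ Y Q := fun Q => Real.rpow_nonneg (sqFnLe_nonneg hy0 _ _) _
  obtain ⟨N, _, hXs, _⟩ : IsNice (sqFn F' y) := isNice_sqFn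
  have hXs' := hXs.comp (fun t => t ^ (r - 1))
  calc ∑ q ∈ G, z q * sqFnLe G z q.1 q.corner ^ (r - 1)
      ≤ ∑ q ∈ G, z q * Y (q.anc s) := by
        refine Finset.sum_le_sum fun q _ => mul_le_mul_of_nonneg_left ?_ (hz0 q)
        have h2 := (hst (q.1 - s)).corner_anc
        refine le_trans ?_ (le_of_eq h2.symm)
        exact Real.rpow_le_rpow (sqFnLe_nonneg hz0 _ _) (hle _ _) (by linarith)
    _ = ∑ Q ∈ F', ((G.filter fun q => q.anc s = Q).card * ν) * (y Q * Y Q) := by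
        rw [← Finset.sum_fiberwise_of_maps_to (s := G) (t := F') (g := HaarIndex.anc s) hG]
        refine Finset.sum_congr rfl fun Q _ => ?_
        have : ∀ q ∈ G.filter (fun q => q.anc s = Q), z q * Y (q.anc s) = ν * (y Q * Y Q) := by
          intro q hq
          simp only [hz, hy, (Finset.mem_filter.1 hq).2]
          ring
        rw [Finset.sum_congr rfl this, Finset.sum_const, nsmul_eq_mul]
        ring
    _ ≤ ∑ Q ∈ F', θ * (y Q * Y Q) := Finset.sum_le_sum fun Q _ =>
        mul_le_mul_of_nonneg_right (hθ Q) (mul_nonneg (hy0 Q) (hY0 Q))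
    _ = θ * ∑ Q ∈ F', y Q * Y Q := by rw [Finset.mul_sum]
    _ ≤ θ * ∫ x, sqFn F' y x ^ r := by
        have hθ0 : 0 ≤ θ := le_trans (by positivity) (hθ (0, 0, fun _ => false))
        refine mul_le_mul_of_nonneg_left ?_ hθ0
        have h1 : ∫ x, sqFn F' y x ^ r = ∫ x, sqFn F' y x * sqFn F' y x ^ (r - 1) := by
          congr 1
          funext x
          rcases (sqFn_nonneg (F := F') hy0 x).eq_or_lt with h | h
          · rw [← h, zero_mul, Real.zero_rpow (by linarith)]
          · have := Real.rpow_add h 1 (r - 1)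
            rw [Real.rpow_one] at this
            rw [← this]; congr 1; ring
        rw [h1, integral_sqFn_mul _ hXs']
        refine Finset.sum_le_sum fun Q _ => mul_le_mul_of_nonneg_left ?_ (hy0 Q)
        refine le_trans (le_of_eq (integral_density_mul le_rfl (hst Q.1)).symm) ?_
        refine integral_mono ((isNice_density Q).mul_step (hst Q.1)).integrable
          ((isNice_density Q).mul_step hXs').integrable fun x => ?_
        exact mul_le_mul_of_nonneg_left (Real.rpow_le_rpow (sqFnLe_nonneg hy0 _ _)
          (sqFnLe_le hy0 _ _) (by linarith)) (density_nonneg Q x)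

/-! ### Haar shifts to ancestors -/

variable {n : ℕ}

/-- The operator `∑ c_q h_q ↦ ∑ c_q α_q h_{anc q}`. -/
def haarShift (s : ℕ) (F : Finset (HaarIndex n)) (c α : HaarIndex n → ℝ) (x : Fin n → ℝ) : ℝ :=
  ∑ q ∈ F, c q * α q * haar (q.anc s) x

/-- Coefficients of size at most `2^{-sn/2} H` whose squares are distributed in `s + 1` layers
`G j` containing at most `2^{sn} 2^{j-s}` descendants of each cube. -/
structure LayeredCoeff (γ : ℝ) (s : ℕ) (F : Finset (HaarIndex n)) (α : HaarIndex n → ℝ) (H : ℝ)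
    (G : ℕ → Finset (HaarIndex n)) : Prop where
  subset : ∀ j, G j ⊆ F
  sq_le : ∀ q ∈ F, α q ^ 2 ≤ (((2:ℝ) ^ s) ^ n)⁻¹ * (H ^ 2 *
    ∑ j ∈ Finset.range (s + 1), (2:ℝ) ^ (-(2 * γ * j)) * (if q ∈ G j then 1 else 0))
  card_le : ∀ j ≤ s, ∀ Q, (((G j).filter fun q => q.anc s = Q).card : ℝ) * (((2:ℝ) ^ s) ^ n)⁻¹ ≤
    (2:ℝ) ^ ((j:ℝ) - s)

lemma haarShift_eq (s : ℕ) (F : Finset (HaarIndex n)) (c α : HaarIndex n → ℝ) :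
    haarShift s F c α = haarSum (F.image (HaarIndex.anc s))
      (fun Q => ∑ q ∈ F with q.anc s = Q, c q * α q) := by
  funext x
  unfold haarShift haarSum
  rw [← Finset.sum_fiberwise_of_maps_to (s := F) (t := F.image (HaarIndex.anc s))
    (g := HaarIndex.anc s) fun q hq => Finset.mem_image_of_mem _ hq]
  refine Finset.sum_congr rfl fun Q _ => ?_
  rw [Finset.sum_mul]
  refine Finset.sum_congr rfl fun q hq => ?_
  rw [(Finset.mem_filter.1 hq).2]

lemma isNice_haarShift (s : ℕ) (F : Finset (HaarIndex n)) (c α : HaarIndex n → ℝ) :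
    IsNice (haarShift s F c α) := by
  rw [haarShift_eq]; exact isNice_haarSum

lemma anc_cancellative {F : Finset (HaarIndex n)} (hF : ∀ q ∈ F, q.2.2 ≠ fun _ => false) (s : ℕ) :
    ∀ Q ∈ F.image (HaarIndex.anc s), Q.2.2 ≠ fun _ => false := by
  intro Q hQ
  obtain ⟨q, hq, rfl⟩ := Finset.mem_image.1 hQ
  exact hF q hq

lemma integral_haarShift_mul {g : (Fin n → ℝ) → ℝ} (hg : IsNice g) {F : Finset (HaarIndex n)}
    (hF : ∀ q ∈ F, q.2.2 ≠ fun _ => false) (s : ℕ) (c α : HaarIndex n → ℝ) :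
    ∫ x, g x * haarShift s F c α x =
      ∫ x, haarSum F c x * haarSum F (fun q => α q * haarCoeff g (q.anc s)) x := by
  have h1 : ∫ x, g x * haarShift s F c α x =
      ∑ q ∈ F, c q * α q * haarCoeff g (q.anc s) := by
    simp only [haarShift, Finset.mul_sum, mul_left_comm (g _)]
    rw [integral_finsetSum _ fun q _ =>
      ((hg.mul (isNice_haar (q.anc s))).const_mul (c q * α q)).integrable]
    simp only [integral_const_mul, haarCoeff]
  rw [h1]
  have h2 := integral_mul_sum_haar (isNice_haarSum (F := F) (c := c)) F
    (fun q => α q * haarCoeff g (q.anc s))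
  refine Eq.trans ?_ h2.symm
  refine Finset.sum_congr rfl fun q hq => ?_
  have h3 : haarCoeff (haarSum F c) q = c q := haarCoeff_sum_haar hF c hq
  rw [h3]; ring

lemma sqFn_mono_coeff {F : Finset (HaarIndex n)} {z y : HaarIndex n → ℝ}
    (h : ∀ q ∈ F, z q ≤ y q) (x : Fin n → ℝ) : sqFn F z x ≤ sqFn F y x :=
  Finset.sum_le_sum fun q hq => mul_le_mul_of_nonneg_right (h q hq) (density_nonneg q x)

lemma abs_rpow_eq_sq_rpow (t e : ℝ) : |t| ^ e = (t ^ 2) ^ (e / 2) := by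
  rw [← sq_abs, ← Real.rpow_natCast, ← Real.rpow_mul (abs_nonneg _)]
  congr 1; push_cast; ring

lemma layer_sum_le {κ γ : ℝ} (s : ℕ) (hκ : κ ≤ γ) {e : ℝ} (he : 0 < e) (hκe : κ ≤ e⁻¹) :
    ∑ j ∈ Finset.range (s + 1), (2:ℝ) ^ (-(e * γ * j)) * (2:ℝ) ^ ((j:ℝ) - s) ≤
      (1 + s) * ((2:ℝ) ^ (-(s:ℝ) * κ)) ^ e := by
  have h : ∀ j ∈ Finset.range (s + 1), (2:ℝ) ^ (-(e * γ * j)) * (2:ℝ) ^ ((j:ℝ) - s) ≤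
      ((2:ℝ) ^ (-(s:ℝ) * κ)) ^ e := by
    intro j hj
    have hjs : (j:ℝ) ≤ s := by exact_mod_cast Nat.lt_succ_iff.1 (Finset.mem_range.1 hj)
    rw [← Real.rpow_add (by norm_num), ← Real.rpow_mul (by norm_num)]
    refine Real.rpow_le_rpow_of_exponent_le (by norm_num) ?_
    have h1 : κ * e ≤ 1 := by
      have := mul_le_mul_of_nonneg_right hκe he.le
      rwa [inv_mul_cancel₀ he.ne'] at this
    have h2 : κ * e * j ≤ γ * e * j :=
      mul_le_mul_of_nonneg_right (mul_le_mul_of_nonneg_right hκ he.le) (Nat.cast_nonneg j)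
    nlinarith
  refine (Finset.sum_le_sum h).trans (le_of_eq ?_)
  rw [Finset.sum_const, Finset.card_range, nsmul_eq_mul]
  push_cast; ring

lemma exists_haarShift_le_of_two_le (n : ℕ) {p : ℝ} (hp : 2 ≤ p) :
    ∃ C : ℝ, 0 ≤ C ∧ ∀ (γ κ : ℝ), κ ≤ γ → κ ≤ 1 / 2 → ∀ (s : ℕ) (F : Finset (HaarIndex n))
      (c α : HaarIndex n → ℝ) (H : ℝ) (G : ℕ → Finset (HaarIndex n)), 0 ≤ H →
      (∀ q ∈ F, q.2.2 ≠ fun _ => false) → LayeredCoeff γ s F α H G →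
      ∫ x, |haarShift s F c α x| ^ p ≤
        C * (H * (1 + s) * (2:ℝ) ^ (-(s:ℝ) * κ)) ^ p * ∫ x, |haarSum F c x| ^ p := by
  obtain ⟨CB, hCB0, hCB⟩ := exists_integral_haarSum_rpow_le n hp
  set r := p / 2 with hr
  have hr1 : 1 ≤ r := by linarith
  refine ⟨CB * (2 * (2 * r) ^ r * (2 * (2 * r) ^ r)), by positivity, ?_⟩
  intro γ κ hκγ hκ2 s F c α H G hH hF hG
  set B : ℝ := H * (1 + s) * (2:ℝ) ^ (-(s:ℝ) * κ) with hB
  have hB0 : 0 ≤ B := by positivity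
  set ν : ℝ := (((2:ℝ) ^ s) ^ n)⁻¹ with hν
  have hν0 : 0 ≤ ν := by positivity
  set F' := F.image (HaarIndex.anc s) with hF'
  set b : HaarIndex n → ℝ := fun Q => ∑ q ∈ F with q.anc s = Q, c q * α q with hb
  set zV : HaarIndex n → ℝ := fun Q => ∑ q ∈ F with q.anc s = Q, c q ^ 2 with hzV
  have hzV0 : ∀ Q, 0 ≤ zV Q := fun Q => Finset.sum_nonneg fun q _ => sq_nonneg _
  have hα : ∀ Q, ∑ q ∈ F with q.anc s = Q, α q ^ 2 ≤ B ^ 2 := by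
    intro Q
    calc ∑ q ∈ F with q.anc s = Q, α q ^ 2
        ≤ ∑ q ∈ F with q.anc s = Q, ν * (H ^ 2 * ∑ j ∈ Finset.range (s + 1),
            (2:ℝ) ^ (-(2 * γ * j)) * (if q ∈ G j then 1 else 0)) :=
          Finset.sum_le_sum fun q hq => hG.sq_le q (Finset.mem_filter.1 hq).1
      _ = H ^ 2 * ∑ j ∈ Finset.range (s + 1), (2:ℝ) ^ (-(2 * γ * j)) *
            ((((G j).filter fun q => q.anc s = Q).card : ℝ) * ν) := by
          rw [← Finset.mul_sum, ← Finset.mul_sum, Finset.sum_comm, mul_left_comm,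
            Finset.mul_sum]
          congr 1
          refine Finset.sum_congr rfl fun j _ => ?_
          rw [← Finset.mul_sum, Finset.sum_boole]
          have : (F.filter fun q => q.anc s = Q).filter (fun q => q ∈ G j) =
              (G j).filter fun q => q.anc s = Q := by
            ext q
            simp only [Finset.mem_filter]
            exact ⟨fun h => ⟨h.2, h.1.2⟩, fun h => ⟨⟨hG.subset j h.1, h.2⟩, h.1⟩⟩
          rw [this]; ring
      _ ≤ H ^ 2 * ∑ j ∈ Finset.range (s + 1), (2:ℝ) ^ (-(2 * γ * j)) * (2:ℝ) ^ ((j:ℝ) - s) := by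
          refine mul_le_mul_of_nonneg_left (Finset.sum_le_sum fun j hj => ?_) (sq_nonneg H)
          exact mul_le_mul_of_nonneg_left
            (hG.card_le j (Nat.lt_succ_iff.1 (Finset.mem_range.1 hj)) Q) (by positivity)
      _ ≤ H ^ 2 * ((1 + s) * ((2:ℝ) ^ (-(s:ℝ) * κ)) ^ (2:ℝ)) :=
          mul_le_mul_of_nonneg_left
            (layer_sum_le s hκγ (by norm_num) (by norm_num at hκ2 ⊢; exact hκ2)) (sq_nonneg H)
      _ ≤ B ^ 2 := by
          rw [Real.rpow_two, hB, mul_pow, mul_pow, mul_assoc]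
          refine mul_le_mul_of_nonneg_left ?_ (sq_nonneg H)
          refine mul_le_mul_of_nonneg_right ?_ (sq_nonneg _)
          have : (0:ℝ) ≤ s := Nat.cast_nonneg s
          nlinarith
  have hbz : ∀ Q ∈ F', b Q ^ 2 ≤ B ^ 2 * zV Q := by
    intro Q _
    refine (Finset.sum_mul_sq_le_sq_mul_sq _ _ _).trans ?_
    rw [mul_comm]
    exact mul_le_mul_of_nonneg_right (hα Q) (hzV0 Q)
  have h1 : ∫ x, |haarShift s F c α x| ^ p ≤ CB * ∫ x, sqFn F' (fun Q => b Q ^ 2) x ^ r := by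
    rw [haarShift_eq]
    exact hCB F' b (anc_cancellative hF s)
  have h2 : ∫ x, sqFn F' (fun Q => b Q ^ 2) x ^ r ≤ B ^ p * ∫ x, sqFn F' zV x ^ r := by
    rw [← integral_const_mul]
    refine integral_mono (isNice_sqFn.rpow (by linarith)).integrable
      ((isNice_sqFn.rpow (by linarith)).const_mul _).integrable fun x => ?_
    have e1 : sqFn F' (fun Q => B ^ 2 * zV Q) x = B ^ 2 * sqFn F' zV x := by
      simp only [sqFn, Finset.mul_sum, mul_assoc]
    have e2 : (B ^ 2) ^ r = B ^ p := by
      rw [← abs_rpow_eq_sq_rpow, abs_of_nonneg hB0]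
    show sqFn F' (fun Q => b Q ^ 2) x ^ r ≤ B ^ p * sqFn F' zV x ^ r
    rw [← e2, ← Real.mul_rpow (sq_nonneg B) (sqFn_nonneg hzV0 x), ← e1]
    exact Real.rpow_le_rpow (sqFn_nonneg (fun Q => sq_nonneg _) x) (sqFn_mono_coeff hbz x)
      (by linarith)
  have h3 := integral_sqFn_anc_rpow_le F (z := fun q => c q ^ 2) (fun q => sq_nonneg _) s hr1
  have h4 := integral_sqFn_haarCoeff_le (isNice_haarSum (F := F) (c := c)) hF hr1
  have e4 : sqFn F (fun q => haarCoeff (haarSum F c) q ^ 2) = sqFn F (fun q => c q ^ 2) := by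
    funext x
    refine Finset.sum_congr rfl fun q hq => ?_
    have : haarCoeff (haarSum F c) q = c q := haarCoeff_sum_haar hF c hq
    simp only [this]
  rw [e4] at h4
  simp only [hr, ← abs_rpow_eq_sq_rpow] at h4
  rw [← hr] at h4
  have h5 := h3.trans (mul_le_mul_of_nonneg_left h4 (by positivity))
  calc ∫ x, |haarShift s F c α x| ^ p
      ≤ CB * (B ^ p * (2 * (2 * r) ^ r * (2 * (2 * r) ^ r * ∫ x, |haarSum F c x| ^ p))) :=
        h1.trans (mul_le_mul_of_nonneg_left
          (h2.trans (mul_le_mul_of_nonneg_left h5 (by positivity))) hCB0)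
    _ = _ := by ring

lemma exists_haarSum_adjoint_le (n : ℕ) {e : ℝ} (he : 2 ≤ e) :
    ∃ C : ℝ, 0 ≤ C ∧ ∀ (γ κ : ℝ), κ ≤ γ → κ ≤ e⁻¹ → ∀ (s : ℕ) (F : Finset (HaarIndex n))
      (α : HaarIndex n → ℝ) (H : ℝ) (G : ℕ → Finset (HaarIndex n)), 0 ≤ H →
      (∀ q ∈ F, q.2.2 ≠ fun _ => false) → LayeredCoeff γ s F α H G →
      ∀ g : (Fin n → ℝ) → ℝ, IsNice g →
      ∫ x, |haarSum F (fun q => α q * haarCoeff g (q.anc s)) x| ^ e ≤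
        C * (H * (1 + s) * (2:ℝ) ^ (-(s:ℝ) * κ)) ^ e * ∫ x, |g x| ^ e := by
  obtain ⟨CB, hCB0, hCB⟩ := exists_integral_haarSum_rpow_le n he
  set r := e / 2 with hr
  have hr1 : 1 ≤ r := by linarith
  refine ⟨CB * (r * (2 * (2 * r) ^ r)), by positivity, ?_⟩
  intro γ κ hκγ hκe s F α H G hH hF hG g hg
  set B : ℝ := H * (1 + s) * (2:ℝ) ^ (-(s:ℝ) * κ) with hB
  have hB0 : 0 ≤ B := by positivity
  set ν : ℝ := (((2:ℝ) ^ s) ^ n)⁻¹ with hν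
  have hν0 : 0 ≤ ν := by positivity
  set F' := F.image (HaarIndex.anc s) with hF'
  set d : HaarIndex n → ℝ := haarCoeff g with hd
  set z : HaarIndex n → ℝ := fun q => ν * d (q.anc s) ^ 2 with hz
  have hz0 : ∀ q, 0 ≤ z q := fun q => mul_nonneg hν0 (sq_nonneg _)
  set lam : ℕ → ℝ := fun j => (2:ℝ) ^ (-(2 * γ * j)) with hlam
  have hlam0 : ∀ j, 0 ≤ lam j := fun j => by positivity
  have h1 := hCB F (fun q => α q * d (q.anc s)) hF
  set X := ∫ x, sqFn F' (fun Q => d Q ^ 2) x ^ r with hX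
  have hX0 : 0 ≤ X := integral_nonneg fun x =>
    Real.rpow_nonneg (sqFn_nonneg (fun q => sq_nonneg _) x) _
  have hpt : ∀ x, sqFn F (fun q => (α q * d (q.anc s)) ^ 2) x ^ r ≤
      ∑ j ∈ Finset.range (s + 1),
        H ^ e * ((1 + s : ℝ) ^ (r - 1) * (lam j ^ r * sqFn (G j) z x ^ r)) := by
    intro x
    have a1 : sqFn F (fun q => (α q * d (q.anc s)) ^ 2) x ≤
        H ^ 2 * ∑ j ∈ Finset.range (s + 1), lam j * sqFn (G j) z x := by
      have b1 : ∀ q ∈ F, (α q * d (q.anc s)) ^ 2 ≤ H ^ 2 * ∑ j ∈ Finset.range (s + 1),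
          lam j * ((if q ∈ G j then 1 else 0) * z q) := by
        intro q hq
        rw [mul_pow]
        refine (mul_le_mul_of_nonneg_right (hG.sq_le q hq) (sq_nonneg _)).trans (le_of_eq ?_)
        simp only [← mul_assoc, ← Finset.sum_mul, hz]
        simp only [hlam, ← hν]
        ring
      refine (sqFn_mono_coeff b1 x).trans (le_of_eq ?_)
      unfold sqFn
      simp only [Finset.mul_sum, Finset.sum_mul]
      rw [Finset.sum_comm]
      refine Finset.sum_congr rfl fun j _ => ?_
      rw [← Finset.sum_subset (hG.subset j) (f := fun q => H ^ 2 * (lam j *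
        ((if q ∈ G j then 1 else 0) * z q)) * density q x)]
      · refine Finset.sum_congr rfl fun q hq => ?_
        rw [if_pos hq]; ring
      · intro q _ hq
        simp only [if_neg hq]; ring
    have a2 : ∀ j ∈ Finset.range (s + 1), 0 ≤ lam j * sqFn (G j) z x := fun j _ =>
      mul_nonneg (hlam0 j) (sqFn_nonneg hz0 x)
    have a3 := Real.rpow_sum_le_const_mul_sum_rpow_of_nonneg (Finset.range (s + 1)) hr1 a2
    rw [Finset.card_range] at a3
    have e2 : (H ^ 2) ^ r = H ^ e := by
      rw [← abs_rpow_eq_sq_rpow, abs_of_nonneg hH]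
    refine (Real.rpow_le_rpow (sqFn_nonneg (fun q => sq_nonneg _) x) a1 (by linarith)).trans ?_
    rw [Real.mul_rpow (sq_nonneg H) (Finset.sum_nonneg a2), e2, ← Finset.mul_sum,
      ← Finset.mul_sum]
    refine mul_le_mul_of_nonneg_left (a3.trans (le_of_eq ?_)) (by positivity)
    push_cast
    rw [add_comm (s:ℝ) 1]
    congr 1
    exact Finset.sum_congr rfl fun j _ => Real.mul_rpow (hlam0 j) (sqFn_nonneg hz0 x)
  have nT : ∀ j, IsNice (fun x => H ^ e * ((1 + s : ℝ) ^ (r - 1) *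
      (lam j ^ r * sqFn (G j) z x ^ r))) := fun j =>
    (((isNice_sqFn.rpow (by linarith)).const_mul _).const_mul _).const_mul _
  have h2 := integral_mono (isNice_sqFn.rpow (by linarith)).integrable
    (IsNice.sum (Finset.range (s + 1)) fun j _ => nT j).integrable hpt
  rw [integral_finsetSum _ fun j _ => (nT j).integrable] at h2
  simp only [integral_const_mul] at h2
  have h3 : ∀ j ∈ Finset.range (s + 1), H ^ e * ((1 + s : ℝ) ^ (r - 1) *
      (lam j ^ r * ∫ x, sqFn (G j) z x ^ r)) ≤
      H ^ e * ((1 + s : ℝ) ^ (r - 1) * (r * X)) *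
        ((2:ℝ) ^ (-(e * γ * j)) * (2:ℝ) ^ ((j:ℝ) - s)) := by
    intro j hj
    have a1 := integral_sqFn_desc_rpow_le (G := G j) (F' := F') (s := s)
      (fun q hq => Finset.mem_image_of_mem _ (hG.subset j hq)) d
      (hG.card_le j (Nat.lt_succ_iff.1 (Finset.mem_range.1 hj))) hr1
    have a2 : lam j ^ r = (2:ℝ) ^ (-(e * γ * j)) := by
      rw [hlam, ← Real.rpow_mul (by norm_num), hr]; congr 1; ring
    rw [a2]
    have a3 := mul_le_mul_of_nonneg_left a1
      (show 0 ≤ H ^ e * ((1 + s : ℝ) ^ (r - 1) * (2:ℝ) ^ (-(e * γ * j))) by positivity)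
    refine le_trans (le_of_eq ?_) (a3.trans (le_of_eq ?_))
    · ring
    · rw [← hX]; ring
  have h4 := h2.trans (Finset.sum_le_sum h3)
  rw [← Finset.mul_sum] at h4
  have h5 := mul_le_mul_of_nonneg_left (layer_sum_le s hκγ (by linarith : 0 < e) hκe)
    (show 0 ≤ H ^ e * ((1 + s : ℝ) ^ (r - 1) * (r * X)) by positivity)
  have h6 : H ^ e * ((1 + s : ℝ) ^ (r - 1) * (r * X)) *
      ((1 + s) * ((2:ℝ) ^ (-(s:ℝ) * κ)) ^ e) ≤ r * (B ^ e * X) := by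
    have hs : (0:ℝ) ≤ s := Nat.cast_nonneg s
    have a1 : (1 + s : ℝ) ^ (r - 1) * (1 + s) ≤ (1 + s) ^ e := by
      rw [← Real.rpow_add_one (by positivity)]
      exact Real.rpow_le_rpow_of_exponent_le (by linarith) (by linarith)
    have a2 : B ^ e = H ^ e * (1 + s) ^ e * ((2:ℝ) ^ (-(s:ℝ) * κ)) ^ e := by
      rw [hB, Real.mul_rpow (by positivity) (by positivity), Real.mul_rpow hH (by positivity)]
    rw [a2]
    have a3 := mul_le_mul_of_nonneg_left a1
      (show 0 ≤ H ^ e * ((2:ℝ) ^ (-(s:ℝ) * κ)) ^ e * (r * X) by positivity)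
    refine le_trans (le_of_eq ?_) (a3.trans (le_of_eq ?_)) <;> ring
  have h7 : X ≤ 2 * (2 * r) ^ r * ∫ x, |g x| ^ e := by
    have := integral_sqFn_haarCoeff_le hg (anc_cancellative hF s) hr1
    simp only [hr, ← abs_rpow_eq_sq_rpow] at this
    rw [← hr] at this
    exact this
  calc _ ≤ CB * (r * (B ^ e * (2 * (2 * r) ^ r * ∫ x, |g x| ^ e))) := by
        refine h1.trans (mul_le_mul_of_nonneg_left ((h4.trans (h5.trans h6)).trans ?_) hCB0)
        exact mul_le_mul_of_nonneg_left (mul_le_mul_of_nonneg_left h7 (by positivity))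
          (by linarith)
    _ = _ := by ring

lemma IsNice.memLp {u : (Fin n → ℝ) → ℝ} (hu : IsNice u) {p : ℝ} (hp : 0 < p) :
    MemLp u (ENNReal.ofReal p) := by
  have h := integrable_norm_rpow_iff (p := ENNReal.ofReal p) (μ := volume)
    hu.measurable.aestronglyMeasurable (by simpa using hp) ENNReal.ofReal_ne_top
  rw [← h, ENNReal.toReal_ofReal hp.le]
  exact (hu.abs_rpow hp.ne').integrable

lemma IsNice.eLpNorm_eq {u : (Fin n → ℝ) → ℝ} (hu : IsNice u) {p : ℝ} (hp : 0 < p) :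
    eLpNorm u (ENNReal.ofReal p) volume = ENNReal.ofReal ((∫ x, |u x| ^ p) ^ p⁻¹) := by
  rw [MemLp.eLpNorm_eq_integral_rpow_norm (by simpa using hp) ENNReal.ofReal_ne_top
    (hu.memLp hp), ENNReal.toReal_ofReal hp.le]
  rfl

lemma exists_haarShift_le_of_lt_two (n : ℕ) {p : ℝ} (hp1 : 1 < p) (hp2 : p < 2) :
    ∃ C : ℝ, 0 ≤ C ∧ ∀ (γ κ : ℝ), κ ≤ γ → κ ≤ 1 - 1 / p → ∀ (s : ℕ) (F : Finset (HaarIndex n))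
      (c α : HaarIndex n → ℝ) (H : ℝ) (G : ℕ → Finset (HaarIndex n)), 0 ≤ H →
      (∀ q ∈ F, q.2.2 ≠ fun _ => false) → LayeredCoeff γ s F α H G →
      ∫ x, |haarShift s F c α x| ^ p ≤
        C * (H * (1 + s) * (2:ℝ) ^ (-(s:ℝ) * κ)) ^ p * ∫ x, |haarSum F c x| ^ p := by
  have hpe : p.HolderConjugate (p / (p - 1)) := Real.HolderConjugate.conjExponent hp1
  set e := p / (p - 1) with he
  have he2 : 2 ≤ e := by
    rw [he, le_div_iff₀ (by linarith)]; linarith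
  obtain ⟨C, hC0, hC⟩ := exists_haarSum_adjoint_le n he2
  refine ⟨(C ^ e⁻¹) ^ p, by positivity, ?_⟩
  intro γ κ hκγ hκp s F c α H G hH hF hG
  have hκe : κ ≤ e⁻¹ := by
    refine hκp.trans (le_of_eq ?_)
    have := hpe.inv_add_inv_eq_one
    rw [one_div]; linarith
  set B : ℝ := H * (1 + s) * (2:ℝ) ^ (-(s:ℝ) * κ) with hB
  have hB0 : 0 ≤ B := by positivity
  set Λ := haarShift s F c α with hΛ
  have hΛn : IsNice Λ := isNice_haarShift s F c α
  set g : (Fin n → ℝ) → ℝ := fun x => SignType.sign (Λ x) * |Λ x| ^ (p - 1) with hg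
  have hgn : IsNice g := hΛn.comp (fun t => (SignType.sign t : ℝ) * |t| ^ (p - 1)) (by simp)
  have hgΛ : ∀ x, g x * Λ x = |Λ x| ^ p := by
    intro x
    have h1 : g x * Λ x = |Λ x| * |Λ x| ^ (p - 1) := by
      rw [hg]
      simp only
      have := sign_mul_self (Λ x)
      calc (SignType.sign (Λ x) : ℝ) * |Λ x| ^ (p - 1) * Λ x =
            (SignType.sign (Λ x) * Λ x) * |Λ x| ^ (p - 1) := by ring
        _ = _ := by rw [this]
    rw [h1]
    rcases (abs_nonneg (Λ x)).eq_or_lt with h | h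
    · rw [← h, zero_mul, Real.zero_rpow (by linarith)]
    · have := Real.rpow_add h 1 (p - 1)
      rw [Real.rpow_one] at this
      rw [← this]; congr 1; ring
  have hge : ∀ x, |g x| ^ e = |Λ x| ^ p := by
    intro x
    rcases eq_or_ne (Λ x) 0 with h | h
    · simp only [hg, h, sign_zero, SignType.coe_zero, zero_mul, abs_zero]
      rw [Real.zero_rpow (by linarith), Real.zero_rpow (by linarith)]
    · have h1 : |g x| = |Λ x| ^ (p - 1) := by
        rw [hg]
        simp only
        rw [abs_mul, abs_of_nonneg (show 0 ≤ |Λ x| ^ (p - 1) by positivity)]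
        rcases lt_or_gt_of_ne h with h2 | h2 <;> simp [h2]
      rw [h1, ← Real.rpow_mul (abs_nonneg _)]
      congr 1
      rw [he]; field_simp [sub_ne_zero.2 hp1.ne']
  set S : (Fin n → ℝ) → ℝ := haarSum F (fun q => α q * haarCoeff g (q.anc s)) with hS
  have hSn : IsNice S := isNice_haarSum
  set f := haarSum F c with hf
  have hfn : IsNice f := isNice_haarSum
  set Y := ∫ x, |Λ x| ^ p with hY
  set Z := ∫ x, |f x| ^ p with hZ
  have hY0 : 0 ≤ Y := integral_nonneg fun x => by positivity
  have hZ0 : 0 ≤ Z := integral_nonneg fun x => by positivity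
  have h1 : Y ≤ Z ^ (1 / p) * (∫ x, |S x| ^ e) ^ (1 / e) := by
    have a1 : Y = ∫ x, f x * S x := by
      rw [hS, hf, ← integral_haarShift_mul hgn hF, hY]
      simp only [← hΛ, hgΛ]
    have a2 : ∫ x, f x * S x ≤ ∫ x, |f x| * |S x| :=
      integral_mono (hfn.mul hSn).integrable
        ((hfn.comp (fun t => |t|) abs_zero).mul (hSn.comp (fun t => |t|) abs_zero)).integrable
        fun x => (le_abs_self _).trans (le_of_eq (abs_mul _ _))
    rw [a1]
    exact a2.trans (integral_mul_le_Lp_mul_Lq_of_nonneg hpe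
      (Filter.Eventually.of_forall fun x => abs_nonneg _)
      (Filter.Eventually.of_forall fun x => abs_nonneg _)
      ((hfn.comp (fun t => |t|) abs_zero).memLp (by linarith))
      ((hSn.comp (fun t => |t|) abs_zero).memLp (by linarith)))
  have h2 := hC γ κ hκγ hκe s F α H G hH hF hG g hgn
  simp only [hge] at h2
  rw [← hS, ← hB, ← hY] at h2
  have hS0 : 0 ≤ ∫ x, |S x| ^ e := integral_nonneg fun x => by positivity
  have h3 : (∫ x, |S x| ^ e) ^ (1 / e) ≤ C ^ e⁻¹ * B * Y ^ e⁻¹ := by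
    rw [one_div]
    refine (Real.rpow_le_rpow hS0 h2 (by positivity)).trans (le_of_eq ?_)
    rw [Real.mul_rpow (by positivity) hY0, Real.mul_rpow hC0 (by positivity),
      Real.rpow_rpow_inv hB0 (by linarith)]
  have h4 : Y ≤ Z ^ p⁻¹ * (C ^ e⁻¹ * B * Y ^ e⁻¹) := by
    rw [← one_div p]
    exact h1.trans (mul_le_mul_of_nonneg_left h3 (by positivity))
  rcases hY0.eq_or_lt with h | h
  · rw [← h]; positivity
  have hYe : 0 < Y ^ e⁻¹ := Real.rpow_pos_of_pos h _
  have h5 : Y ^ p⁻¹ ≤ Z ^ p⁻¹ * (C ^ e⁻¹ * B) := by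
    have a1 : Y ^ p⁻¹ * Y ^ e⁻¹ = Y := by
      rw [← Real.rpow_add h, hpe.inv_add_inv_eq_one, Real.rpow_one]
    refine le_of_mul_le_mul_right ?_ hYe
    rw [a1]
    exact h4.trans (le_of_eq (by ring))
  have h6 := Real.rpow_le_rpow (by positivity) h5 (show 0 ≤ p by linarith)
  rw [Real.rpow_inv_rpow hY0 (by linarith), Real.mul_rpow (by positivity) (by positivity),
    Real.rpow_inv_rpow hZ0 (by linarith), Real.mul_rpow (by positivity) hB0] at h6
  linarith

/-- `L^p` bound for Haar shifts with layered coefficients. -/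
theorem exists_eLpNorm_haarShift_le (n : ℕ) {p : ℝ} (hp : 1 < p) :
    ∃ C : ℝ, 0 ≤ C ∧ ∀ (γ κ : ℝ), κ ≤ γ → κ ≤ 1 / 2 → κ ≤ 1 - 1 / p →
      ∀ (s : ℕ) (F : Finset (HaarIndex n))
      (c α : HaarIndex n → ℝ) (H : ℝ) (G : ℕ → Finset (HaarIndex n)), 0 ≤ H →
      (∀ q ∈ F, q.2.2 ≠ fun _ => false) → LayeredCoeff γ s F α H G →
      eLpNorm (haarShift s F c α) (ENNReal.ofReal p) volume ≤
        ENNReal.ofReal (C * (H * (1 + s) * (2:ℝ) ^ (-(s:ℝ) * κ))) *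
          eLpNorm (haarSum F c) (ENNReal.ofReal p) volume := by
  obtain ⟨C, hC0, hC⟩ : ∃ C : ℝ, 0 ≤ C ∧ ∀ (γ κ : ℝ), κ ≤ γ → κ ≤ 1 / 2 → κ ≤ 1 - 1 / p →
      ∀ (s : ℕ) (F : Finset (HaarIndex n))
      (c α : HaarIndex n → ℝ) (H : ℝ) (G : ℕ → Finset (HaarIndex n)), 0 ≤ H →
      (∀ q ∈ F, q.2.2 ≠ fun _ => false) → LayeredCoeff γ s F α H G →
      ∫ x, |haarShift s F c α x| ^ p ≤
        C * (H * (1 + s) * (2:ℝ) ^ (-(s:ℝ) * κ)) ^ p * ∫ x, |haarSum F c x| ^ p := by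
    rcases le_or_gt 2 p with h | h
    · obtain ⟨C, hC0, hC⟩ := exists_haarShift_le_of_two_le n h
      exact ⟨C, hC0, fun γ κ h1 h2 _ => hC γ κ h1 h2⟩
    · obtain ⟨C, hC0, hC⟩ := exists_haarShift_le_of_lt_two n hp h
      exact ⟨C, hC0, fun γ κ h1 _ h2 => hC γ κ h1 h2⟩
  refine ⟨C ^ p⁻¹, by positivity, fun γ κ h1 h2 h3 s F c α H G hH hF hG => ?_⟩
  have h := hC γ κ h1 h2 h3 s F c α H G hH hF hG
  set B := H * (1 + s) * (2:ℝ) ^ (-(s:ℝ) * κ) with hB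
  have hB0 : 0 ≤ B := by positivity
  rw [(isNice_haarShift s F c α).eLpNorm_eq (by linarith), isNice_haarSum.eLpNorm_eq (by linarith),
    ← ENNReal.ofReal_mul (by positivity)]
  refine ENNReal.ofReal_le_ofReal ?_
  have hZ0 : 0 ≤ ∫ x, |haarSum F c x| ^ p := integral_nonneg fun x => by positivity
  have hY0 : 0 ≤ ∫ x, |haarShift s F c α x| ^ p := integral_nonneg fun x => by positivity
  refine (Real.rpow_le_rpow hY0 h (by positivity)).trans (le_of_eq ?_)
  rw [Real.mul_rpow (by positivity) hZ0, Real.mul_rpow hC0 (by positivity),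
    Real.rpow_rpow_inv hB0 (by linarith)]

/-! ### Off-diagonal estimates for singular integrals -/

/-- The truncated weakly singular kernel `1_{r ≤ R} r^{1/2-d}`. -/
def nearKernel (d : ℕ) (R : ℝ) : ℝ → ℝ :=
  (Set.Iic R).indicator fun r => r ^ ((1:ℝ) / 2 - d)

/-- The truncated tail `1_{r ≥ R} r^{-d-γ}`. -/
def farKernel (d : ℕ) (γ R : ℝ) : ℝ → ℝ :=
  (Set.Ici R).indicator fun r => r ^ (-(d:ℝ) - γ)

lemma nearKernel_nonneg {d : ℕ} {R r : ℝ} (hr : 0 ≤ r) : 0 ≤ nearKernel d R r :=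
  Set.indicator_apply_nonneg fun _ => by positivity

lemma farKernel_nonneg {d : ℕ} {γ R r : ℝ} (hr : 0 ≤ r) : 0 ≤ farKernel d γ R r :=
  Set.indicator_apply_nonneg fun _ => by positivity

section Radial

variable {E : Type*} [NormedAddCommGroup E] [NormedSpace ℝ E] [FiniteDimensional ℝ E]
  [Nontrivial E] [MeasurableSpace E] [BorelSpace E] (μ : Measure E) [μ.IsAddHaarMeasure]

lemma eqOn_pow_smul_nearKernel {d : ℕ} (hd : 0 < d) (R : ℝ) :
    Set.EqOn (fun r => r ^ (d - 1) • nearKernel d R r)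
      ((Set.Iic R).indicator fun r : ℝ => r ^ (-(1:ℝ) / 2)) (Set.Ioi 0) := by
  intro r (hr : 0 < r)
  change r ^ (d - 1) • nearKernel d R r = _
  unfold nearKernel
  by_cases h : r ∈ Set.Iic R
  · rw [Set.indicator_of_mem h, Set.indicator_of_mem h, smul_eq_mul, ← Real.rpow_natCast,
      ← Real.rpow_add hr, Nat.cast_sub hd]
    congr 1; push_cast; ring
  · simp [h]

lemma eqOn_pow_smul_farKernel {d : ℕ} (hd : 0 < d) (γ R : ℝ) :
    Set.EqOn (fun r => r ^ (d - 1) • farKernel d γ R r)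
      ((Set.Ici R).indicator fun r : ℝ => r ^ (-1 - γ)) (Set.Ioi 0) := by
  intro r (hr : 0 < r)
  change r ^ (d - 1) • farKernel d γ R r = _
  unfold farKernel
  by_cases h : r ∈ Set.Ici R
  · rw [Set.indicator_of_mem h, Set.indicator_of_mem h, smul_eq_mul, ← Real.rpow_natCast,
      ← Real.rpow_add hr, Nat.cast_sub hd]
    congr 1; push_cast; ring
  · simp [h]

lemma integrable_nearKernel_norm (R : ℝ) :
    Integrable (fun z : E => nearKernel (Module.finrank ℝ E) R ‖z‖) μ := by
  rw [integrable_fun_norm_addHaar]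
  rw [integrableOn_congr_fun (eqOn_pow_smul_nearKernel Module.finrank_pos R)
    measurableSet_Ioi]
  rw [integrableOn_indicator_iff measurableSet_Iic]
  rcases le_or_gt 0 R with hR | hR
  · have h : IntervalIntegrable (fun r : ℝ => r ^ (-(1:ℝ) / 2)) volume 0 R :=
      intervalIntegral.intervalIntegrable_rpow' (by norm_num)
    rw [intervalIntegrable_iff_integrableOn_Ioc_of_le hR] at h
    rwa [Set.inter_comm, Set.Ioi_inter_Iic]
  · rw [Set.inter_comm, Set.Ioi_inter_Iic, Set.Ioc_eq_empty (by linarith)]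
    exact integrableOn_empty

lemma integral_nearKernel_norm {R : ℝ} (hR : 0 ≤ R) :
    ∫ z : E, nearKernel (Module.finrank ℝ E) R ‖z‖ ∂μ =
      Module.finrank ℝ E * μ.real (Metric.ball 0 1) * (2 * R ^ ((1:ℝ) / 2)) := by
  rw [integral_fun_norm_addHaar]
  rw [setIntegral_congr_fun measurableSet_Ioi
    (eqOn_pow_smul_nearKernel Module.finrank_pos R),
    setIntegral_indicator measurableSet_Iic, Set.Ioi_inter_Iic,
    ← intervalIntegral.integral_of_le hR, integral_rpow (Or.inl (by norm_num))]
  norm_num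
  ring

lemma integrable_farKernel_norm {γ R : ℝ} (hγ : 0 < γ) (hR : 0 < R) :
    Integrable (fun z : E => farKernel (Module.finrank ℝ E) γ R ‖z‖) μ := by
  rw [integrable_fun_norm_addHaar]
  rw [integrableOn_congr_fun (eqOn_pow_smul_farKernel Module.finrank_pos γ R)
    measurableSet_Ioi]
  rw [integrableOn_indicator_iff measurableSet_Ici]
  have h := integrableOn_Ioi_rpow_of_lt (by linarith : -1 - γ < -1) hR
  exact ((integrableOn_Ici_iff_integrableOn_Ioi).2 h).mono_set Set.inter_subset_left

lemma integral_farKernel_norm {γ R : ℝ} (hγ : 0 < γ) (hR : 0 < R) :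
    ∫ z : E, farKernel (Module.finrank ℝ E) γ R ‖z‖ ∂μ =
      Module.finrank ℝ E * μ.real (Metric.ball 0 1) * (γ⁻¹ * R ^ (-γ)) := by
  rw [integral_fun_norm_addHaar]
  rw [setIntegral_congr_fun measurableSet_Ioi
    (eqOn_pow_smul_farKernel Module.finrank_pos γ R),
    setIntegral_indicator measurableSet_Ici,
    Set.inter_eq_right.2 (Set.Ici_subset_Ioi.2 hR),
    integral_Ici_eq_integral_Ioi, integral_Ioi_rpow_of_lt (by linarith) hR]
  rw [show -1 - γ + 1 = -γ by ring]
  simp only [nsmul_eq_mul, smul_eq_mul]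
  field_simp

end Radial

/-- Off-diagonal decay of a singular integral of a function with mean zero. -/
lemma abs_czIntegral_le_of_lt_dist {γ : ℝ} (hγ : 0 < γ) {K : (Fin n → ℝ) → (Fin n → ℝ) → ℝ}
    (hK : IsNormalisedKernel n γ K) {h : (Fin n → ℝ) → ℝ} (hh : Integrable h)
    (h0 : ∫ y, h y = 0) {c x : Fin n → ℝ} {l : ℝ}
    (hc : ∀ y, h y ≠ 0 → ‖y - c‖ ≤ l / 2) (hx : l < dist x c) :
    |czIntegral K h x| ≤ l ^ γ * dist x c ^ (-(n:ℝ) - γ) * ∫ y, |h y| := by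
  have hl : 0 ≤ l ∨ ∀ y, h y = 0 := by
    by_contra! hcon
    obtain ⟨h1, y, hy⟩ := hcon
    linarith [norm_nonneg (y - c), hc y hy]
  rcases hl with hl | hl
  swap
  · simp [czIntegral, hl]
  by_cases hi : Integrable fun y => K x y * h y
  swap
  · rw [czIntegral, integral_undef hi, abs_zero]
    have : 0 ≤ ∫ y, |h y| := integral_nonneg fun y => abs_nonneg _
    positivity
  have e : czIntegral K h x = ∫ y, (K x y - K x c) * h y := by
    simp only [sub_mul]
    rw [integral_sub hi (hh.const_mul _), integral_const_mul, h0]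
    simp [czIntegral]
  rw [e, ← integral_const_mul, ← Real.norm_eq_abs]
  refine norm_integral_le_of_norm_le (hh.abs.const_mul _) (Filter.Eventually.of_forall fun y => ?_)
  rw [Real.norm_eq_abs, abs_mul]
  by_cases hy : h y = 0
  · simp [hy]
  refine mul_le_mul_of_nonneg_right ?_ (abs_nonneg _)
  have h1 := hK.smooth x c (y - c) (by linarith [hc y hy])
  rw [add_sub_cancel] at h1
  have h2 : ‖y - c‖ ^ γ ≤ l ^ γ :=
    Real.rpow_le_rpow (norm_nonneg _) (by linarith [hc y hy]) hγ.le
  have h3 : 0 ≤ dist x c ^ (-(n:ℝ) - γ) := by positivity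
  have h4 := abs_nonneg (K (x + (y - c)) c - K x c)
  nlinarith [mul_le_mul_of_nonneg_right h2 h3]

/-- Local bound for a singular integral of a bounded function off its support. -/
lemma exists_abs_czIntegral_le_of_dist_le (hn : 0 < n) : ∃ D : ℝ, 0 ≤ D ∧ ∀ (γ : ℝ)
    (K : (Fin n → ℝ) → (Fin n → ℝ) → ℝ), IsNormalisedKernel n γ K →
    ∀ (h : (Fin n → ℝ) → ℝ) (c x : Fin n → ℝ) (l M t : ℝ), 0 ≤ l → 0 < t → (∀ y, |h y| ≤ M) →
    (∀ y, h y ≠ 0 → ‖y - c‖ ≤ l / 2) → (∀ y, h y ≠ 0 → t ≤ dist x y) → dist x c ≤ l →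
    |czIntegral K h x| ≤ D * (M * l ^ ((1:ℝ) / 2) * t ^ (-(1:ℝ) / 2)) := by
  have : Nonempty (Fin n) := ⟨⟨0, hn⟩⟩
  set V : ℝ := n * volume.real (Metric.ball (0 : Fin n → ℝ) 1) with hV
  refine ⟨V * (2 * 2 ^ ((1:ℝ) / 2)), by positivity, ?_⟩
  intro γ K hK h c x l M t hl ht hM hc hd hx
  have hM0 : 0 ≤ M := (abs_nonneg _).trans (hM 0)
  have hI := integrable_nearKernel_norm (volume : Measure (Fin n → ℝ)) (2 * l)
  have hE := integral_nearKernel_norm (volume : Measure (Fin n → ℝ)) (R := 2 * l) (by linarith)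
  rw [Module.finrank_fin_fun] at hI hE
  have hI' := (hI.comp_sub_left x).const_mul (M * t ^ (-(1:ℝ) / 2))
  have hE' : ∫ y, M * t ^ (-(1:ℝ) / 2) * nearKernel n (2 * l) ‖x - y‖ =
      V * (2 * 2 ^ ((1:ℝ) / 2)) * (M * l ^ ((1:ℝ) / 2) * t ^ (-(1:ℝ) / 2)) := by
    rw [integral_const_mul,
      integral_sub_left_eq_self (fun z => nearKernel n (2 * l) ‖z‖) volume x, hE,
      Real.mul_rpow (by norm_num) hl, ← hV]
    ring
  rw [← hE', ← Real.norm_eq_abs]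
  refine norm_integral_le_of_norm_le hI' (Filter.Eventually.of_forall fun y => ?_)
  rw [Real.norm_eq_abs, abs_mul]
  by_cases hy : h y = 0
  · rw [hy, abs_zero, mul_zero]
    exact mul_nonneg (by positivity) (nearKernel_nonneg (norm_nonneg _))
  have h1 := hd y hy
  have h2 : dist x y ≤ 2 * l := by
    have := dist_triangle x c y
    rw [dist_comm c y, dist_eq_norm y c] at this
    linarith [hc y hy]
  have h3 := hK.size x y (dist_pos.1 (ht.trans_le h1))
  have h4 : nearKernel n (2 * l) ‖x - y‖ = dist x y ^ ((1:ℝ) / 2 - n) := by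
    rw [← dist_eq_norm, nearKernel, Set.indicator_of_mem (Set.mem_Iic.2 h2)]
  rw [h4]
  have h5 : dist x y ^ (-(n:ℝ)) ≤ t ^ (-(1:ℝ) / 2) * dist x y ^ ((1:ℝ) / 2 - n) := by
    rw [show -(n:ℝ) = -(1:ℝ) / 2 + (1 / 2 - n) by ring, Real.rpow_add (ht.trans_le h1)]
    refine mul_le_mul_of_nonneg_right ?_ (by positivity)
    exact Real.rpow_le_rpow_of_nonpos ht h1 (by norm_num)
  calc |K x y| * |h y| ≤ (t ^ (-(1:ℝ) / 2) * dist x y ^ ((1:ℝ) / 2 - n)) * M :=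
        mul_le_mul (h3.trans h5) (hM y) (abs_nonneg _) (by positivity)
    _ = _ := by ring

open Classical in
lemma abs_haarFn (k : ℤ) (μ : Fin n → ℤ) (η : Fin n → Bool) (x : Fin n → ℝ) :
    |haarFn n k μ η x| =
      if dyadicIdx k x = μ then ((2:ℝ) ^ (-k)) ^ (-(n:ℝ) / 2) else 0 := by
  have h : haarFn n k μ η x ^ 2 = if dyadicIdx k x = μ then ((2:ℝ) ^ k) ^ n else 0 :=
    haar_sq (k, μ, η) x
  split_ifs at h ⊢ with hx
  · rw [← Real.sqrt_sq_eq_abs, h, Real.sqrt_eq_rpow, ← Real.rpow_natCast,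
      ← Real.rpow_mul (by positivity), zpow_neg, Real.inv_rpow (by positivity),
      ← Real.rpow_neg (by positivity)]
    congr 1; ring
  · simpa using h

lemma abs_haarFn_le (k : ℤ) (μ : Fin n → ℤ) (η : Fin n → Bool) (x : Fin n → ℝ) :
    |haarFn n k μ η x| ≤ ((2:ℝ) ^ (-k)) ^ (-(n:ℝ) / 2) := by
  rw [abs_haarFn]; split_ifs
  · exact le_rfl
  · positivity

lemma integrable_haarFn (k : ℤ) (μ : Fin n → ℤ) (η : Fin n → Bool) :
    Integrable (haarFn n k μ η) := (isNice_haar (k, μ, η)).integrable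

lemma integral_abs_haarFn (k : ℤ) (μ : Fin n → ℤ) (η : Fin n → Bool) :
    ∫ x, |haarFn n k μ η x| = ((2:ℝ) ^ (-k)) ^ ((n:ℝ) / 2) := by
  have h : ∀ x, |haarFn n k μ η x| = ((2:ℝ) ^ (-k)) ^ ((n:ℝ) / 2) * density (k, μ, η) x := by
    intro x
    rw [abs_haarFn, density]
    split_ifs
    · rw [show ((2:ℝ) ^ k) ^ n = ((2:ℝ) ^ (-k)) ^ (-(n:ℝ)) by
        rw [zpow_neg, Real.inv_rpow (by positivity), ← Real.rpow_neg (by positivity), neg_neg,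
          Real.rpow_natCast], ← Real.rpow_add (by positivity)]
      congr 1; ring
    · simp
  simp only [h]
  rw [integral_const_mul, integral_density, mul_one]

lemma dyadicIdx_of_haarFn_ne_zero {k : ℤ} {μ : Fin n → ℤ} {η : Fin n → Bool} {x : Fin n → ℝ}
    (h : haarFn n k μ η x ≠ 0) : dyadicIdx k x = μ := by
  by_contra hne
  exact h (haar_eq_zero (q := (k, μ, η)) hne)

lemma mem_Ico_of_dyadicIdx {k : ℤ} {μ : Fin n → ℤ} {x : Fin n → ℝ} (h : dyadicIdx k x = μ)
    (i : Fin n) : x i ∈ Set.Ico ((2:ℝ) ^ (-k) * μ i) ((2:ℝ) ^ (-k) * (μ i + 1)) :=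
  (mem_dyadic_Ico_iff _ _ _).2 (congrFun h i)

lemma norm_sub_cubeCenter_le {k : ℤ} {μ : Fin n → ℤ} {x : Fin n → ℝ} (h : dyadicIdx k x = μ) :
    ‖x - cubeCenter n k μ‖ ≤ (2:ℝ) ^ (-k) / 2 := by
  refine (pi_norm_le_iff_of_nonneg (by positivity)).2 fun i => ?_
  obtain ⟨h1, h2⟩ := mem_Ico_of_dyadicIdx h i
  rw [Pi.sub_apply, cubeCenter, Real.norm_eq_abs, abs_le]
  constructor <;> linarith

/-! ### Distances to the faces of a cube -/

/-- In units of the side length of the small interval `a`, the distance to the end of its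
`s`-th ancestor in the direction of `b`. -/
def edgeGap (s : ℕ) (a b : ℤ) : ℤ := if 0 < b then 2 ^ s - 1 - a % 2 ^ s else a % 2 ^ s

lemma edgeGap_nonneg (s : ℕ) (a b : ℤ) : 0 ≤ edgeGap s a b := by
  have h1 := Int.emod_nonneg a (by positivity : (2:ℤ) ^ s ≠ 0)
  have h2 := Int.emod_lt_of_pos a (by positivity : (0:ℤ) < 2 ^ s)
  unfold edgeGap; split_ifs <;> lia

lemma edgeGap_lt (s : ℕ) (a b : ℤ) : edgeGap s a b < 2 ^ s := by
  have h1 := Int.emod_nonneg a (by positivity : (2:ℤ) ^ s ≠ 0)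
  have h2 := Int.emod_lt_of_pos a (by positivity : (0:ℤ) < 2 ^ s)
  unfold edgeGap; split_ifs <;> lia

/-- The endpoint, in the direction of `b`, of the interval of side `l` and index `a`. -/
def nearEdge (l : ℝ) (a b : ℤ) : ℝ := if 0 < b then l * (a + 1) else l * a

lemma abs_nearEdge_sub {l : ℝ} (hl : 0 ≤ l) (a b : ℤ) :
    |nearEdge l a b - l * (a + 1 / 2)| ≤ l / 2 := by
  unfold nearEdge
  split_ifs <;> rw [abs_le] <;> constructor <;> linarith

lemma abs_sub_nearEdge_le {l u v : ℝ} {s : ℕ} {a b : ℤ} (hl : 0 < l) (hb : b ≠ 0)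
    (hu : u ∈ Set.Ico ((2:ℝ) ^ s * l * ((a / 2 ^ s + b : ℤ) : ℝ))
      ((2:ℝ) ^ s * l * (((a / 2 ^ s + b : ℤ) : ℝ) + 1)))
    (hv : v ∈ Set.Ico (l * a) (l * (a + 1))) : |u - nearEdge l a b| ≤ |u - v| := by
  have e : (a:ℝ) = 2 ^ s * ((a / 2 ^ s : ℤ) : ℝ) + ((a % 2 ^ s : ℤ) : ℝ) := by
    exact_mod_cast (Int.mul_ediv_add_emod a (2 ^ s)).symm
  have h1 : (0:ℝ) ≤ ((a % 2 ^ s : ℤ) : ℝ) := by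
    exact_mod_cast Int.emod_nonneg a (by positivity : (2:ℤ) ^ s ≠ 0)
  have h2 : ((a % 2 ^ s : ℤ) : ℝ) + 1 ≤ 2 ^ s := by
    exact_mod_cast Int.emod_lt_of_pos a (by positivity : (0:ℤ) < 2 ^ s)
  obtain ⟨hu1, hu2⟩ := hu
  obtain ⟨hv1, hv2⟩ := hv
  push_cast at hu1 hu2
  have hS : (0:ℝ) < 2 ^ s := by positivity
  set A : ℝ := ((a / 2 ^ s : ℤ) : ℝ) with hA
  set r : ℝ := ((a % 2 ^ s : ℤ) : ℝ) with hr
  unfold nearEdge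
  split_ifs with h
  · have hb' : (1:ℝ) ≤ b := by exact_mod_cast h
    have h3 : (a:ℝ) + 1 ≤ 2 ^ s * (A + b) := by nlinarith
    have h4 : l * (a + 1) ≤ u := by nlinarith
    rw [abs_of_nonneg (by linarith), abs_of_nonneg (by linarith)]
    linarith
  · have hb' : (b:ℝ) + 1 ≤ 0 := by exact_mod_cast (show b + 1 ≤ 0 by lia)
    have h3 : 2 ^ s * (A + b + 1) ≤ (a:ℝ) := by nlinarith
    have h4 : u ≤ l * a := by nlinarith
    rw [abs_of_nonpos (by linarith), abs_of_nonpos (by linarith)]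
    linarith

lemma le_abs_sub_center {l u : ℝ} {s : ℕ} {a b : ℤ} (hb : b ≠ 0)
    (hu : u ∈ Set.Ico ((2:ℝ) ^ s * l * ((a / 2 ^ s + b : ℤ) : ℝ))
      ((2:ℝ) ^ s * l * (((a / 2 ^ s + b : ℤ) : ℝ) + 1))) :
    l * ((|(b:ℝ)| - 1) * 2 ^ s + edgeGap s a b + 1 / 2) ≤ |u - l * (a + 1 / 2)| := by
  have e : (a:ℝ) = 2 ^ s * ((a / 2 ^ s : ℤ) : ℝ) + ((a % 2 ^ s : ℤ) : ℝ) := by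
    exact_mod_cast (Int.mul_ediv_add_emod a (2 ^ s)).symm
  obtain ⟨hu1, hu2⟩ := hu
  push_cast at hu1 hu2
  unfold edgeGap
  split_ifs with h
  · have hb' : (0:ℝ) < b := by exact_mod_cast h
    push_cast
    rw [abs_of_pos hb']
    refine le_trans (le_of_eq ?_) ((sub_le_sub_right hu1 _).trans (le_abs_self _))
    rw [e]; ring
  · have hb' : (b:ℝ) < 0 := by exact_mod_cast (show b < 0 by lia)
    rw [abs_of_neg hb']
    refine le_trans (le_of_eq ?_) ((sub_le_sub_left hu2.le _).trans
      ((neg_sub u (l * (a + 1 / 2))).symm.le.trans (neg_le_abs _)))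
    rw [e]; ring

/-- A product majorant of `|x i₀ - e|^{-1/2}` on the cube `‖x - c‖ ≤ l`. -/
lemma exists_prod_majorant {l : ℝ} (hl : 0 < l) (c : Fin n → ℝ) (i₀ : Fin n) (e : ℝ) :
    ∃ G : (Fin n → ℝ) → ℝ, Integrable G ∧ ∫ x, G x = 4 * (2 * l) ^ (-(1:ℝ) / 2) * (2 * l) ^ n ∧
      (∀ x, 0 ≤ G x) ∧
      ∀ x, ‖x - c‖ ≤ l → |x i₀ - e| ≤ 2 * l → G x = |x i₀ - e| ^ (-(1:ℝ) / 2) := by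
  classical
  set g : Fin n → ℝ → ℝ := fun i => if i = i₀ then fun u => nearKernel 1 (2 * l) ‖u - e‖
    else (Set.Icc (c i - l) (c i + l)).indicator 1 with hg
  have hI := integrable_nearKernel_norm (volume : Measure ℝ) (2 * l)
  have hE := integral_nearKernel_norm (volume : Measure ℝ) (R := 2 * l) (by linarith)
  rw [Module.finrank_self] at hI hE
  have hball : volume.real (Metric.ball (0:ℝ) 1) = 2 := by
    rw [measureReal_def, Real.volume_ball]; norm_num
  rw [hball] at hE
  have hgint : ∀ i, Integrable (g i) := by
    intro i
    simp only [hg]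
    split_ifs
    · exact hI.comp_sub_right e
    · exact (integrable_indicator_iff measurableSet_Icc).2 (integrableOn_const (by simp))
  have hval : ∀ i, ∫ u, g i u = (if i = i₀ then 2 * (2 * l) ^ (-(1:ℝ) / 2) * 2 else 1) * (2 * l) := by
    intro i
    simp only [hg]
    split_ifs
    · rw [integral_sub_right_eq_self (fun z => nearKernel 1 (2 * l) ‖z‖) e, hE,
        show (1:ℝ) / 2 = -1 / 2 + 1 by norm_num, Real.rpow_add_one (by positivity)]
      push_cast; ring
    · rw [integral_indicator_one measurableSet_Icc, Real.volume_real_Icc_of_le (by linarith)]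
      ring
  refine ⟨fun x => ∏ i, g i (x i), ?_, ?_, ?_, ?_⟩
  · exact Integrable.fintype_prod hgint
  · rw [integral_fintype_prod_volume_eq_prod]
    simp only [hval, Finset.prod_mul_distrib, Finset.prod_ite_eq', Finset.mem_univ, if_true,
      Finset.prod_const, Finset.card_univ, Fintype.card_fin]
    ring
  · intro x
    refine Finset.prod_nonneg fun i _ => ?_
    simp only [hg]
    split_ifs
    · exact nearKernel_nonneg (norm_nonneg _)
    · exact Set.indicator_nonneg (fun _ _ => zero_le_one) _
  · intro x hx hxe
    have h : ∀ i, g i (x i) = if i = i₀ then |x i₀ - e| ^ (-(1:ℝ) / 2) else 1 := by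
      intro i
      simp only [hg]
      split_ifs with hi
      · subst hi
        simp only [nearKernel, Real.norm_eq_abs]
        rw [Set.indicator_of_mem (Set.mem_Iic.2 hxe)]
        congr 1; norm_num
      · refine Set.indicator_of_mem ?_ _
        have := (norm_le_pi_norm (x - c) i).trans hx
        rw [Pi.sub_apply, Real.norm_eq_abs, abs_le] at this
        constructor <;> linarith
    simp [h]

lemma inorm_nonneg (m : Fin n → ℤ) : 0 ≤ inorm m := norm_nonneg _

lemma exists_abs_eq_inorm {m : Fin n → ℤ} (hm : m ≠ 0) :
    ∃ i, m i ≠ 0 ∧ inorm m = |m i| := by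
  obtain ⟨j, hj⟩ := Function.ne_iff.1 hm
  have : Nonempty (Fin n) := ⟨j⟩
  obtain ⟨i, hi⟩ := Finite.exists_max fun i => |m i|
  refine ⟨i, ?_, ?_⟩
  · have h1 := hi j
    have h2 := abs_pos.2 hj
    exact abs_pos.1 (h2.trans_le h1)
  · refine le_antisymm ((pi_norm_le_iff_of_nonneg (by positivity)).2 fun k => ?_) ?_
    · rw [Real.norm_eq_abs]; exact_mod_cast hi k
    · have h := norm_le_pi_norm (fun i => (m i : ℝ)) i
      rw [Real.norm_eq_abs] at h
      exact_mod_cast h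

/-! ### Pairings of singular integrals of Haar functions -/

/-- The geometry of a cube and a translate of its `s`-th ancestor. -/
lemma mem_translate_Ico {s : ℕ} {k : ℤ} {μ m : Fin n → ℤ} {x : Fin n → ℝ}
    (hx : dyadicIdx (k - s) x = ancestorIdx s μ + m) (i : Fin n) :
    x i ∈ Set.Ico ((2:ℝ) ^ s * (2:ℝ) ^ (-k) * ((μ i / 2 ^ s + m i : ℤ) : ℝ))
      ((2:ℝ) ^ s * (2:ℝ) ^ (-k) * (((μ i / 2 ^ s + m i : ℤ) : ℝ) + 1)) := by
  have h := mem_Ico_of_dyadicIdx hx i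
  have e : (2:ℝ) ^ (-(k - s)) = 2 ^ s * (2:ℝ) ^ (-k) := by
    rw [← zpow_natCast, ← zpow_add₀ (by norm_num)]; congr 1; ring
  have e2 : (ancestorIdx s μ + m) i = μ i / 2 ^ s + m i := by
    rw [Pi.add_apply, ancestorIdx, Int.fdiv_eq_ediv_of_nonneg _ (by positivity)]
  rwa [e, e2] at h

lemma le_dist_cubeCenter {s : ℕ} {k : ℤ} {μ m : Fin n → ℤ} {x : Fin n → ℝ}
    (hx : dyadicIdx (k - s) x = ancestorIdx s μ + m) {i : Fin n} (hi : m i ≠ 0) :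
    (2:ℝ) ^ (-k) * ((|(m i : ℝ)| - 1) * 2 ^ s + edgeGap s (μ i) (m i) + 1 / 2) ≤
      dist x (cubeCenter n k μ) :=
  (le_abs_sub_center hi (mem_translate_Ico hx i)).trans (dist_le_pi_dist x (cubeCenter n k μ) i)

lemma abs_pairing_le_of_bound {g f B : (Fin n → ℝ) → ℝ} (hB : Integrable B)
    (h : ∀ᵐ x, |g x * f x| ≤ B x) : |pairing g f| ≤ ∫ x, B x :=
  norm_integral_le_of_norm_le (f := fun x => g x * f x) hB h

lemma abs_czIntegral_haarFn_le {γ : ℝ} (hγ : 0 < γ) {K : (Fin n → ℝ) → (Fin n → ℝ) → ℝ}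
    (hK : IsNormalisedKernel n γ K) {k : ℤ} {μ : Fin n → ℤ} {η : Fin n → Bool}
    (hη : η ≠ fun _ => false) {x : Fin n → ℝ}
    (hx : (2:ℝ) ^ (-k) < dist x (cubeCenter n k μ)) :
    |czIntegral K (haarFn n k μ η) x| ≤ ((2:ℝ) ^ (-k)) ^ ((n:ℝ) / 2 + γ) *
      dist x (cubeCenter n k μ) ^ (-(n:ℝ) - γ) := by
  have h := abs_czIntegral_le_of_lt_dist hγ hK (integrable_haarFn k μ η)
    (integral_haar (q := (k, μ, η)) hη)
    (fun y hy => norm_sub_cubeCenter_le (dyadicIdx_of_haarFn_ne_zero hy)) hx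
  refine h.trans (le_of_eq ?_)
  rw [integral_abs_haarFn, Real.rpow_add (by positivity)]
  ring

/-- The pairing with a distant translate. -/
lemma abs_pairing_le_of_two_le {γ : ℝ} (hγ : 0 < γ) {K : (Fin n → ℝ) → (Fin n → ℝ) → ℝ}
    (hK : IsNormalisedKernel n γ K) (s : ℕ) {m : Fin n → ℤ} {i : Fin n} (hi : 2 ≤ |m i|)
    (k : ℤ) (μ : Fin n → ℤ) {η : Fin n → Bool} (hη : η ≠ fun _ => false) :
    |pairing (haarZero n (k - s) (ancestorIdx s μ + m)) (czIntegral K (haarFn n k μ η))| ≤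
      3 ^ ((n:ℝ) + γ) * (((2:ℝ) ^ s) ^ (-(n:ℝ) / 2) * (1 + |(m i : ℝ)|) ^ (-(n:ℝ) - γ) *
        (1 + edgeGap s (μ i) (m i) : ℝ) ^ (-γ)) := by
  set l : ℝ := (2:ℝ) ^ (-k) with hl
  have hl0 : 0 < l := by positivity
  set S : ℝ := (2:ℝ) ^ s with hS
  have hS0 : 0 < S := by positivity
  have hS1 : 1 ≤ S := one_le_pow₀ (by norm_num)
  have hN : (2:ℝ) ≤ |(m i : ℝ)| := by exact_mod_cast hi
  set N : ℝ := |(m i : ℝ)| with hN'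
  have hm0 : m i ≠ 0 := by intro h; simp [h] at hi
  have hd0 : (0:ℝ) ≤ edgeGap s (μ i) (m i) := by exact_mod_cast edgeGap_nonneg _ _ _
  have hd1 : (1:ℝ) + edgeGap s (μ i) (m i) ≤ S := by
    have := edgeGap_lt s (μ i) (m i)
    rw [hS]; exact_mod_cast (by lia : 1 + edgeGap s (μ i) (m i) ≤ 2 ^ s)
  set δ : ℝ := ((edgeGap s (μ i) (m i) : ℤ) : ℝ) with hδ
  have eL : (2:ℝ) ^ (-(k - s)) = S * l := by
    rw [hS, hl, ← zpow_natCast, ← zpow_add₀ (by norm_num)]; congr 1; ring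
  set A : ℝ := l ^ ((n:ℝ) / 2 + γ) * (S * l * ((1 + N) / 3)) ^ (-(n:ℝ) - γ) with hA
  have hA0 : 0 ≤ A := by positivity
  have hb : ∀ x, |haarZero n (k - s) (ancestorIdx s μ + m) x * czIntegral K (haarFn n k μ η) x| ≤
      A * |haarFn n (k - s) (ancestorIdx s μ + m) (fun _ => false) x| := by
    intro x
    rw [abs_mul, mul_comm]
    by_cases hx : haarFn n (k - s) (ancestorIdx s μ + m) (fun _ => false) x = 0
    · simp [haarZero, hx]
    refine mul_le_mul_of_nonneg_right ?_ (abs_nonneg _)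
    have h1 := le_dist_cubeCenter (dyadicIdx_of_haarFn_ne_zero hx) hm0
    rw [← hl, ← hS, ← hN', ← hδ] at h1
    have h2 : S * l * ((1 + N) / 3) ≤ dist x (cubeCenter n k μ) := by
      refine le_trans ?_ h1
      have : S * ((1 + N) / 3) ≤ (N - 1) * S + δ + 1 / 2 := by nlinarith
      nlinarith
    have h3 : l < dist x (cubeCenter n k μ) := by
      refine lt_of_lt_of_le ?_ h1
      have : 1 < (N - 1) * S + δ + 1 / 2 := by nlinarith
      nlinarith
    refine (abs_czIntegral_haarFn_le hγ hK hη h3).trans ?_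
    refine mul_le_mul_of_nonneg_left ?_ (by positivity)
    exact Real.rpow_le_rpow_of_nonpos (by positivity) h2 (by
      have : (0:ℝ) ≤ n := by positivity
      linarith)
  refine (abs_pairing_le_of_bound ((integrable_haarFn _ _ _).abs.const_mul A)
    (Filter.Eventually.of_forall hb)).trans ?_
  rw [integral_const_mul, integral_abs_haarFn, eL]
  have h4 : S ^ (-γ) ≤ (1 + δ) ^ (-γ) :=
    Real.rpow_le_rpow_of_nonpos (by positivity) hd1 (by linarith)
  have h5 : A * (S * l) ^ ((n:ℝ) / 2) =
      3 ^ ((n:ℝ) + γ) * (S ^ (-(n:ℝ) / 2) * (1 + N) ^ (-(n:ℝ) - γ) * S ^ (-γ)) := by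
    rw [hA, Real.mul_rpow (by positivity) (by positivity), Real.mul_rpow hS0.le hl0.le,
      Real.mul_rpow hS0.le hl0.le, Real.div_rpow (by positivity) (by norm_num),
      show (n:ℝ) + γ = -(-(n:ℝ) - γ) by ring, Real.rpow_neg (by norm_num : (0:ℝ) ≤ 3)]
    have e1 : S ^ (-(n:ℝ) / 2) * S ^ (-γ) = S ^ (-(n:ℝ) - γ) * S ^ ((n:ℝ) / 2) := by
      rw [← Real.rpow_add hS0, ← Real.rpow_add hS0]; congr 1; ring
    have e2 : l ^ ((n:ℝ) / 2 + γ) * l ^ (-(n:ℝ) - γ) * l ^ ((n:ℝ) / 2) = 1 := by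
      rw [← Real.rpow_add hl0, ← Real.rpow_add hl0, ← Real.rpow_zero l]; congr 1; ring
    calc _ = (l ^ ((n:ℝ) / 2 + γ) * l ^ (-(n:ℝ) - γ) * l ^ ((n:ℝ) / 2)) *
        ((S ^ (-(n:ℝ) - γ) * S ^ ((n:ℝ) / 2)) * (1 + N) ^ (-(n:ℝ) - γ) /
          3 ^ (-(n:ℝ) - γ)) := by ring
      _ = _ := by rw [e2, ← e1]; ring
  rw [h5]
  gcongr

/-- The pairing with an adjacent translate. -/
lemma exists_abs_pairing_le_of_abs_eq_one (hn : 0 < n) {γ : ℝ} (hγ : 0 < γ) :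
    ∃ C : ℝ, 0 ≤ C ∧ ∀ (K : (Fin n → ℝ) → (Fin n → ℝ) → ℝ), IsNormalisedKernel n γ K →
    ∀ (s : ℕ) (m : Fin n → ℤ) (i : Fin n), |m i| = 1 →
    ∀ (k : ℤ) (μ : Fin n → ℤ) (η : Fin n → Bool), (η ≠ fun _ => false) →
    |pairing (haarZero n (k - s) (ancestorIdx s μ + m)) (czIntegral K (haarFn n k μ η))| ≤
      C * (((2:ℝ) ^ s) ^ (-(n:ℝ) / 2) * (1 + edgeGap s (μ i) (m i) : ℝ) ^ (-γ)) := by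
  obtain ⟨D, hD0, hD⟩ := exists_abs_czIntegral_le_of_dist_le hn
  have : Nonempty (Fin n) := ⟨⟨0, hn⟩⟩
  set V : ℝ := n * volume.real (Metric.ball (0 : Fin n → ℝ) 1) with hV
  refine ⟨V * (γ⁻¹ * 2⁻¹ ^ (-γ)) + D * (4 * 2 ^ (-(1:ℝ) / 2) * 2 ^ n), by positivity, ?_⟩
  intro K hK s m i hi k μ η hη
  set l : ℝ := (2:ℝ) ^ (-k) with hl
  have hl0 : 0 < l := by positivity
  set S : ℝ := (2:ℝ) ^ s with hS
  have hS0 : 0 < S := by positivity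
  have hm0 : m i ≠ 0 := by intro h; simp [h] at hi
  have hN : |(m i : ℝ)| = 1 := by exact_mod_cast hi
  have hg0 := edgeGap_nonneg s (μ i) (m i)
  set δ : ℤ := edgeGap s (μ i) (m i) with hδ
  have hd0 : (0:ℝ) ≤ δ := by exact_mod_cast hg0
  have eL : (2:ℝ) ^ (-(k - s)) = S * l := by
    rw [hS, hl, ← zpow_natCast, ← zpow_add₀ (by norm_num)]; congr 1; ring
  set c := cubeCenter n k μ with hc
  set e : ℝ := nearEdge l (μ i) (m i) with he
  obtain ⟨G, hGi, hGv, hG0, hG⟩ := exists_prod_majorant hl0 c i e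
  set E : ℝ := if δ = 0 then 1 else 0 with hE
  have hE0 : 0 ≤ E := by rw [hE]; split_ifs <;> norm_num
  have hE1 : E ≤ (1 + δ : ℝ) ^ (-γ) := by
    rw [hE]; split_ifs with h
    · simp [h]
    · positivity
  set R : ℝ := 2⁻¹ * (1 + δ) * l with hR
  have hR0 : 0 < R := by positivity
  have hFi := (integrable_farKernel_norm (volume : Measure (Fin n → ℝ)) hγ hR0).comp_sub_right c
  have hFv := integral_farKernel_norm (volume : Measure (Fin n → ℝ)) hγ hR0
  rw [Module.finrank_fin_fun] at hFi hFv
  rw [← integral_sub_right_eq_self _ c, ← hV] at hFv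
  set A₁ : ℝ := (S * l) ^ (-(n:ℝ) / 2) * l ^ ((n:ℝ) / 2 + γ) with hA₁
  set A₂ : ℝ := (S * l) ^ (-(n:ℝ) / 2) * (E * (D * (l ^ (-(n:ℝ) / 2) * l ^ ((1:ℝ) / 2)))) with hA₂
  have hA₁0 : 0 ≤ A₁ := by positivity
  have hA₂0 : 0 ≤ A₂ := by positivity
  have hae : ∀ᵐ x : Fin n → ℝ, x i ≠ e := by
    rw [ae_iff]
    simpa [volume_pi] using Measure.pi_hyperplane (fun _ : Fin n => (volume : Measure ℝ)) i e
  have hb : ∀ᵐ x : Fin n → ℝ,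
      |haarZero n (k - s) (ancestorIdx s μ + m) x * czIntegral K (haarFn n k μ η) x| ≤
      A₁ * farKernel n γ R ‖x - c‖ + A₂ * G x := by
    filter_upwards [hae] with x hxe
    have hf0 : 0 ≤ farKernel n γ R ‖x - c‖ := farKernel_nonneg (norm_nonneg _)
    rw [abs_mul]
    by_cases hx : haarFn n (k - s) (ancestorIdx s μ + m) (fun _ => false) x = 0
    · rw [haarZero, hx, abs_zero, zero_mul]
      have := hG0 x
      positivity
    have hidx := dyadicIdx_of_haarFn_ne_zero hx
    have h0 : |haarZero n (k - s) (ancestorIdx s μ + m) x| ≤ (S * l) ^ (-(n:ℝ) / 2) := by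
      rw [← eL]; exact abs_haarFn_le _ _ _ _
    have h1 := le_dist_cubeCenter hidx hm0
    rw [← hl, ← hS, hN, ← hδ, sub_self, zero_mul, zero_add] at h1
    rcases lt_or_ge l (dist x c) with h2 | h2
    · have h3 := abs_czIntegral_haarFn_le hγ hK hη h2
      have h4 : farKernel n γ R ‖x - c‖ = dist x c ^ (-(n:ℝ) - γ) := by
        rw [farKernel, Set.indicator_of_mem, dist_eq_norm]
        rw [Set.mem_Ici, ← dist_eq_norm]
        refine le_trans ?_ h1
        rw [hR]; nlinarith
      calc _ ≤ (S * l) ^ (-(n:ℝ) / 2) * (l ^ ((n:ℝ) / 2 + γ) * dist x c ^ (-(n:ℝ) - γ)) := by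
            gcongr
        _ = A₁ * farKernel n γ R ‖x - c‖ := by rw [h4]; ring
        _ ≤ _ := le_add_of_nonneg_right (mul_nonneg hA₂0 (hG0 x))
    · have hδ0 : δ = 0 := by
        by_contra hne
        have : (1:ℝ) ≤ δ := by exact_mod_cast (by lia : 1 ≤ δ)
        nlinarith
      have hE' : E = 1 := by rw [hE, if_pos hδ0]
      have hec : |e - c i| ≤ l / 2 := abs_nearEdge_sub hl0.le _ _
      have hxc : |x i - c i| ≤ l := by
        have := dist_le_pi_dist x c i
        rw [Real.dist_eq] at this
        linarith
      have h3 : |x i - e| ≤ 2 * l := by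
        have := abs_sub_le (x i) (c i) e
        rw [abs_sub_comm (c i)] at this
        linarith
      have h4 := hD γ K hK (haarFn n k μ η) c x l (l ^ (-(n:ℝ) / 2)) |x i - e| hl0.le
        (abs_pos.2 (sub_ne_zero.2 hxe)) (abs_haarFn_le k μ η)
        (fun y hy => norm_sub_cubeCenter_le (dyadicIdx_of_haarFn_ne_zero hy))
        (fun y hy => by
          refine (abs_sub_nearEdge_le hl0 hm0 (mem_translate_Ico hidx i)
            (mem_Ico_of_dyadicIdx (dyadicIdx_of_haarFn_ne_zero hy) i)).trans ?_
          have := dist_le_pi_dist x y i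
          rwa [Real.dist_eq] at this) h2
      have h5 := hG x (by rwa [← dist_eq_norm]) h3
      calc _ ≤ (S * l) ^ (-(n:ℝ) / 2) *
            (D * (l ^ (-(n:ℝ) / 2) * l ^ ((1:ℝ) / 2) * |x i - e| ^ (-(1:ℝ) / 2))) := by
            gcongr
        _ = A₂ * G x := by rw [hA₂, hE', h5]; ring
        _ ≤ _ := le_add_of_nonneg_left (mul_nonneg hA₁0 hf0)
  refine (abs_pairing_le_of_bound ((hFi.const_mul A₁).add (hGi.const_mul A₂)) hb).trans ?_
  have hsum : ∫ x, ((fun x => A₁ * farKernel n γ R ‖x - c‖) + fun x => A₂ * G x) x =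
      A₁ * (∫ x, farKernel n γ R ‖x - c‖) + A₂ * ∫ x, G x := by
    rw [integral_add' (hFi.const_mul A₁) (hGi.const_mul A₂), integral_const_mul,
      integral_const_mul]
  rw [hsum, hFv, hGv]
  have e1 : A₁ * (V * (γ⁻¹ * R ^ (-γ))) =
      V * (γ⁻¹ * 2⁻¹ ^ (-γ)) * (S ^ (-(n:ℝ) / 2) * (1 + δ : ℝ) ^ (-γ)) := by
    have hd1 : (0:ℝ) ≤ 1 + δ := by positivity
    rw [hA₁, hR, Real.mul_rpow (mul_nonneg (by norm_num) hd1) hl0.le,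
      Real.mul_rpow (by norm_num) hd1, Real.mul_rpow hS0.le hl0.le]
    have : l ^ (-(n:ℝ) / 2) * l ^ ((n:ℝ) / 2 + γ) * l ^ (-γ) = 1 := by
      rw [← Real.rpow_add hl0, ← Real.rpow_add hl0, ← Real.rpow_zero l]; congr 1; ring
    calc _ = (l ^ (-(n:ℝ) / 2) * l ^ ((n:ℝ) / 2 + γ) * l ^ (-γ)) *
        (V * (γ⁻¹ * 2⁻¹ ^ (-γ)) * (S ^ (-(n:ℝ) / 2) * (1 + δ : ℝ) ^ (-γ))) := by ring
      _ = _ := by rw [this, one_mul]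
  have e2 : A₂ * (4 * (2 * l) ^ (-(1:ℝ) / 2) * (2 * l) ^ n) =
      D * (4 * 2 ^ (-(1:ℝ) / 2) * 2 ^ n) * (S ^ (-(n:ℝ) / 2) * E) := by
    rw [hA₂, Real.mul_rpow zero_le_two hl0.le, Real.mul_rpow hS0.le hl0.le, mul_pow,
      ← Real.rpow_natCast l]
    have : l ^ (-(n:ℝ) / 2) * l ^ (-(n:ℝ) / 2) * l ^ ((1:ℝ) / 2) * l ^ (-(1:ℝ) / 2) * l ^ (n:ℝ)
        = 1 := by
      rw [← Real.rpow_add hl0, ← Real.rpow_add hl0, ← Real.rpow_add hl0, ← Real.rpow_add hl0,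
        ← Real.rpow_zero l]
      congr 1; ring
    calc _ = (l ^ (-(n:ℝ) / 2) * l ^ (-(n:ℝ) / 2) * l ^ ((1:ℝ) / 2) * l ^ (-(1:ℝ) / 2) *
        l ^ (n:ℝ)) * (D * (4 * 2 ^ (-(1:ℝ) / 2) * 2 ^ n) * (S ^ (-(n:ℝ) / 2) * E)) := by ring
      _ = _ := by rw [this, one_mul]
  rw [e1, e2, add_mul]
  gcongr

/-- Decay of the pairings of a singular integral of a Haar function with the translates of the
ancestor. -/
theorem exists_abs_pairing_le (hn : 0 < n) {γ : ℝ} (hγ : 0 < γ) :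
    ∃ C : ℝ, 0 ≤ C ∧ ∀ (K : (Fin n → ℝ) → (Fin n → ℝ) → ℝ), IsNormalisedKernel n γ K →
    ∀ (s : ℕ) (m : Fin n → ℤ) (i : Fin n), m i ≠ 0 → inorm m = |m i| →
    ∀ (k : ℤ) (μ : Fin n → ℤ) (η : Fin n → Bool), (η ≠ fun _ => false) →
    |pairing (haarZero n (k - s) (ancestorIdx s μ + m)) (czIntegral K (haarFn n k μ η))| ≤
      C * (((2:ℝ) ^ s) ^ (-(n:ℝ) / 2) * (1 + inorm m) ^ (-(n:ℝ) - γ) *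
        (1 + edgeGap s (μ i) (m i) : ℝ) ^ (-γ)) := by
  obtain ⟨C, hC0, hC⟩ := exists_abs_pairing_le_of_abs_eq_one hn hγ
  refine ⟨3 ^ ((n:ℝ) + γ) + C * 2 ^ ((n:ℝ) + γ), by positivity, ?_⟩
  intro K hK s m i hm0 hm k μ η hη
  have hd0 : (0:ℝ) ≤ edgeGap s (μ i) (m i) := by exact_mod_cast edgeGap_nonneg _ _ _
  have hm1 : 1 ≤ |m i| := Int.one_le_abs hm0
  have hN := inorm_nonneg m
  have hmul : 0 ≤ ((2:ℝ) ^ s) ^ (-(n:ℝ) / 2) * (1 + inorm m) ^ (-(n:ℝ) - γ) *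
        (1 + edgeGap s (μ i) (m i) : ℝ) ^ (-γ) := by positivity
  rw [add_mul]
  rcases hm1.lt_or_eq with h | h
  · have := abs_pairing_le_of_two_le hγ hK s (m := m) (i := i) (by lia) k μ hη
    have e : |(m i : ℝ)| = inorm m := by rw [hm]; push_cast; rfl
    rw [e] at this
    exact this.trans (le_add_of_nonneg_right (mul_nonneg (by positivity) hmul))
  · refine (hC K hK s m i h.symm k μ η hη).trans ?_
    have e : (1 + inorm m) = 2 := by rw [hm, ← h]; norm_num
    refine le_trans (le_of_eq ?_) (le_add_of_nonneg_left (mul_nonneg (by positivity) hmul))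
    rw [e, show (n:ℝ) + γ = -(-(n:ℝ) - γ) by ring, Real.rpow_neg (by norm_num : (0:ℝ) ≤ 2)]
    have : (2:ℝ) ^ (-(n:ℝ) - γ) ≠ 0 := by positivity
    field_simp

lemma card_filter_anc_le (F : Finset (HaarIndex n)) (s j : ℕ) (i : Fin n) (b : ℤ)
    (Q : HaarIndex n) :
    (((F.filter fun q => edgeGap s (q.2.1 i) b < 2 ^ j).filter fun q => q.anc s = Q).card : ℝ) *
      (((2:ℝ) ^ s) ^ n)⁻¹ ≤ (2:ℝ) ^ ((j:ℝ) - s) := by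
  classical
  set I : Fin n → Finset ℤ := fun i' => if i' = i then
      (if 0 < b then Finset.Ico (2 ^ s - 2 ^ j) (2 ^ s) else Finset.Ico 0 (2 ^ j))
    else Finset.Ico 0 (2 ^ s) with hI
  have hpow : ∀ a : ℕ, ((((2:ℤ) ^ a).toNat : ℕ) : ℝ) = 2 ^ a := fun a => by
    have := Int.toNat_of_nonneg (by positivity : (0:ℤ) ≤ 2 ^ a)
    exact_mod_cast this
  have hcard : ∀ i', ((I i').card : ℝ) = (if i' = i then (2:ℝ) ^ j / 2 ^ s else 1) * 2 ^ s := by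
    intro i'
    simp only [hI]
    split_ifs
    · rw [Int.card_Ico]; simp [hpow]
    · rw [Int.card_Ico]; simp [hpow]
    · rw [Int.card_Ico]; simp [hpow]
  have h1 : ((F.filter fun q => edgeGap s (q.2.1 i) b < 2 ^ j).filter
      fun q => q.anc s = Q).card ≤ (Fintype.piFinset I).card := by
    refine Finset.card_le_card_of_injOn (fun q i' => q.2.1 i' % 2 ^ s) ?_ ?_
    · intro q hq
      simp only [Finset.coe_filter, Finset.mem_filter, Set.mem_ofPred_eq] at hq
      obtain ⟨⟨-, hq⟩, -⟩ := hq
      rw [Finset.mem_coe, Fintype.mem_piFinset]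
      intro i'
      have a1 := Int.emod_nonneg (q.2.1 i') (by positivity : (2:ℤ) ^ s ≠ 0)
      have a2 := Int.emod_lt_of_pos (q.2.1 i') (by positivity : (0:ℤ) < 2 ^ s)
      simp only [hI]
      unfold edgeGap at hq
      split_ifs with hi' hb <;> rw [Finset.mem_Ico]
      · subst hi'
        rw [if_pos hb] at hq
        constructor <;> lia
      · subst hi'
        rw [if_neg hb] at hq
        exact ⟨a1, hq⟩
      · exact ⟨a1, a2⟩
    · intro q hq q' hq' h
      simp only [Finset.coe_filter, Finset.mem_filter, Set.mem_ofPred_eq] at hq hq'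
      have e : q.anc s = q'.anc s := hq.2.trans hq'.2.symm
      simp only [HaarIndex.anc, Prod.mk.injEq] at e
      obtain ⟨e1, e2, e3⟩ := e
      refine Prod.ext (by linarith) (Prod.ext ?_ e3)
      funext i'
      have e4 : q.2.1 i' / 2 ^ s = q'.2.1 i' / 2 ^ s := by
        have := congrFun e2 i'
        rwa [ancestorIdx, ancestorIdx, Int.fdiv_eq_ediv_of_nonneg _ (by positivity),
          Int.fdiv_eq_ediv_of_nonneg _ (by positivity)] at this
      have e5 : q.2.1 i' % 2 ^ s = q'.2.1 i' % 2 ^ s := congrFun h i'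
      rw [← Int.mul_ediv_add_emod (q.2.1 i') (2 ^ s), e4, e5, Int.mul_ediv_add_emod]
  have h2 : ((Fintype.piFinset I).card : ℝ) = (2:ℝ) ^ j / 2 ^ s * (2 ^ s) ^ n := by
    rw [Fintype.card_piFinset]
    push_cast
    simp only [hcard, Finset.prod_mul_distrib, Finset.prod_ite_eq', Finset.mem_univ, if_true,
      Finset.prod_const, Finset.card_univ, Fintype.card_fin]
  have h3 : (2:ℝ) ^ ((j:ℝ) - s) = (2:ℝ) ^ j / 2 ^ s := by
    rw [Real.rpow_sub (by norm_num), Real.rpow_natCast, Real.rpow_natCast]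
  rw [h3, ← div_eq_mul_inv, div_le_iff₀ (by positivity), ← h2]
  exact_mod_cast h1

lemma rpow_neg_le_layer_sum {γ : ℝ} (hγ : 0 < γ) {s : ℕ} {d : ℤ} (hd0 : 0 ≤ d) (hd : d < 2 ^ s) :
    (1 + d : ℝ) ^ (-(2 * γ)) ≤ 2 ^ (2 * γ) * ∑ j ∈ Finset.range (s + 1),
      (2:ℝ) ^ (-(2 * γ * j)) * (if d < 2 ^ j then 1 else 0) := by
  classical
  have hex : ∃ j, d < 2 ^ j := ⟨s, hd⟩
  set j := Nat.find hex with hj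
  have h1 : d < 2 ^ j := Nat.find_spec hex
  have hjs : j ≤ s := Nat.find_le hd
  have h2 : (2:ℝ) ^ (j:ℝ) ≤ 2 * (1 + d) := by
    rw [Real.rpow_natCast]
    rcases Nat.eq_zero_or_pos j with h | h
    · rw [h]
      have : (0:ℝ) ≤ d := by exact_mod_cast hd0
      norm_num
      linarith
    · have h3 := Nat.find_min hex (show j - 1 < j by lia)
      rw [not_lt] at h3
      have h4 : (2:ℝ) ^ (j - 1) ≤ d := by exact_mod_cast h3
      rw [show j = j - 1 + 1 by lia, pow_succ]
      linarith
  have hd' : (0:ℝ) ≤ d := by exact_mod_cast hd0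
  have h3 : (1 + d : ℝ) ^ (-(2 * γ)) ≤ 2 ^ (2 * γ) * (2:ℝ) ^ (-(2 * γ * j)) := by
    have e : (2:ℝ) ^ (-(2 * γ * j)) = ((2:ℝ) ^ (j:ℝ)) ^ (-(2 * γ)) := by
      rw [← Real.rpow_mul (by norm_num)]; congr 1; ring
    have h4 := Real.rpow_le_rpow_of_nonpos (by positivity) h2 (by linarith : -(2 * γ) ≤ 0)
    rw [Real.mul_rpow (by norm_num) (by positivity)] at h4
    rw [e]
    refine le_trans (le_of_eq ?_) (mul_le_mul_of_nonneg_left h4 (by positivity))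
    rw [← mul_assoc, ← Real.rpow_add (by norm_num)]
    simp
  refine h3.trans (mul_le_mul_of_nonneg_left ?_ (by positivity))
  have h5 := Finset.single_le_sum (f := fun j : ℕ =>
    (2:ℝ) ^ (-(2 * γ * j)) * (if d < 2 ^ j then 1 else 0)) (s := Finset.range (s + 1))
    (fun i _ => mul_nonneg (by positivity) (by split_ifs <;> norm_num))
    (Finset.mem_range.2 (by lia : j < s + 1))
  simpa [h1] using h5

/-! ### Layered coefficients and the main estimate -/

/-- The coefficients of a singular integral against translated ancestors are layered. -/
theorem exists_layeredCoeff (hn : 0 < n) {γ : ℝ} (hγ : 0 < γ) :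
    ∃ C : ℝ, 0 ≤ C ∧ ∀ (K : (Fin n → ℝ) → (Fin n → ℝ) → ℝ), IsNormalisedKernel n γ K →
    ∀ (s : ℕ) (m : Fin n → ℤ), m ≠ 0 → ∀ F : Finset (HaarIndex n),
    (∀ q ∈ F, q.2.2 ≠ fun _ => false) →
    ∃ G, LayeredCoeff γ s F (fun q => pairing (haarZero n (q.1 - s) (ancestorIdx s q.2.1 + m))
      (czIntegral K (haarFn n q.1 q.2.1 q.2.2))) (C * (1 + inorm m) ^ (-(n:ℝ) - γ)) G := by
  obtain ⟨C, hC0, hC⟩ := exists_abs_pairing_le hn hγ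
  refine ⟨C * 2 ^ γ, by positivity, ?_⟩
  intro K hK s m hm F hF
  obtain ⟨i, hi0, hi⟩ := exists_abs_eq_inorm hm
  refine ⟨fun j => F.filter fun q => edgeGap s (q.2.1 i) (m i) < 2 ^ j,
    fun j => Finset.filter_subset _ _, fun q hq => ?_,
    fun j _ Q => card_filter_anc_le F s j i (m i) Q⟩
  have h1 := hC K hK s m i hi0 hi q.1 q.2.1 q.2.2 (hF q hq)
  have hd0 := edgeGap_nonneg s (q.2.1 i) (m i)
  have h2 := rpow_neg_le_layer_sum hγ hd0 (edgeGap_lt s (q.2.1 i) (m i))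
  simp only [Finset.mem_filter, hq, true_and]
  set d := edgeGap s (q.2.1 i) (m i) with hd
  have hd0' : (0:ℝ) ≤ d := by exact_mod_cast hd0
  have hN := inorm_nonneg m
  rw [← sq_abs]
  refine (pow_le_pow_left₀ (abs_nonneg _) h1 2).trans ?_
  set T := ∑ j ∈ Finset.range (s + 1), (2:ℝ) ^ (-(2 * γ * j)) * (if d < 2 ^ j then (1:ℝ) else 0)
  have e1 : (((2:ℝ) ^ s) ^ (-(n:ℝ) / 2)) ^ 2 = (((2:ℝ) ^ s) ^ n)⁻¹ := by
    rw [← Real.rpow_natCast (((2:ℝ) ^ s) ^ (-(n:ℝ) / 2)), ← Real.rpow_mul (by positivity),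
      ← Real.rpow_natCast ((2:ℝ) ^ s) n, ← Real.rpow_neg (by positivity)]
    congr 1; push_cast; ring
  have e2 : ((1 + d : ℝ) ^ (-γ)) ^ 2 = (1 + d : ℝ) ^ (-(2 * γ)) := by
    rw [← Real.rpow_natCast, ← Real.rpow_mul (by positivity)]
    congr 1; push_cast; ring
  have e3 : ((2:ℝ) ^ γ) ^ 2 = 2 ^ (2 * γ) := by
    rw [← Real.rpow_natCast, ← Real.rpow_mul (by positivity)]
    congr 1; push_cast; ring
  rw [mul_pow, mul_pow, mul_pow, e1, e2, mul_pow, mul_pow, e3]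
  calc C ^ 2 * ((((2:ℝ) ^ s) ^ n)⁻¹ * ((1 + inorm m) ^ (-(n:ℝ) - γ)) ^ 2 *
        (1 + d : ℝ) ^ (-(2 * γ))) ≤
      C ^ 2 * ((((2:ℝ) ^ s) ^ n)⁻¹ * ((1 + inorm m) ^ (-(n:ℝ) - γ)) ^ 2 *
        (2 ^ (2 * γ) * T)) := by gcongr
    _ = _ := by ring

end

/-- The estimate (4.6) for the operators `Λ_{s,m}` acting on the Haar basis by
`Λ_{s,m} h^η_I = ⟨h⁰_{I^{(s)}∔m}, T h^η_I⟩ h^η_{I^{(s)}}`, extended linearly to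
functions with finite Haar expansion. -/
theorem statement10 (n : ℕ) (hn : 0 < n) (p γ : ℝ) (hp : 1 < p)
    (hγ0 : 0 < γ) (hγ1 : γ ≤ 1) :
    ∃ C : ℝ, 0 < C ∧
      ∀ K : (Fin n → ℝ) → (Fin n → ℝ) → ℝ, IsNormalisedKernel n γ K →
      ∀ (s : ℕ) (m : Fin n → ℤ), m ≠ 0 →
      ∀ (F : Finset (ℤ × (Fin n → ℤ) × (Fin n → Bool)))
        (c : ℤ × (Fin n → ℤ) × (Fin n → Bool) → ℝ),
        (∀ q ∈ F, q.2.2 ≠ (fun _ => false)) →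
      ∀ f : (Fin n → ℝ) → ℝ,
        (f = fun x => ∑ q ∈ F, c q * haarFn n q.1 q.2.1 q.2.2 x) →
        eLpNorm
            (fun x => ∑ q ∈ F,
              c q *
                pairing (haarZero n (q.1 - s) (ancestorIdx s q.2.1 + m))
                  (czIntegral K (haarFn n q.1 q.2.1 q.2.2)) *
                haarFn n (q.1 - s) (ancestorIdx s q.2.1) q.2.2 x)
            (ENNReal.ofReal p) volume ≤
          ENNReal.ofReal
              (C * (1 + (s:ℝ)) * (2:ℝ) ^ (-(s:ℝ) * min γ (min (1/2) (1 - 1/p))) *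
                (1 + inorm m) ^ (-(n:ℝ) - γ)) *
            eLpNorm f (ENNReal.ofReal p) volume := by
  obtain ⟨C₁, hC₁, h₁⟩ := exists_eLpNorm_haarShift_le n hp
  obtain ⟨C₂, hC₂, h₂⟩ := exists_layeredCoeff hn hγ0
  refine ⟨C₁ * C₂ + 1, by positivity, ?_⟩
  rintro K hK s m hm F c hF f rfl
  obtain ⟨G, hG⟩ := h₂ K hK s m hm F hF
  have hN := inorm_nonneg m
  have h := h₁ γ (min γ (min (1/2) (1 - 1/p))) (min_le_left _ _)
    ((min_le_right _ _).trans (min_le_left _ _)) ((min_le_right _ _).trans (min_le_right _ _))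
    s F c _ _ G (by positivity) hF hG
  refine h.trans (mul_le_mul_left (ENNReal.ofReal_le_ofReal ?_) _)
  set κ := min γ (min (1/2) (1 - 1/p))
  have hX : 0 ≤ (1 + (s:ℝ)) * (2:ℝ) ^ (-(s:ℝ) * κ) * (1 + inorm m) ^ (-(n:ℝ) - γ) := by positivity
  calc _ = C₁ * C₂ * ((1 + (s:ℝ)) * (2:ℝ) ^ (-(s:ℝ) * κ) * (1 + inorm m) ^ (-(n:ℝ) - γ)) := by ring
    _ ≤ (C₁ * C₂ + 1) * ((1 + (s:ℝ)) * (2:ℝ) ^ (-(s:ℝ) * κ) * (1 + inorm m) ^ (-(n:ℝ) - γ)) := by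
        gcongr; linarith
    _ = _ := by ring

end
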